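/- Let ℓ be a prime and K a number field containing the ℓ-th roots of unity. Let 𝒞 ∈ Cl(K) be a realizable Steinitz class for degree-ℓ cyclic extensions of K, and let 𝔔 be a possible value of 𝔏_{L/K} for such extensions, with ρ_𝔔 the density of degree-ℓ cyclic extensions having 𝔏_{L/K} = 𝔔 (ordered by N(𝔉_{L/K})). Then lim_{X→∞} #{L/K : Gal(L/K) ≅ ℤ/ℓℤ, N(𝔉_{L/K}) ≤ X, St(𝒪_L) = 𝒞, 𝔏_{L/K} = 𝔔} / #{L/K : Gal(L/K) ≅ ℤ/ℓℤ, N(𝔉_{L/K}) ≤ X, St(𝒪_L) = 𝒞} = ρ_𝔔. -/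

import Mathlib

open NumberField Filter
open scoped nonZeroDivisors

noncomputable section

/-- The relative discriminant ideal of `L/K`. -/
def relDisc (K L : Type*) [Field K] [NumberField K] [Field L] [Algebra K L] :
    Ideal (𝓞 K) :=
  Ideal.span {d : 𝓞 K | ∃ b : Module.Basis (Fin (Module.finrank K L)) K L,
    (∀ i, IsIntegral ℤ (b i)) ∧ algebraMap (𝓞 K) K d = Algebra.discr K ⇑b}

/-- `c` is the Steinitz class of `L/K`. -/
def IsSteinitzClass (K : Type*) [Field K] [NumberField K] (L : Type*) [Field L]
    [Algebra K L] (c : ClassGroup (𝓞 K)) : Prop :=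
  ∃ I : (Ideal (𝓞 K))⁰, ClassGroup.mk0 I = c ∧
    Nonempty ((𝓞 L) ≃ₗ[𝓞 K] ((Fin (Module.finrank K L - 1) → 𝓞 K) × (I : Ideal (𝓞 K))))

/-- `L/K` is Galois with Galois group `ℤ/ℓℤ`. -/
def IsCyclicExt (ℓ : ℕ) (K L : Type*) [Field K] [Field L] [Algebra K L] : Prop :=
  IsGalois K L ∧ Nonempty ((L ≃ₐ[K] L) ≃* Multiplicative (ZMod ℓ))

/-- `I = Lp * F` where `Lp` is the `ℓ`-part (supported on primes dividing `l`) and `F` is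
the `ℓ`-free part (coprime to `l`). -/
def IsLPartition {R : Type*} [CommRing R] (l I Lp F : Ideal R) : Prop :=
  I = Lp * F ∧ (∀ p : Ideal R, p.IsPrime → p ∣ Lp → p ∣ l) ∧
    (∀ p : Ideal R, p.IsPrime → p ∣ F → ¬ p ∣ l)

section SteinitzDensity
set_option linter.unusedSectionVars false
open Filter Topology Asymptotics

/-- The number of elements of `s` of size at most `X`. -/
def sizeCount {T : Type*} (N : T → ℕ) (s : Set T) (X : ℝ) : ℝ :=
  ({t | t ∈ s ∧ (N t : ℝ) ≤ X}.ncard : ℝ)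

/-- Sublevel sets of the size function are finite. -/
def FiniteSublevels {T : Type*} (N : T → ℕ) : Prop :=
  ∀ X : ℝ, {t | (N t : ℝ) ≤ X}.Finite

namespace SizeCount

variable {T : Type*} {N : T → ℕ}

theorem finite (hN : FiniteSublevels N) (s : Set T) (X : ℝ) :
    {t | t ∈ s ∧ (N t : ℝ) ≤ X}.Finite :=
  (hN X).subset fun _ h => h.2

theorem nonneg (s : Set T) (X : ℝ) : 0 ≤ sizeCount N s X := Nat.cast_nonneg _

theorem mono (hN : FiniteSublevels N) {s t : Set T} (h : s ⊆ t) {X Y : ℝ} (hXY : X ≤ Y) :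
    sizeCount N s X ≤ sizeCount N t Y :=
  Nat.cast_le.2 (Set.ncard_le_ncard (fun _ hx => ⟨h hx.1, hx.2.trans hXY⟩) (finite hN _ _))

theorem eq_zero_of_lt_one (h1 : ∀ t, 1 ≤ N t) (s : Set T) {X : ℝ} (hX : X < 1) :
    sizeCount N s X = 0 := by
  have : {t | t ∈ s ∧ (N t : ℝ) ≤ X} = ∅ := by
    ext t
    simp only [Set.mem_ofPred_eq, Set.mem_empty_iff_false, iff_false, not_and, not_le]
    intro _
    exact hX.trans_le (by exact_mod_cast h1 t)
  simp [sizeCount, this]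

theorem congr_equiv {T' : Type*} {N' : T' → ℕ} (e : T ≃ T') {s : Set T} {s' : Set T'}
    {X X' : ℝ} (h : ∀ t, (t ∈ s ∧ (N t : ℝ) ≤ X) ↔ (e t ∈ s' ∧ (N' (e t) : ℝ) ≤ X')) :
    sizeCount N s X = sizeCount N' s' X' := by
  unfold sizeCount
  congr 1
  rw [← Set.ncard_image_of_injective _ e.injective]
  congr 1
  ext t'
  constructor
  · rintro ⟨t, ht, rfl⟩
    exact (h t).1 ht
  · intro ht
    exact ⟨e.symm t', (h _).2 (by simpa using ht), by simp⟩

theorem union_disjoint (hN : FiniteSublevels N) {s t : Set T} (h : Disjoint s t) (X : ℝ) :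
    sizeCount N (s ∪ t) X = sizeCount N s X + sizeCount N t X := by
  unfold sizeCount
  rw [← Nat.cast_add, ← Set.ncard_union_eq _ (finite hN _ _) (finite hN _ _)]
  · congr 2
    ext x
    simp only [Set.mem_union, Set.mem_ofPred_eq]
    tauto
  · rw [Set.disjoint_left] at h ⊢
    exact fun x hx hx' => h hx.1 hx'.1

theorem sum_fiber {G : Type*} [Fintype G] (hN : FiniteSublevels N) (κ : T → G) (s : Set T)
    (X : ℝ) : ∑ g, sizeCount N (s ∩ {t | κ t = g}) X = sizeCount N s X := by
  classical
  unfold sizeCount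
  rw [← Nat.cast_sum]
  congr 1
  rw [Set.ncard_eq_toFinset_card _ (finite hN s X),
    Finset.card_eq_sum_card_fiberwise (f := κ) (t := Finset.univ) (fun _ _ => Finset.mem_univ _)]
  refine Finset.sum_congr rfl fun g _ => ?_
  rw [Set.ncard_eq_toFinset_card _ (finite hN _ X)]
  congr 1
  ext t
  simp
  tauto

end SizeCount

section Convolution

open SizeCount

variable {A B : Type*} {NA : A → ℕ} {NB : B → ℕ}

theorem FiniteSublevels.prod (hA : FiniteSublevels NA) (hB : FiniteSublevels NB)
    (hA1 : ∀ a, 1 ≤ NA a) (hB1 : ∀ b, 1 ≤ NB b) :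
    FiniteSublevels (fun x : A × B => NA x.1 * NB x.2) := by
  intro X
  refine ((hA X).prod (hB X)).subset ?_
  rintro ⟨a, b⟩ h
  have h' : ((NA a * NB b : ℕ) : ℝ) ≤ X := h
  constructor
  · exact le_trans (by exact_mod_cast Nat.le_mul_of_pos_right _ (hB1 b)) h'
  · exact le_trans (by exact_mod_cast Nat.le_mul_of_pos_left _ (hA1 a)) h'

theorem sizeCount_prod (hA : FiniteSublevels NA) (hB : FiniteSublevels NB)
    (hA1 : ∀ a, 1 ≤ NA a) (hB1 : ∀ b, 1 ≤ NB b) (s : Set A) (t : Set B) (X Z : ℝ) (hXZ : X ≤ Z) :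
    sizeCount (fun x : A × B => NA x.1 * NB x.2) (s ×ˢ t) X =
      ∑ b ∈ (finite hB t Z).toFinset, sizeCount NA s (X / NB b) := by
  classical
  unfold sizeCount
  rw [← Nat.cast_sum]
  congr 1
  rw [Set.ncard_eq_toFinset_card _ (finite (hA.prod hB hA1 hB1) (s ×ˢ t) X),
    Finset.card_eq_sum_card_fiberwise (f := Prod.snd) (t := (finite hB t Z).toFinset)]
  · refine Finset.sum_congr rfl fun b hb => ?_
    have hb' : b ∈ t := by simpa using ((finite hB t Z).mem_toFinset.1 hb).1
    have hpos : (0 : ℝ) < NB b := by exact_mod_cast hB1 b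
    rw [← Set.ncard_coe_finset, ← Set.ncard_image_of_injective
      {a | a ∈ s ∧ (NA a : ℝ) ≤ X / NB b} (f := fun a => (a, b)) (fun a a' h => by simpa using h)]
    congr 1
    ext ⟨a, b'⟩
    simp only [Finset.coe_filter, Set.Finite.mem_toFinset, Set.mem_prod, Set.mem_ofPred_eq,
      Set.mem_image, Prod.mk.injEq, le_div_iff₀ hpos, Nat.cast_mul]
    constructor
    · rintro ⟨⟨⟨ha, _⟩, hle⟩, rfl⟩
      exact ⟨a, ⟨ha, hle⟩, rfl, rfl⟩
    · rintro ⟨a', ⟨ha, hle⟩, rfl, rfl⟩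
      exact ⟨⟨⟨ha, hb'⟩, hle⟩, rfl⟩
  · intro x hx
    have hx' := (Set.Finite.mem_toFinset _).1 hx
    simp only [Set.Finite.coe_toFinset, Set.mem_ofPred_eq]
    refine ⟨hx'.1.2, le_trans ?_ hXZ⟩
    exact le_trans (by exact_mod_cast Nat.le_mul_of_pos_left _ (hA1 x.1)) hx'.2

/-- Comparison of convolutions: an almost-identity between counting functions of the first factor
passes to the convolution when the second factor is negligible. -/
theorem isLittleO_convolution {h F : ℝ → ℝ} {f f₁ f₂ : ℝ → ℝ} {F₁ F₂ : ℝ → ℝ}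
    (hB : FiniteSublevels NB) (hB1 : ∀ b, 1 ≤ NB b) (t : Set B)
    (hh : h = sizeCount NB t)
    (hF : ∀ X ≥ 0, F X = ∑ b ∈ (finite hB t X).toFinset, f (X / NB b))
    (hF₁ : ∀ X ≥ 0, F₁ X = ∑ b ∈ (finite hB t X).toFinset, f₁ (X / NB b))
    (hF₂ : ∀ X ≥ 0, F₂ X = ∑ b ∈ (finite hB t X).toFinset, f₂ (X / NB b))
    (hf : ∀ Y, 0 ≤ f Y)
    (hcmp : ∀ ε > 0, ∃ C, ∀ Y ≥ 1, |f₁ Y - f₂ Y| ≤ ε * f Y + C)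
    (hhF : h =o[atTop] F) : (fun X => F₁ X - F₂ X) =o[atTop] F := by
  rw [isLittleO_iff]
  intro ε hε
  obtain ⟨C, hC⟩ := hcmp (ε / 2) (by positivity)
  have hF0 : ∀ X ≥ 0, 0 ≤ F X := fun X hX => by rw [hF X hX]; exact Finset.sum_nonneg fun _ _ => hf _
  have hC1 : 0 < |C| + 1 := by positivity
  filter_upwards [(isLittleO_iff.1 hhF) (show 0 < ε / 2 / (|C| + 1) by positivity),
    eventually_ge_atTop 0] with X hX hX0
  have key : |F₁ X - F₂ X| ≤ ε / 2 * F X + C * h X := by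
    rw [hF₁ X hX0, hF₂ X hX0, hF X hX0, ← Finset.sum_sub_distrib, Finset.mul_sum]
    refine (Finset.abs_sum_le_sum_abs _ _).trans ?_
    have hcard : h X = ∑ _b ∈ (finite hB t X).toFinset, (1 : ℝ) := by
      rw [hh, sizeCount, Set.ncard_eq_toFinset_card _ (finite hB t X)]
      simp
    rw [hcard, Finset.mul_sum, ← Finset.sum_add_distrib]
    refine Finset.sum_le_sum fun b hb => ?_
    rw [mul_one]
    apply hC
    have := (Set.Finite.mem_toFinset _).1 hb
    have hpos : (0 : ℝ) < NB b := by exact_mod_cast hB1 b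
    rw [ge_iff_le, le_div_iff₀ hpos, one_mul]
    exact this.2
  have hh0 : 0 ≤ h X := by rw [hh]; exact SizeCount.nonneg _ _
  rw [Real.norm_of_nonneg hh0, Real.norm_of_nonneg (hF0 X hX0)] at hX
  rw [Real.norm_eq_abs, Real.norm_of_nonneg (hF0 X hX0)]
  have h2 : C * h X ≤ ε / 2 * F X := by
    calc C * h X ≤ (|C| + 1) * h X := by
          gcongr
          linarith [le_abs_self C]
      _ ≤ (|C| + 1) * (ε / 2 / (|C| + 1) * F X) := by gcongr
      _ = ε / 2 * F X := by field_simp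
  linarith

end Convolution

/-- The size of a tuple is the product of the sizes of its entries. -/
def tupleSize {A : Type*} (N : A → ℕ) {k : ℕ} (m : Fin k → A) : ℕ := ∏ i, N (m i)

/-- The number of `k`-tuples of size at most `X`. -/
def tupleCount {A : Type*} (N : A → ℕ) (k : ℕ) (X : ℝ) : ℝ :=
  sizeCount (tupleSize N (k := k)) Set.univ X

section LinearGrowth

open SizeCount

theorem exists_forall_abs_sub_le_of_tendsto {f f₁ f₂ : ℝ → ℝ} {c d : ℝ} (hc : 0 < c)
    (hf : ∀ Y ≥ 1, c * Y ≤ f Y) (m₁ : Monotone f₁) (m₂ : Monotone f₂)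
    (n₁ : ∀ Y, 0 ≤ f₁ Y) (n₂ : ∀ Y, 0 ≤ f₂ Y)
    (h₁ : Tendsto (fun Y => f₁ Y / Y) atTop (𝓝 d)) (h₂ : Tendsto (fun Y => f₂ Y / Y) atTop (𝓝 d)) :
    ∀ ε > 0, ∃ C, ∀ Y ≥ 1, |f₁ Y - f₂ Y| ≤ ε * f Y + C := by
  intro ε hε
  have h := h₁.sub h₂
  rw [sub_self] at h
  have h' := (Metric.tendsto_nhds.1 h) (ε * c) (by positivity)
  obtain ⟨Y₀, hY₀⟩ := eventually_atTop.1 h'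
  refine ⟨f₁ Y₀ + f₂ Y₀, fun Y hY => ?_⟩
  have hfY : 0 ≤ f Y := le_trans (by nlinarith) (hf Y hY)
  rcases le_total Y₀ Y with hle | hle
  · have h3 := hY₀ Y hle
    have hYpos : 0 < Y := by linarith
    rw [Real.dist_eq, sub_zero, ← sub_div, abs_div, abs_of_pos hYpos, div_lt_iff₀ hYpos] at h3
    have h4 : ε * (c * Y) ≤ ε * f Y := by gcongr; exact hf Y hY
    have := n₁ Y₀
    have := n₂ Y₀
    linarith
  · have h5 := m₁ hle
    have h6 := m₂ hle
    have h7 := n₁ Y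
    have h8 := n₂ Y
    have : 0 ≤ ε * f Y := by positivity
    rw [abs_le]
    constructor <;> linarith

variable {A : Type*} {N : A → ℕ}

theorem sizeCount_monotone (hfin : FiniteSublevels N) (s : Set A) : Monotone (sizeCount N s) :=
  fun _ _ h => SizeCount.mono hfin subset_rfl h

theorem exists_linear_lower_bound (hfin : FiniteSublevels N) (hone : ∃ a, N a = 1) {δ : ℝ}
    (hδ : 0 < δ) (hlim : Tendsto (fun X => sizeCount N Set.univ X / X) atTop (𝓝 δ)) :
    ∃ c > 0, ∀ Y ≥ 1, c * Y ≤ sizeCount N Set.univ Y := by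
  obtain ⟨Y₀, hY₀⟩ := eventually_atTop.1 (hlim.eventually (lt_mem_nhds (half_lt_self hδ)))
  set Y₁ := max Y₀ 1
  have hY₁ : 1 ≤ Y₁ := le_max_right _ _
  refine ⟨min (δ / 2) Y₁⁻¹, by positivity, fun Y hY => ?_⟩
  rcases le_total Y₁ Y with hle | hle
  · have h := hY₀ Y ((le_max_left _ _).trans hle)
    rw [lt_div_iff₀ (by linarith)] at h
    have : min (δ / 2) Y₁⁻¹ * Y ≤ δ / 2 * Y := by gcongr; exact min_le_left _ _
    linarith
  · have h1 : 1 ≤ sizeCount N Set.univ Y := by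
      obtain ⟨a, ha⟩ := hone
      unfold sizeCount
      rw [Nat.one_le_cast, Nat.one_le_iff_ne_zero, Ne, Set.ncard_eq_zero (finite hfin _ _)]
      refine Set.Nonempty.ne_empty ⟨a, Set.mem_univ _, ?_⟩
      rw [ha]
      exact_mod_cast hY
    calc min (δ / 2) Y₁⁻¹ * Y ≤ Y₁⁻¹ * Y₁ := by gcongr; exact min_le_right _ _
      _ = 1 := inv_mul_cancel₀ (by positivity)
      _ ≤ _ := h1

theorem exists_linear_upper_bound (hfin : FiniteSublevels N) {δ : ℝ}
    (hδ : 0 < δ) (hlim : Tendsto (fun X => sizeCount N Set.univ X / X) atTop (𝓝 δ)) :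
    ∃ C > 0, ∀ Y ≥ 1, sizeCount N Set.univ Y ≤ C * Y := by
  obtain ⟨Y₀, hY₀⟩ := eventually_atTop.1 (hlim.eventually (gt_mem_nhds (show δ < 2 * δ by linarith)))
  refine ⟨2 * δ + sizeCount N Set.univ Y₀, by have := nonneg (N := N) Set.univ Y₀; linarith,
    fun Y hY => ?_⟩
  have h0 := nonneg (N := N) Set.univ Y₀
  rcases le_total Y₀ Y with hle | hle
  · have h := hY₀ Y hle
    rw [div_lt_iff₀ (by linarith)] at h
    nlinarith
  · have := sizeCount_monotone hfin Set.univ hle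
    nlinarith

theorem tendsto_sizeCount_atTop {δ : ℝ}
    (hδ : 0 < δ) (hlim : Tendsto (fun X => sizeCount N Set.univ X / X) atTop (𝓝 δ)) :
    Tendsto (sizeCount N Set.univ) atTop atTop := by
  have h := hlim.pos_mul_atTop hδ tendsto_id
  refine h.congr' ?_
  filter_upwards [eventually_gt_atTop 0] with X hX
  simp only [id]
  field_simp

/-- Linear growth forces the sum of the inverse sizes to diverge. -/
theorem exists_finset_sum_inv_gt (hfin : FiniteSublevels N) (h1 : ∀ a, 1 ≤ N a)
    (hone : ∃ a, N a = 1) {δ : ℝ} (hδ : 0 < δ)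
    (hlim : Tendsto (fun X => sizeCount N Set.univ X / X) atTop (𝓝 δ)) (R : ℝ) :
    ∃ t : Finset A, R < ∑ a ∈ t, (1 : ℝ) / N a := by
  classical
  by_contra! hcon
  have hsum : Summable fun a => (1 : ℝ) / N a :=
    summable_of_sum_le (fun a => by positivity) hcon
  obtain ⟨c, hc, hcY⟩ := exists_linear_lower_bound hfin hone hδ hlim
  obtain ⟨t, ht⟩ := (summable_iff_vanishing_norm.1 hsum) (c / 2) (by positivity)
  have hbound : ∀ Y ≥ 1, sizeCount N Set.univ Y ≤ t.card + c / 2 * Y := by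
    intro Y hY
    have hYpos : 0 < Y := by linarith
    unfold sizeCount
    rw [Set.ncard_eq_toFinset_card _ (finite hfin Set.univ Y)]
    set s := (finite hfin Set.univ Y).toFinset with hs
    have h2 := ht (s \ t) Finset.sdiff_disjoint
    have h3 : ((s \ t).card : ℝ) / Y ≤ ∑ a ∈ s \ t, (1 : ℝ) / N a := by
      rw [← nsmul_one, smul_div_assoc]
      refine Finset.card_nsmul_le_sum _ _ _ fun a ha => ?_
      have ha' : (N a : ℝ) ≤ Y := by
        have := (Finset.mem_sdiff.1 ha).1
        rw [hs, Set.Finite.mem_toFinset] at this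
        exact this.2
      have : (0 : ℝ) < N a := by exact_mod_cast h1 a
      gcongr
    have h4 : ((s \ t).card : ℝ) ≤ c / 2 * Y := by
      have h5 : ((s \ t).card : ℝ) / Y ≤ c / 2 := h3.trans ((le_abs_self _).trans h2.le)
      rwa [div_le_iff₀ hYpos] at h5
    have h6 : (s.card : ℝ) ≤ t.card + (s \ t).card := by
      have h7 : s.card ≤ (t ∪ s \ t).card := Finset.card_le_card (by
        intro x hx
        by_cases hxt : x ∈ t <;> simp [hx, hxt])
      exact_mod_cast h7.trans (Finset.card_union_le _ _)
    linarith
  have hY := hbound (max 1 (2 * (t.card + 1) / c)) (le_max_left _ _)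
  have hY' := hcY (max 1 (2 * (t.card + 1) / c)) (le_max_left _ _)
  set Y := max 1 (2 * ((t.card : ℝ) + 1) / c)
  have h8 : 2 * ((t.card : ℝ) + 1) / c ≤ Y := le_max_right _ _
  rw [div_le_iff₀ hc] at h8
  nlinarith

end LinearGrowth

section Tuples

open SizeCount

variable {A : Type*} {N : A → ℕ}

theorem one_le_tupleSize (h1 : ∀ a, 1 ≤ N a) {k : ℕ} (m : Fin k → A) : 1 ≤ tupleSize N m := by
  unfold tupleSize
  exact Nat.succ_le_of_lt (Finset.prod_pos fun i _ => h1 (m i))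

theorem FiniteSublevels.tuple (hfin : FiniteSublevels N) (h1 : ∀ a, 1 ≤ N a) (k : ℕ) :
    FiniteSublevels (tupleSize N (k := k)) := by
  intro X
  refine (Set.Finite.pi' (t := fun _ : Fin k => {a | (N a : ℝ) ≤ X}) fun _ => hfin X).subset ?_
  intro m hm i
  refine le_trans ?_ (show (tupleSize N m : ℝ) ≤ X from hm)
  exact_mod_cast Nat.le_of_dvd (one_le_tupleSize h1 m) (Finset.dvd_prod_of_mem _ (Finset.mem_univ i))

/-- Splitting off one slot of a tuple. -/
theorem sizeCount_tuple_slot (hfin : FiniteSublevels N) (h1 : ∀ a, 1 ≤ N a) {k : ℕ}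
    (i : Fin (k + 1)) (s : Set A) (t : Set (Fin k → A)) {X Z : ℝ} (hXZ : X ≤ Z) :
    sizeCount (tupleSize N (k := k + 1)) {m | m i ∈ s ∧ i.removeNth m ∈ t} X =
      ∑ b ∈ (finite (hfin.tuple h1 k) t Z).toFinset, sizeCount N s (X / tupleSize N b) := by
  rw [← sizeCount_prod hfin (hfin.tuple h1 k) h1 (one_le_tupleSize h1) s t X Z hXZ]
  refine congr_equiv (Fin.insertNthEquiv (fun _ => A) i).symm fun m => ?_
  simp only [Set.mem_ofPred_eq, Fin.insertNthEquiv_symm_apply, Set.mem_prod]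
  have : tupleSize N m = N (m i) * tupleSize N (i.removeNth m) := by
    unfold tupleSize
    rw [Fin.prod_univ_succAbove _ i]
    rfl
  rw [this]

theorem tupleCount_succ (hfin : FiniteSublevels N) (h1 : ∀ a, 1 ≤ N a) (k : ℕ) {X Z : ℝ}
    (hXZ : X ≤ Z) : tupleCount N (k + 1) X =
      ∑ b ∈ (finite (hfin.tuple h1 k) Set.univ Z).toFinset,
        sizeCount N Set.univ (X / tupleSize N b) := by
  rw [← sizeCount_tuple_slot hfin h1 0 Set.univ Set.univ hXZ]
  simp [tupleCount, Set.ofPred_true]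

theorem tupleCount_succ_eq_sum (hfin : FiniteSublevels N) (h1 : ∀ a, 1 ≤ N a) (k : ℕ) (X : ℝ) :
    tupleCount N (k + 1) X =
      ∑ a ∈ (finite hfin Set.univ X).toFinset, tupleCount N k (X / N a) := by
  unfold tupleCount
  have := sizeCount_prod (hfin.tuple h1 k) hfin (one_le_tupleSize h1) h1 Set.univ Set.univ X X le_rfl
  rw [← this]
  refine congr_equiv ((Fin.insertNthEquiv (fun _ => A) 0).symm.trans (Equiv.prodComm _ _))
    fun m => ?_
  have : tupleSize N m = tupleSize N ((0 : Fin (k + 1)).removeNth m) * N (m 0) := by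
    unfold tupleSize
    rw [Fin.prod_univ_succAbove _ 0, mul_comm]
    rfl
  rw [this]
  simp [Fin.insertNthEquiv]

theorem tupleCount_nonneg (k : ℕ) (X : ℝ) : 0 ≤ tupleCount N k X := nonneg _ _

theorem tupleCount_mul_le (hfin : FiniteSublevels N) (h1 : ∀ a, 1 ≤ N a) (hone : ∃ a, N a = 1)
    {δ : ℝ} (hδ : 0 < δ) (hlim : Tendsto (fun X => sizeCount N Set.univ X / X) atTop (𝓝 δ))
    (k : ℕ) : ∃ C > 0, ∀ X, ∀ y ≥ 1, tupleCount N (k + 1) (X / y) ≤ C / y * tupleCount N (k + 1) X := by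
  obtain ⟨c, hc, hcY⟩ := exists_linear_lower_bound hfin hone hδ hlim
  obtain ⟨C, hC, hCY⟩ := exists_linear_upper_bound hfin hδ hlim
  refine ⟨C / c, by positivity, fun X y hy => ?_⟩
  have hy0 : 0 < y := by linarith
  rcases lt_or_ge X 0 with hX | hX
  · have h0 : X / y < 1 := (div_neg_of_neg_of_pos hX hy0).trans one_pos
    rw [tupleCount, eq_zero_of_lt_one (one_le_tupleSize h1) _ h0]
    have := tupleCount_nonneg (N := N) (k + 1) X
    positivity
  rw [tupleCount_succ hfin h1 k (div_le_self hX hy), tupleCount_succ hfin h1 k le_rfl,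
    Finset.mul_sum]
  refine Finset.sum_le_sum fun b _ => ?_
  have hb : (1 : ℝ) ≤ tupleSize N b := by exact_mod_cast one_le_tupleSize h1 b
  set Y := X / tupleSize N b
  have hYy : X / y / tupleSize N b = Y / y := by rw [div_right_comm]
  rw [hYy]
  rcases lt_or_ge (Y / y) 1 with h | h
  · rw [eq_zero_of_lt_one h1 _ h]
    have := nonneg (N := N) Set.univ Y
    positivity
  · have hY : 1 ≤ Y := by
      rw [le_div_iff₀ hy0] at h
      linarith
    calc sizeCount N Set.univ (Y / y) ≤ C * (Y / y) := hCY _ h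
      _ = C / c / y * (c * Y) := by field_simp
      _ ≤ C / c / y * sizeCount N Set.univ Y := by gcongr; exact hcY Y hY

theorem tendsto_div_of_isLittleO_sub {F F₁ : ℝ → ℝ} {r : ℝ}
    (hF : ∀ᶠ X in atTop, 0 < F X) (h : (fun X => F₁ X - r * F X) =o[atTop] F) :
    Tendsto (fun X => F₁ X / F X) atTop (𝓝 r) := by
  have h2 := h.tendsto_div_nhds_zero
  have h3 := h2.add_const r
  rw [zero_add] at h3
  refine h3.congr' ?_
  filter_upwards [hF] with X hX
  field_simp
  ring

theorem tupleCount_pos (hone : ∃ a, N a = 1) (hfin : FiniteSublevels N) (h1 : ∀ a, 1 ≤ N a)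
    (k : ℕ) {X : ℝ} (hX : 1 ≤ X) : 0 < tupleCount N k X := by
  obtain ⟨a, ha⟩ := hone
  unfold tupleCount sizeCount
  rw [Nat.cast_pos, Nat.pos_iff_ne_zero, Ne, Set.ncard_eq_zero (finite (hfin.tuple h1 k) _ _)]
  refine Set.Nonempty.ne_empty ⟨fun _ => a, Set.mem_univ _, ?_⟩
  simpa [tupleSize, ha] using hX

theorem tupleCount_scaling_of_isLittleO (hfin : FiniteSublevels N) (h1 : ∀ a, 1 ≤ N a)
    (hone : ∃ a, N a = 1)
    {δ : ℝ} (hδ : 0 < δ) (hlim : Tendsto (fun X => sizeCount N Set.univ X / X) atTop (𝓝 δ))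
    (k : ℕ) (ho : tupleCount N k =o[atTop] tupleCount N (k + 1)) {y : ℝ} (hy : 1 ≤ y) :
    Tendsto (fun X => tupleCount N (k + 1) (X / y) / tupleCount N (k + 1) X) atTop (𝓝 y⁻¹) := by
  have hy0 : 0 < y := by linarith
  obtain ⟨c, hc, hcY⟩ := exists_linear_lower_bound hfin hone hδ hlim
  have hmono := sizeCount_monotone hfin Set.univ
  have hcmp := exists_forall_abs_sub_le_of_tendsto (f := sizeCount N Set.univ)
    (f₁ := fun Y => sizeCount N Set.univ (Y / y)) (f₂ := fun Y => y⁻¹ * sizeCount N Set.univ Y)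
    (d := y⁻¹ * δ) hc hcY (fun a b h => hmono (by gcongr)) (fun a b h => by
      have := hmono h
      simp only
      gcongr) (fun Y => nonneg _ _) (fun Y => mul_nonneg (by positivity) (nonneg _ _)) (by
        have h := (hlim.comp (tendsto_id.atTop_div_const hy0)).const_mul y⁻¹
        refine h.congr fun X => ?_
        simp only [Function.comp, id]
        field_simp) (by
        refine (hlim.const_mul y⁻¹).congr fun X => ?_
        ring)
  refine tendsto_div_of_isLittleO_sub ?_ ?_
  · filter_upwards [eventually_ge_atTop 1] with X hX
    exact tupleCount_pos hone hfin h1 _ hX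
  · refine isLittleO_convolution (F := tupleCount N (k + 1))
      (F₁ := fun X => tupleCount N (k + 1) (X / y))
      (F₂ := fun X => y⁻¹ * tupleCount N (k + 1) X)
      (hfin.tuple h1 k) (one_le_tupleSize h1) Set.univ rfl (fun X hX => ?_) (fun X hX => ?_)
      (fun X hX => ?_) (fun Y => nonneg _ _) hcmp ho
    · exact tupleCount_succ hfin h1 k le_rfl
    · rw [tupleCount_succ hfin h1 k (div_le_self hX hy)]
      refine Finset.sum_congr rfl fun b _ => ?_
      rw [div_right_comm]
    · rw [tupleCount_succ hfin h1 k le_rfl, Finset.mul_sum]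

theorem tupleCount_isLittleO_succ (hfin : FiniteSublevels N) (h1 : ∀ a, 1 ≤ N a)
    (hone : ∃ a, N a = 1)
    {δ : ℝ} (hδ : 0 < δ) (hlim : Tendsto (fun X => sizeCount N Set.univ X / X) atTop (𝓝 δ))
    (k : ℕ) : tupleCount N k =o[atTop] tupleCount N (k + 1) := by
  induction k with
  | zero =>
    have hM1 : tupleCount N (0 + 1) = sizeCount N Set.univ := by
      ext X
      refine congr_equiv (Equiv.funUnique (Fin 1) A) fun m => ?_
      simp [tupleSize]
    rw [hM1]
    have hO : tupleCount N 0 =O[atTop] (fun _ => (1 : ℝ)) := by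
      refine IsBigO.of_bound 1 (Eventually.of_forall fun X => ?_)
      rw [Real.norm_of_nonneg (tupleCount_nonneg _ _)]
      simp only [norm_one, mul_one, tupleCount, sizeCount]
      exact_mod_cast Set.ncard_le_one_of_subsingleton _
    refine hO.trans_isLittleO ?_
    rw [isLittleO_const_left]
    right
    exact tendsto_norm_atTop_atTop.comp (tendsto_sizeCount_atTop hδ hlim)
  | succ k ih =>
    rw [isLittleO_iff]
    intro ε hε
    obtain ⟨t, ht⟩ := exists_finset_sum_inv_gt hfin h1 hone hδ hlim ε⁻¹
    have hlimt : Tendsto (fun X => ∑ a ∈ t, tupleCount N (k + 1) (X / N a) / tupleCount N (k + 1) X)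
        atTop (𝓝 (∑ a ∈ t, (N a : ℝ)⁻¹)) := by
      refine tendsto_finsetSum _ fun a _ => ?_
      exact tupleCount_scaling_of_isLittleO hfin h1 hone hδ hlim k ih (by exact_mod_cast h1 a)
    simp only [one_div] at ht
    filter_upwards [hlimt.eventually (lt_mem_nhds ht), eventually_ge_atTop 1,
      eventually_ge_atTop (∑ a ∈ t, (N a : ℝ))] with X hX hX1 hXt
    rw [Real.norm_of_nonneg (tupleCount_nonneg _ _), Real.norm_of_nonneg (tupleCount_nonneg _ _)]
    have hpos := tupleCount_pos hone hfin h1 (k + 1) hX1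
    rw [← Finset.sum_div, lt_div_iff₀ hpos] at hX
    have hle : ∑ a ∈ t, tupleCount N (k + 1) (X / N a) ≤ tupleCount N (k + 1 + 1) X := by
      rw [tupleCount_succ_eq_sum hfin h1 (k + 1) X]
      refine Finset.sum_le_sum_of_subset_of_nonneg ?_ fun _ _ _ => tupleCount_nonneg _ _
      intro a ha
      simp only [Set.Finite.mem_toFinset, Set.mem_univ, true_and, Set.mem_ofPred_eq]
      exact (Finset.single_le_sum (f := fun a => (N a : ℝ)) (fun _ _ => Nat.cast_nonneg _) ha).trans hXt
    calc tupleCount N (k + 1) X = ε * (ε⁻¹ * tupleCount N (k + 1) X) := by field_simp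
      _ ≤ ε * tupleCount N (k + 1 + 1) X := by gcongr; linarith

theorem tupleCount_scaling (hfin : FiniteSublevels N) (h1 : ∀ a, 1 ≤ N a) (hone : ∃ a, N a = 1)
    {δ : ℝ} (hδ : 0 < δ) (hlim : Tendsto (fun X => sizeCount N Set.univ X / X) atTop (𝓝 δ))
    (k : ℕ) {y : ℝ} (hy : 1 ≤ y) :
    Tendsto (fun X => tupleCount N (k + 1) (X / y) / tupleCount N (k + 1) X) atTop (𝓝 y⁻¹) :=
  tupleCount_scaling_of_isLittleO hfin h1 hone hδ hlim k
    (tupleCount_isLittleO_succ hfin h1 hone hδ hlim k) hy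

end Tuples

section ClassTuples

open SizeCount

variable {A G : Type*} [Fintype G] {N : A → ℕ}

/-- Tuples with prescribed classes. -/
def classTuples (κ : A → G) {k : ℕ} (g : Fin k → G) : Set (Fin k → A) := {m | ∀ i, κ (m i) = g i}

theorem tendsto_sizeCount_univ_div (hfin : FiniteSublevels N) (κ : A → G) {δ : ℝ}
    (hlim : ∀ g, Tendsto (fun X => sizeCount N {a | κ a = g} X / X) atTop (𝓝 δ)) :
    Tendsto (fun X => sizeCount N Set.univ X / X) atTop (𝓝 (Fintype.card G * δ)) := by
  have h := tendsto_finsetSum Finset.univ fun g (_ : g ∈ Finset.univ) => hlim g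
  simp only [Finset.sum_const, Finset.card_univ, nsmul_eq_mul] at h
  refine h.congr fun X => ?_
  rw [← sum_fiber hfin κ Set.univ X, Finset.sum_div]
  simp

theorem classTuples_update_isLittleO (hfin : FiniteSublevels N) (h1 : ∀ a, 1 ≤ N a)
    (hone : ∃ a, N a = 1) (κ : A → G) {δ : ℝ} (hδ : 0 < δ)
    (hlim : ∀ g, Tendsto (fun X => sizeCount N {a | κ a = g} X / X) atTop (𝓝 δ))
    {k : ℕ} (g : Fin (k + 1) → G) (i : Fin (k + 1)) (x : G) :
    (fun X => sizeCount (tupleSize N) (classTuples κ (Function.update g i x)) X -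
      sizeCount (tupleSize N) (classTuples κ g) X) =o[atTop] tupleCount N (k + 1) := by
  have : Nonempty G := ⟨x⟩
  have hδ' : 0 < Fintype.card G * δ := by
    have : 0 < Fintype.card G := Fintype.card_pos
    positivity
  have htot := tendsto_sizeCount_univ_div hfin κ hlim
  obtain ⟨c, hc, hcY⟩ := exists_linear_lower_bound hfin hone hδ' htot
  have hslot : ∀ g' : Fin (k + 1) → G, i.removeNth g' = i.removeNth g →
      classTuples κ g' = {m : Fin (k + 1) → A | m i ∈ {a | κ a = g' i} ∧ i.removeNth m ∈
        (classTuples κ (i.removeNth g) : Set (Fin k → A))} := by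
    intro g' hg'
    ext m
    simp only [classTuples, Set.mem_ofPred_eq]
    rw [Fin.forall_iff_succAbove i, ← hg']
    rfl
  have ho := tupleCount_isLittleO_succ hfin h1 hone hδ' htot k
  set t := classTuples κ (i.removeNth g) with ht
  have hmono := sizeCount_monotone hfin
  rw [isLittleO_iff]
  intro ε hε
  obtain ⟨C, hC⟩ := exists_forall_abs_sub_le_of_tendsto hc hcY (hmono {a | κ a = x})
    (hmono {a | κ a = g i}) (fun _ => nonneg _ _) (fun _ => nonneg _ _) (hlim x) (hlim (g i))
    (ε / 2) (by positivity)
  have hC1 : 0 < |C| + 1 := by positivity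
  filter_upwards [(isLittleO_iff.1 ho) (show 0 < ε / 2 / (|C| + 1) by positivity)] with X hX
  rw [Real.norm_of_nonneg (tupleCount_nonneg _ _), Real.norm_of_nonneg (tupleCount_nonneg _ _)] at hX
  rw [Real.norm_of_nonneg (tupleCount_nonneg _ _), Real.norm_eq_abs,
    hslot (Function.update g i x) (by simp), hslot g rfl, Function.update_self,
    sizeCount_tuple_slot hfin h1 i _ t (le_refl X), sizeCount_tuple_slot hfin h1 i _ t (le_refl X),
    ← Finset.sum_sub_distrib]
  have hsub : (finite (hfin.tuple h1 k) t X).toFinset ⊆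
      (finite (hfin.tuple h1 k) Set.univ X).toFinset := by
    intro b hb
    simp only [Set.Finite.mem_toFinset, Set.mem_ofPred_eq, Set.mem_univ, true_and] at hb ⊢
    exact hb.2
  refine (Finset.abs_sum_le_sum_abs _ _).trans ?_
  refine (Finset.sum_le_sum_of_subset_of_nonneg hsub fun _ _ _ => abs_nonneg _).trans ?_
  have hb : ∀ b ∈ (finite (hfin.tuple h1 k) Set.univ X).toFinset,
      |sizeCount N {a | κ a = x} (X / tupleSize N b) -
        sizeCount N {a | κ a = g i} (X / tupleSize N b)| ≤
      ε / 2 * sizeCount N Set.univ (X / tupleSize N b) + C := by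
    intro b hb
    apply hC
    have := (Set.Finite.mem_toFinset _).1 hb
    have hpos : (0 : ℝ) < tupleSize N b := by exact_mod_cast one_le_tupleSize h1 b
    rw [ge_iff_le, le_div_iff₀ hpos, one_mul]
    exact this.2
  refine (Finset.sum_le_sum hb).trans ?_
  rw [Finset.sum_add_distrib, ← Finset.mul_sum, ← tupleCount_succ hfin h1 k le_rfl,
    Finset.sum_const, nsmul_eq_mul]
  have hcard : ((finite (hfin.tuple h1 k) Set.univ X).toFinset.card : ℝ) = tupleCount N k X := by
    rw [tupleCount, sizeCount, Set.ncard_eq_toFinset_card _ (finite (hfin.tuple h1 k) Set.univ X)]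
  rw [hcard]
  have h0 := tupleCount_nonneg (N := N) k X
  have h2 : tupleCount N k X * C ≤ ε / 2 * tupleCount N (k + 1) X := by
    calc tupleCount N k X * C ≤ tupleCount N k X * (|C| + 1) := by
          gcongr
          linarith [le_abs_self C]
      _ ≤ ε / 2 / (|C| + 1) * tupleCount N (k + 1) X * (|C| + 1) := by gcongr
      _ = _ := by field_simp
  linarith

theorem classTuples_sub_isLittleO (hfin : FiniteSublevels N) (h1 : ∀ a, 1 ≤ N a)
    (hone : ∃ a, N a = 1) (κ : A → G) {δ : ℝ} (hδ : 0 < δ)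
    (hlim : ∀ g, Tendsto (fun X => sizeCount N {a | κ a = g} X / X) atTop (𝓝 δ))
    {k : ℕ} (g g' : Fin (k + 1) → G) :
    (fun X => sizeCount (tupleSize N) (classTuples κ g') X -
      sizeCount (tupleSize N) (classTuples κ g) X) =o[atTop] tupleCount N (k + 1) := by
  classical
  have key : ∀ S : Finset (Fin (k + 1)),
      (fun X => sizeCount (tupleSize N) (classTuples κ (S.piecewise g' g)) X -
      sizeCount (tupleSize N) (classTuples κ g) X) =o[atTop] tupleCount N (k + 1) := by
    intro S
    induction S using Finset.induction_on with
    | empty => simp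
    | insert j S _ ih =>
      rw [Finset.piecewise_insert]
      refine ((classTuples_update_isLittleO hfin h1 hone κ hδ hlim (S.piecewise g' g) j
        (g' j)).add ih).congr_left fun X => ?_
      ring
  simpa using key Finset.univ

theorem tendsto_classTuples_div (hfin : FiniteSublevels N) (h1 : ∀ a, 1 ≤ N a)
    (hone : ∃ a, N a = 1) (κ : A → G) {δ : ℝ} (hδ : 0 < δ)
    (hlim : ∀ g, Tendsto (fun X => sizeCount N {a | κ a = g} X / X) atTop (𝓝 δ))
    {k : ℕ} (g : Fin (k + 1) → G) :
    Tendsto (fun X => sizeCount (tupleSize N) (classTuples κ g) X / tupleCount N (k + 1) X) atTop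
      (𝓝 ((Fintype.card (Fin (k + 1) → G) : ℝ)⁻¹)) := by
  classical
  have : Nonempty (Fin (k + 1) → G) := ⟨g⟩
  have hcard : (Fintype.card (Fin (k + 1) → G) : ℝ) ≠ 0 :=
    Nat.cast_ne_zero.2 Fintype.card_ne_zero
  refine tendsto_div_of_isLittleO_sub ?_ ?_
  · filter_upwards [eventually_ge_atTop 1] with X hX
    exact tupleCount_pos hone hfin h1 _ hX
  · have h := IsLittleO.sum (A := fun (g' : Fin (k + 1) → G) X =>
        sizeCount (tupleSize N) (classTuples κ g) X -
        sizeCount (tupleSize N) (classTuples κ g') X) (g' := tupleCount N (k + 1)) (l := atTop)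
        (s := Finset.univ) fun g' _ => classTuples_sub_isLittleO hfin h1 hone κ hδ hlim g' g
    refine (h.const_mul_left (Fintype.card (Fin (k + 1) → G) : ℝ)⁻¹).congr_left fun X => ?_
    rw [Finset.sum_apply, Finset.sum_sub_distrib, Finset.sum_const, Finset.card_univ, nsmul_eq_mul, mul_sub,
      ← mul_assoc, inv_mul_cancel₀ hcard, one_mul, tupleCount,
      ← sum_fiber (hfin.tuple h1 (k + 1)) (fun m i => κ (m i)) Set.univ X]
    congr 3
    ext g'
    congr 1
    ext m
    simp [classTuples, funext_iff]

theorem tendsto_tupleCount_atTop (hfin : FiniteSublevels N) (h1 : ∀ a, 1 ≤ N a)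
    (hone : ∃ a, N a = 1) {δ : ℝ} (hδ : 0 < δ)
    (hlim : Tendsto (fun X => sizeCount N Set.univ X / X) atTop (𝓝 δ)) (k : ℕ) :
    Tendsto (tupleCount N (k + 1)) atTop atTop := by
  have h : (fun _ : ℝ => (1 : ℝ)) =O[atTop] tupleCount N k := by
    refine IsBigO.of_bound 1 ?_
    filter_upwards [eventually_ge_atTop 1] with X hX
    have := tupleCount_pos hone hfin h1 k hX
    rw [Real.norm_of_nonneg this.le, one_mul, norm_one]
    unfold tupleCount sizeCount at this ⊢
    exact_mod_cast this
  have h2 := h.trans_isLittleO (tupleCount_isLittleO_succ hfin h1 hone hδ hlim k)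
  rw [isLittleO_const_left] at h2
  rcases h2 with h2 | h2
  · exact absurd h2 one_ne_zero
  · refine h2.congr fun X => ?_
    simp [Real.norm_of_nonneg (tupleCount_nonneg _ _)]

end ClassTuples

section FiniteSieve

open SizeCount

variable {P G : Type*} [AddCommGroup G] {N : P → ℕ} {k : ℕ}

/-- The multiplicative size of an effective divisor. -/
def monSize (N : P → ℕ) (m : P →₀ ℕ) : ℕ := m.prod fun p e => N p ^ e

theorem monSize_add (m n : P →₀ ℕ) : monSize N (m + n) = monSize N m * monSize N n :=
  Finsupp.prod_add_index' (fun _ => pow_zero _) fun _ _ _ => pow_add _ _ _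

theorem monSize_single (p : P) : monSize N (Finsupp.single p 1) = N p := by
  simp [monSize]

theorem monSize_zero : monSize N 0 = 1 := by simp [monSize]

theorem one_le_monSize (hN : ∀ p, 2 ≤ N p) (m : P →₀ ℕ) : 1 ≤ monSize N m :=
  Nat.succ_le_of_lt (Finset.prod_pos fun p _ => pow_pos (by have := hN p; omega) _)

open Classical in
/-- Adding a point in one slot of a tuple of divisors. -/
def shiftAt (j : Fin k) (p : P) (m : Fin k → P →₀ ℕ) : Fin k → P →₀ ℕ :=
  m + Pi.single j (Finsupp.single p 1)

theorem shiftAt_injective (j : Fin k) (p : P) : Function.Injective (shiftAt j p) :=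
  fun _ _ h => add_right_cancel h

open Classical in
theorem shiftAt_apply (j : Fin k) (p : P) (m : Fin k → P →₀ ℕ) (i : Fin k) (q : P) :
    shiftAt j p m i q = m i q + if i = j ∧ q = p then 1 else 0 := by
  unfold shiftAt
  by_cases hi : i = j
  · subst hi
    simp [Finsupp.single_apply, eq_comm]
  · simp [hi]

theorem exists_shiftAt_of_ne_zero {j : Fin k} {p : P} {m : Fin k → P →₀ ℕ} (h : m j p ≠ 0) :
    ∃ m', shiftAt j p m' = m := by
  classical
  refine ⟨fun i => if i = j then m i - Finsupp.single p 1 else m i, ?_⟩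
  ext i q
  rw [shiftAt_apply]
  by_cases hi : i = j
  · subst hi
    by_cases hq : q = p
    · subst hq
      simp
      omega
    · simp [hq]
  · simp [hi]

theorem tupleSize_shiftAt (j : Fin k) (p : P) (m : Fin k → P →₀ ℕ) :
    tupleSize (monSize N) (shiftAt j p m) = tupleSize (monSize N) m * N p := by
  classical
  unfold tupleSize shiftAt
  simp only [Pi.add_apply, monSize_add, Finset.prod_mul_distrib]
  congr 1
  rw [Finset.prod_eq_single j]
  · simp [monSize_single]
  · intro i _ hi
    simp [hi, monSize_zero]
  · simp

open Classical in
theorem sizeCount_shiftAt (hN : ∀ p, 2 ≤ N p) (κ : (P →₀ ℕ) →+ G) (j : Fin k) (p : P)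
    (T : Set (Fin k → P →₀ ℕ)) (g : Fin k → G) (X : ℝ) :
    sizeCount (tupleSize (monSize N)) (shiftAt j p '' T ∩ classTuples κ g) X =
      sizeCount (tupleSize (monSize N))
        (T ∩ classTuples κ (g - Pi.single j (κ (Finsupp.single p 1)))) (X / N p) := by
  have hp : (0 : ℝ) < N p := by have := hN p; positivity
  unfold sizeCount
  symm
  rw [← Set.ncard_image_of_injective _ (shiftAt_injective j p)]
  symm
  congr 2
  have hκ : ∀ m : Fin k → P →₀ ℕ, (shiftAt j p m ∈ classTuples κ g ↔
      m ∈ classTuples κ (g - Pi.single j (κ (Finsupp.single p 1)))) := by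
    intro m
    refine forall_congr' fun i => ?_
    rw [Pi.sub_apply, eq_sub_iff_add_eq]
    simp only [shiftAt, Pi.add_apply, map_add]
    by_cases hi : i = j
    · subst hi
      simp
    · simp [hi]
  ext m
  simp only [Set.mem_inter_iff, Set.mem_image, Set.mem_ofPred_eq]
  constructor
  · rintro ⟨⟨⟨m', hm', rfl⟩, hc⟩, hX⟩
    refine ⟨m', ⟨⟨hm', (hκ m').1 hc⟩, ?_⟩, rfl⟩
    rw [tupleSize_shiftAt, Nat.cast_mul] at hX
    rwa [le_div_iff₀ hp]
  · rintro ⟨m', ⟨⟨hm', hc⟩, hX⟩, rfl⟩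
    refine ⟨⟨⟨m', hm', rfl⟩, (hκ m').2 hc⟩, ?_⟩
    rw [tupleSize_shiftAt, Nat.cast_mul]
    rwa [le_div_iff₀ hp] at hX

/-- `T` has relative density `b` with respect to `M` in every class. -/
def HasClassDensity (N : P → ℕ) (κ : (P →₀ ℕ) →+ G) (M : ℝ → ℝ) (T : Set (Fin k → P →₀ ℕ))
    (b : ℝ) : Prop :=
  ∀ g, Tendsto (fun X => sizeCount (tupleSize (monSize N)) (T ∩ classTuples κ g) X / M X) atTop
    (𝓝 b)

variable {κ : (P →₀ ℕ) →+ G} {M : ℝ → ℝ} {T T' : Set (Fin k → P →₀ ℕ)} {b b' : ℝ}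

theorem HasClassDensity.shiftAt (hN : ∀ p, 2 ≤ N p) (hM : ∀ᶠ X in atTop, 0 < M X)
    (hscal : ∀ p, Tendsto (fun X => M (X / N p) / M X) atTop (𝓝 (N p : ℝ)⁻¹))
    (h : HasClassDensity N κ M T b) (j : Fin k) (p : P) :
    HasClassDensity N κ M (shiftAt j p '' T) (b * (N p : ℝ)⁻¹) := by
  classical
  have hp : (0 : ℝ) < N p := by have := hN p; positivity
  intro g
  have hdiv : Tendsto (fun X : ℝ => X / N p) atTop atTop := tendsto_id.atTop_div_const hp
  have h1 := ((h (g - Pi.single j (κ (Finsupp.single p 1)))).comp hdiv).mul (hscal p)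
  refine h1.congr' ?_
  filter_upwards [hdiv.eventually hM] with X hX
  rw [sizeCount_shiftAt hN]
  simp only [Function.comp]
  field_simp

theorem HasClassDensity.union (hfin : FiniteSublevels (tupleSize (monSize N) (k := k)))
    (h : HasClassDensity N κ M T b)
    (h' : HasClassDensity N κ M T' b') (hd : Disjoint T T') :
    HasClassDensity N κ M (T ∪ T') (b + b') := by
  intro g
  refine ((h g).add (h' g)).congr fun X => ?_
  rw [Set.union_inter_distrib_right, union_disjoint hfin, add_div]
  exact hd.mono Set.inter_subset_left Set.inter_subset_left

theorem HasClassDensity.of_union (hfin : FiniteSublevels (tupleSize (monSize N) (k := k)))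
    (h : HasClassDensity N κ M (T ∪ T') b)
    (h' : HasClassDensity N κ M T' b') (hd : Disjoint T T') :
    HasClassDensity N κ M T (b - b') := by
  intro g
  refine ((h g).sub (h' g)).congr fun X => ?_
  rw [Set.union_inter_distrib_right, union_disjoint hfin]
  · ring
  exact hd.mono Set.inter_subset_left Set.inter_subset_left

theorem HasClassDensity.slot_eq_zero (hN : ∀ p, 2 ≤ N p) (hM : ∀ᶠ X in atTop, 0 < M X)
    (hscal : ∀ p, Tendsto (fun X => M (X / N p) / M X) atTop (𝓝 (N p : ℝ)⁻¹))
    (hfin : FiniteSublevels (tupleSize (monSize N) (k := k)))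
    (h : HasClassDensity N κ M T b) {j : Fin k} {p : P}
    (hT : ∀ m, _root_.shiftAt j p m ∈ T ↔ m ∈ T) :
    HasClassDensity N κ M (T ∩ {m | m j p = 0}) (b * (1 - (N p : ℝ)⁻¹)) := by
  have hset : T = (T ∩ {m | m j p = 0}) ∪ _root_.shiftAt j p '' T := by
    ext m
    constructor
    · intro hm
      by_cases h0 : m j p = 0
      · exact Or.inl ⟨hm, h0⟩
      · obtain ⟨m', rfl⟩ := exists_shiftAt_of_ne_zero h0
        exact Or.inr ⟨m', (hT m').1 hm, rfl⟩
    · rintro (hm | ⟨m', hm', rfl⟩)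
      · exact hm.1
      · exact (hT m').2 hm'
  rw [mul_sub, mul_one]
  refine HasClassDensity.of_union hfin (T' := _root_.shiftAt j p '' T) (by rwa [← hset])
    (h.shiftAt hN hM hscal j p) ?_
  rw [Set.disjoint_left]
  rintro m ⟨_, hm⟩ ⟨m', _, rfl⟩
  simp [shiftAt_apply] at hm

theorem HasClassDensity.slots_eq_zero (hN : ∀ p, 2 ≤ N p) (hM : ∀ᶠ X in atTop, 0 < M X)
    (hscal : ∀ p, Tendsto (fun X => M (X / N p) / M X) atTop (𝓝 (N p : ℝ)⁻¹))
    (hfin : FiniteSublevels (tupleSize (monSize N) (k := k)))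
    (h : HasClassDensity N κ M T b) {p : P}
    (hT : ∀ j m, _root_.shiftAt j p m ∈ T ↔ m ∈ T) (J : Finset (Fin k)) :
    HasClassDensity N κ M (T ∩ {m | ∀ j ∈ J, m j p = 0}) (b * (1 - (N p : ℝ)⁻¹) ^ J.card) := by
  classical
  induction J using Finset.induction_on with
  | empty => simpa using h
  | insert j J hj ih =>
    have := ih.slot_eq_zero hN hM hscal hfin (j := j) (p := p) (by
      intro m
      simp only [Set.mem_inter_iff, hT, Set.mem_ofPred_eq, shiftAt_apply]
      refine and_congr_right fun _ => forall_congr' fun i => forall_congr' fun hi => ?_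
      have : i ≠ j := fun hij => hj (hij ▸ hi)
      simp [this])
    rw [Finset.card_insert_of_notMem hj, pow_succ, ← mul_assoc]
    convert! this using 1
    ext m
    simp only [Finset.mem_insert, forall_eq_or_imp, Set.mem_inter_iff, Set.mem_ofPred_eq]
    tauto

theorem HasClassDensity.sum_le_one (hN : ∀ p, 2 ≤ N p) (hM : ∀ᶠ X in atTop, 0 < M X)
    (hscal : ∀ p, Tendsto (fun X => M (X / N p) / M X) atTop (𝓝 (N p : ℝ)⁻¹))
    (hfin : FiniteSublevels (tupleSize (monSize N) (k := k)))
    (h : HasClassDensity N κ M T b) {p : P}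
    (hT : ∀ j m, _root_.shiftAt j p m ∈ T ↔ m ∈ T) :
    HasClassDensity N κ M (T ∩ {m | ∑ j, m j p ≤ 1})
      (b * ((1 - (N p : ℝ)⁻¹) ^ k * (1 + k * (N p : ℝ)⁻¹))) := by
  classical
  set Z := T ∩ {m | ∀ j ∈ (Finset.univ : Finset (Fin k)), m j p = 0} with hZ
  have hz := h.slots_eq_zero hN hM hscal hfin hT Finset.univ
  rw [Finset.card_univ, Fintype.card_fin, ← hZ] at hz
  set b₀ := b * (1 - (N p : ℝ)⁻¹) ^ k
  have key : ∀ J : Finset (Fin k), HasClassDensity N κ M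
      (Z ∪ {m | ∃ j ∈ J, m ∈ _root_.shiftAt j p '' Z}) (b₀ + J.card * (b₀ * (N p : ℝ)⁻¹)) := by
    intro J
    induction J using Finset.induction_on with
    | empty => simpa using hz
    | insert j J hj ih =>
      have := ih.union hfin (hz.shiftAt hN hM hscal j p) (by
        rw [Set.disjoint_left]
        rintro m (hm | ⟨i, hi, m'', hm'', rfl⟩) ⟨m', hm', hmm'⟩
        · subst hmm'
          have := hm.2 j (Finset.mem_univ _)
          simp [shiftAt_apply] at this
        · have h1 := congrFun (congrArg (fun f : Fin k → P →₀ ℕ => (fun l => f l p)) hmm') j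
          have hij : j ≠ i := fun hij => hj (hij ▸ hi)
          have h2 := hm''.2 j (Finset.mem_univ _)
          simp [shiftAt_apply, hij, h2] at h1)
      convert! this using 1
      · ext m
        simp only [Finset.mem_insert, exists_eq_or_imp, Set.mem_union, Set.mem_ofPred_eq]
        rw [or_assoc]
        exact or_congr_right or_comm
      · rw [Finset.card_insert_of_notMem hj]
        push_cast
        ring
  have := key Finset.univ
  rw [Finset.card_univ, Fintype.card_fin] at this
  convert! this using 1
  · ext m
    simp only [Set.mem_inter_iff, Set.mem_ofPred_eq, Set.mem_union, Finset.mem_univ, true_and]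
    constructor
    · rintro ⟨hm, hsum⟩
      by_cases h0 : ∀ j, m j p = 0
      · exact Or.inl ⟨hm, fun j _ => h0 j⟩
      · push Not at h0
        obtain ⟨j, hj⟩ := h0
        right
        obtain ⟨m', rfl⟩ := exists_shiftAt_of_ne_zero hj
        refine ⟨j, m', ⟨(hT j m').1 hm, fun i _ => ?_⟩, rfl⟩
        simp only [shiftAt_apply, and_true, Finset.sum_add_distrib] at hsum
        rw [Finset.sum_ite_eq' Finset.univ j] at hsum
        simp only [Finset.mem_univ, if_true] at hsum
        have h3 := Finset.single_le_sum (f := fun i => m' i p) (fun _ _ => Nat.zero_le _)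
          (Finset.mem_univ i)
        omega
    · rintro (hm | ⟨j, m', hm', rfl⟩)
      · refine ⟨hm.1, ?_⟩
        rw [Finset.sum_eq_zero fun i hi => hm.2 i hi]
        exact zero_le_one
      · refine ⟨(hT j m').2 hm'.1, ?_⟩
        simp only [shiftAt_apply, and_true, Finset.sum_add_distrib]
        rw [Finset.sum_ite_eq' Finset.univ j, Finset.sum_eq_zero fun i hi => hm'.2 i hi]
        simp
  · ring

/-- The local factor of the squarefree tuple sieve. -/
def sieveFactor (k : ℕ) (n : ℕ) : ℝ := (1 - (n : ℝ)⁻¹) ^ k * (1 + k * (n : ℝ)⁻¹)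

theorem HasClassDensity.finset_sum_le_one (hN : ∀ p, 2 ≤ N p) (hM : ∀ᶠ X in atTop, 0 < M X)
    (hscal : ∀ p, Tendsto (fun X => M (X / N p) / M X) atTop (𝓝 (N p : ℝ)⁻¹))
    (hfin : FiniteSublevels (tupleSize (monSize N) (k := k)))
    (h : HasClassDensity N κ M (Set.univ : Set (Fin k → P →₀ ℕ)) b) (S : Finset P) :
    HasClassDensity N κ M {m : Fin k → P →₀ ℕ | ∀ p ∈ S, ∑ j, m j p ≤ 1}
      (b * ∏ p ∈ S, sieveFactor k (N p)) := by
  classical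
  induction S using Finset.induction_on with
  | empty => simpa [Set.ofPred_true] using h
  | insert p S hp ih =>
    have := ih.sum_le_one hN hM hscal hfin (p := p) (by
      intro j m
      refine forall_congr' fun q => forall_congr' fun hq => ?_
      have : q ≠ p := fun hqp => hp (hqp ▸ hq)
      simp [shiftAt_apply, this])
    rw [Finset.prod_insert hp]
    convert! this using 1
    · ext m
      simp only [Finset.mem_insert, forall_eq_or_imp, Set.mem_inter_iff, Set.mem_ofPred_eq]
      tauto
    · rw [sieveFactor]
      ring

theorem sieveFactor_pos (k : ℕ) {n : ℕ} (hn : 2 ≤ n) : 0 < sieveFactor k n := by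
  have h : (n : ℝ)⁻¹ < 1 := inv_lt_one_of_one_lt₀ (by exact_mod_cast hn)
  have h0 : 0 ≤ (n : ℝ)⁻¹ := by positivity
  unfold sieveFactor
  have : 0 < 1 - (n : ℝ)⁻¹ := by linarith
  positivity

theorem le_sieveFactor (k : ℕ) {n : ℕ} (hn : 2 ≤ n) :
    1 - (k : ℝ) ^ 2 * ((n : ℝ) ^ 2)⁻¹ ≤ sieveFactor k n := by
  have h : (n : ℝ)⁻¹ < 1 := inv_lt_one_of_one_lt₀ (by exact_mod_cast hn)
  have h0 : 0 ≤ (n : ℝ)⁻¹ := by positivity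
  have hb := one_add_mul_le_pow (a := -(n : ℝ)⁻¹) (by linarith) k
  unfold sieveFactor
  calc 1 - (k : ℝ) ^ 2 * ((n : ℝ) ^ 2)⁻¹ = (1 + k * -(n : ℝ)⁻¹) * (1 + k * (n : ℝ)⁻¹) := by
        ring
    _ ≤ (1 + -(n : ℝ)⁻¹) ^ k * (1 + k * (n : ℝ)⁻¹) := by gcongr
    _ = _ := by rw [← sub_eq_add_neg]

end FiniteSieve

section Tail

open SizeCount

theorem summable_inv_sq_of_linear_bound {P : Type*} {N : P → ℕ} (h1 : ∀ p, 1 ≤ N p)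
    (hfin : FiniteSublevels N) {C : ℝ} (hC : 0 < C)
    (hb : ∀ X ≥ 1, sizeCount N Set.univ X ≤ C * X) :
    Summable fun p => ((N p : ℝ) ^ 2)⁻¹ := by
  classical
  refine summable_of_sum_le (c := 2 * C * 2) (fun p => by positivity) fun t => ?_
  set J := t.sup (fun p => Nat.log 2 (N p)) + 1
  have hmaps : ∀ p ∈ t, Nat.log 2 (N p) ∈ Finset.range J := fun p hp => by
    rw [Finset.mem_range, Nat.lt_succ_iff]
    exact Finset.le_sup (f := fun p => Nat.log 2 (N p)) hp
  rw [← Finset.sum_fiberwise_of_maps_to hmaps]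
  have hstep : ∀ j ∈ Finset.range J,
      ∑ p ∈ t with Nat.log 2 (N p) = j, ((N p : ℝ) ^ 2)⁻¹ ≤ 2 * C * (1 / 2 : ℝ) ^ j := by
    intro j _
    have hle : ∀ p ∈ t.filter (fun p => Nat.log 2 (N p) = j),
        ((N p : ℝ) ^ 2)⁻¹ ≤ (((2 : ℝ) ^ j) ^ 2)⁻¹ := by
      intro p hp
      have hj := (Finset.mem_filter.1 hp).2
      have : 2 ^ j ≤ N p := hj ▸ Nat.pow_log_le_self 2 (by have := h1 p; omega)
      have : (2 : ℝ) ^ j ≤ N p := by exact_mod_cast this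
      gcongr
    refine (Finset.sum_le_card_nsmul _ _ _ hle).trans ?_
    have hcard : ((t.filter (fun p => Nat.log 2 (N p) = j)).card : ℝ) ≤ C * 2 ^ (j + 1) := by
      refine le_trans ?_ (hb (2 ^ (j + 1)) (one_le_pow₀ (by norm_num)))
      unfold sizeCount
      rw [← Set.ncard_coe_finset]
      refine Nat.cast_le.2 (Set.ncard_le_ncard ?_ (finite hfin Set.univ (2 ^ (j + 1))))
      intro p hp
      have hj := (Finset.mem_filter.1 hp).2
      have : N p < 2 ^ (j + 1) := hj ▸ Nat.lt_pow_succ_log_self (by norm_num) _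
      simp only [Set.mem_univ, true_and, Set.mem_ofPred_eq]
      exact_mod_cast this.le
    rw [nsmul_eq_mul]
    calc _ ≤ C * 2 ^ (j + 1) * (((2 : ℝ) ^ j) ^ 2)⁻¹ := by gcongr
      _ = 2 * C * (1 / 2 : ℝ) ^ j := by
        rw [one_div, inv_pow, pow_succ]
        field_simp
  refine (Finset.sum_le_sum hstep).trans ?_
  rw [← Finset.mul_sum]
  gcongr
  have := summable_geometric_two.sum_le_tsum (Finset.range J) (fun _ _ => by positivity)
  rwa [tsum_geometric_two] at this

theorem one_sub_sum_le_prod {ι : Type*} (s : Finset ι) (x w : ι → ℝ) (hx : ∀ i, 0 ≤ x i)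
    (hw : ∀ i, 0 ≤ w i) (hs : ∑ i ∈ s, x i ≤ 1) (hxw : ∀ i, 1 - x i ≤ w i) :
    1 - ∑ i ∈ s, x i ≤ ∏ i ∈ s, w i := by
  classical
  induction s using Finset.induction_on with
  | empty => simp
  | insert i s hi ih =>
    rw [Finset.sum_insert hi] at hs ⊢
    rw [Finset.prod_insert hi]
    have h0 : 0 ≤ ∑ i ∈ s, x i := Finset.sum_nonneg fun i _ => hx i
    have h1 := hx i
    have ih' := ih (by linarith)
    have h2 := hxw i
    have h3 := hw i
    calc 1 - (x i + ∑ i ∈ s, x i) ≤ (1 - x i) * (1 - ∑ i ∈ s, x i) := by nlinarith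
      _ ≤ w i * (1 - ∑ i ∈ s, x i) := by
        apply mul_le_mul_of_nonneg_right h2
        linarith
      _ ≤ w i * ∏ i ∈ s, w i := by gcongr

variable {P G : Type*} [AddCommGroup G] {N : P → ℕ} {k : ℕ}

/-- Tuples of effective divisors whose sum is reduced. -/
def reducedTuples (P : Type*) (k : ℕ) : Set (Fin k → P →₀ ℕ) := {m | ∀ p, ∑ j, m j p ≤ 1}

theorem sizeCount_two_le_sum (hN : ∀ p, 2 ≤ N p)
    (hfin : FiniteSublevels (tupleSize (monSize N) (k := k))) (p : P) (X : ℝ) :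
    sizeCount (tupleSize (monSize N)) {m : Fin k → P →₀ ℕ | 2 ≤ ∑ j, m j p} X ≤
      (k : ℝ) ^ 2 * tupleCount (monSize N) k (X / (N p : ℝ) ^ 2) := by
  classical
  have hp : (0 : ℝ) < N p := by have := hN p; positivity
  have hsub : {m : Fin k → P →₀ ℕ | m ∈ {m : Fin k → P →₀ ℕ | 2 ≤ ∑ j, m j p} ∧
      (tupleSize (monSize N) m : ℝ) ≤ X} ⊆
      ⋃ ij ∈ (Finset.univ : Finset (Fin k × Fin k)), (fun m => shiftAt ij.1 p (shiftAt ij.2 p m)) ''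
        {m | m ∈ Set.univ ∧ (tupleSize (monSize N) m : ℝ) ≤ X / (N p : ℝ) ^ 2} := by
    rintro m ⟨hm, hX⟩
    have hm : 2 ≤ ∑ j, m j p := hm
    simp only [Finset.mem_univ, Set.iUnion_true, Set.mem_iUnion, Prod.exists]
    have h1 : ∃ i, m i p ≠ 0 := by
      by_contra! h
      simp [h] at hm
    obtain ⟨i, hi⟩ := h1
    obtain ⟨m₁, rfl⟩ := exists_shiftAt_of_ne_zero hi
    have h2 : ∃ j, m₁ j p ≠ 0 := by
      by_contra! h
      simp [shiftAt_apply, h] at hm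
    obtain ⟨j, hj⟩ := h2
    obtain ⟨m₂, rfl⟩ := exists_shiftAt_of_ne_zero hj
    refine ⟨i, j, m₂, ⟨Set.mem_univ _, ?_⟩, rfl⟩
    rw [tupleSize_shiftAt, tupleSize_shiftAt] at hX
    rw [le_div_iff₀ (by positivity), pow_two, ← mul_assoc]
    exact_mod_cast hX
  have hfinU : (⋃ ij ∈ (Finset.univ : Finset (Fin k × Fin k)),
      (fun m => shiftAt ij.1 p (shiftAt ij.2 p m)) ''
        {m | m ∈ Set.univ ∧ (tupleSize (monSize N) m : ℝ) ≤ X / (N p : ℝ) ^ 2}).Finite :=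
    Set.Finite.biUnion (Finset.finite_toSet _) fun _ _ => (finite hfin _ _).image _
  unfold tupleCount sizeCount
  have h1 := Set.ncard_le_ncard hsub hfinU
  have h2 := Finset.set_ncard_biUnion_le (Finset.univ : Finset (Fin k × Fin k))
    fun ij => (fun m => shiftAt ij.1 p (shiftAt ij.2 p m)) ''
        {m | m ∈ Set.univ ∧ (tupleSize (monSize N) m : ℝ) ≤ X / (N p : ℝ) ^ 2}
  have h3 := h1.trans (h2.trans (Finset.sum_le_card_nsmul _ _ _ fun ij _ =>
    Set.ncard_image_le (finite hfin _ _)))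
  rw [Finset.card_univ, Fintype.card_prod, Fintype.card_fin, smul_eq_mul] at h3
  rw [pow_two]
  exact_mod_cast h3

theorem sizeCount_finset_sub_reduced (hN : ∀ p, 2 ≤ N p)
    (hfin : FiniteSublevels (tupleSize (monSize N) (k := k))) (hfinP : FiniteSublevels N) {C : ℝ}
    (hC : 0 ≤ C)
    (hM : ∀ X, ∀ y ≥ 1, tupleCount (monSize N) k (X / y) ≤ C / y * tupleCount (monSize N) k X)
    (S : Finset P) (τ : ℝ)
    (hS : ∀ t : Finset P, Disjoint t S → ∑ p ∈ t, ((N p : ℝ) ^ 2)⁻¹ ≤ τ)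
    (U : Set (Fin k → P →₀ ℕ)) (X : ℝ) :
    sizeCount (tupleSize (monSize N)) ({m | ∀ p ∈ S, ∑ j, m j p ≤ 1} ∩ U) X ≤
      sizeCount (tupleSize (monSize N)) (reducedTuples P k ∩ U) X +
        (k : ℝ) ^ 2 * C * τ * tupleCount (monSize N) k X := by
  classical
  set t := (finite hfinP Set.univ X).toFinset \ S with ht
  have hsub : {m : Fin k → P →₀ ℕ | m ∈ ({m | ∀ p ∈ S, ∑ j, m j p ≤ 1} ∩ U) ∧
      (tupleSize (monSize N) m : ℝ) ≤ X} ⊆ {m | m ∈ (reducedTuples P k ∩ U) ∧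
      (tupleSize (monSize N) m : ℝ) ≤ X} ∪
      ⋃ p ∈ t, {m | m ∈ {m : Fin k → P →₀ ℕ | 2 ≤ ∑ j, m j p} ∧
        (tupleSize (monSize N) m : ℝ) ≤ X} := by
    rintro m ⟨⟨hmS, hmU⟩, hX⟩
    by_cases hred : m ∈ reducedTuples P k
    · exact Or.inl ⟨⟨hred, hmU⟩, hX⟩
    · right
      simp only [reducedTuples, Set.mem_ofPred_eq, not_forall, not_le] at hred
      obtain ⟨p, hp⟩ := hred
      simp only [Set.mem_iUnion]
      refine ⟨p, ?_, hp, hX⟩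
      rw [ht, Finset.mem_sdiff]
      refine ⟨?_, fun hpS => ?_⟩
      · simp only [Set.Finite.mem_toFinset, Set.mem_univ, true_and, Set.mem_ofPred_eq]
        have : ∃ i, m i p ≠ 0 := by
          by_contra! h
          simp [h] at hp
        obtain ⟨i, hi⟩ := this
        obtain ⟨m', rfl⟩ := exists_shiftAt_of_ne_zero hi
        refine le_trans ?_ hX
        rw [tupleSize_shiftAt]
        exact_mod_cast Nat.le_mul_of_pos_left _
          (one_le_tupleSize (one_le_monSize hN) m')
      · have := hmS p hpS
        omega
  have hfinU : (⋃ p ∈ t, {m | m ∈ {m : Fin k → P →₀ ℕ | 2 ≤ ∑ j, m j p} ∧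
        (tupleSize (monSize N) m : ℝ) ≤ X}).Finite :=
    Set.Finite.biUnion (Finset.finite_toSet _) fun _ _ => finite hfin _ _
  have h1 := (Set.ncard_le_ncard hsub ((finite hfin _ _).union hfinU)).trans (Set.ncard_union_le _ _)
  have h2 := Finset.set_ncard_biUnion_le t fun p => {m | m ∈ {m : Fin k → P →₀ ℕ | 2 ≤ ∑ j, m j p} ∧
        (tupleSize (monSize N) m : ℝ) ≤ X}
  have h3 : ((∑ p ∈ t, {m | m ∈ {m : Fin k → P →₀ ℕ | 2 ≤ ∑ j, m j p} ∧
        (tupleSize (monSize N) m : ℝ) ≤ X}.ncard : ℕ) : ℝ) ≤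
      (k : ℝ) ^ 2 * C * τ * tupleCount (monSize N) k X := by
    rw [Nat.cast_sum]
    calc _ ≤ ∑ p ∈ t, (k : ℝ) ^ 2 * (C / (N p : ℝ) ^ 2 * tupleCount (monSize N) k X) := by
          refine Finset.sum_le_sum fun p _ => (sizeCount_two_le_sum hN hfin p X).trans ?_
          gcongr
          refine hM X _ (one_le_pow₀ ?_)
          have := hN p
          exact_mod_cast (by omega : 1 ≤ N p)
      _ = (k : ℝ) ^ 2 * C * (∑ p ∈ t, ((N p : ℝ) ^ 2)⁻¹) * tupleCount (monSize N) k X := by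
          rw [Finset.mul_sum, Finset.sum_mul]
          refine Finset.sum_congr rfl fun p _ => ?_
          ring
      _ ≤ _ := by
          have := tupleCount_nonneg (N := monSize N) k X
          gcongr
          exact hS t Finset.sdiff_disjoint
  have h4 := (Nat.cast_le (α := ℝ)).2 (h1.trans (Nat.add_le_add_left h2 _))
  rw [Nat.cast_add] at h4
  unfold sizeCount
  linarith

/-- **Equidistribution of reduced tuples in classes.** -/
theorem reducedTuples_equidistribution [Fintype G] (hN : ∀ p, 2 ≤ N p)
    (hfin : FiniteSublevels (monSize N)) (κ : (P →₀ ℕ) →+ G) {δ : ℝ} (hδ : 0 < δ)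
    (hlim : ∀ g, Tendsto (fun X => sizeCount (monSize N) {a | κ a = g} X / X) atTop (𝓝 δ))
    (k : ℕ) :
    ∃ F : ℝ → ℝ, Tendsto F atTop atTop ∧ ∀ g : Fin (k + 1) → G,
      Tendsto (fun X => sizeCount (tupleSize (monSize N)) (reducedTuples P (k + 1) ∩
        classTuples κ g) X / F X) atTop (𝓝 1) := by
  classical
  have h1 := one_le_monSize hN
  have hone : ∃ a, monSize N a = 1 := ⟨0, monSize_zero⟩
  have hδ' : 0 < Fintype.card G * δ := by
    have : 0 < Fintype.card G := Fintype.card_pos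
    positivity
  have htot := tendsto_sizeCount_univ_div hfin κ hlim
  have hfinT := hfin.tuple h1 (k + 1)
  have hfinP : FiniteSublevels N := by
    intro X
    refine Set.Finite.of_injOn (f := fun p : P => Finsupp.single p 1) (t := {m | (monSize N m : ℝ) ≤ X})
      ?_ ?_ (hfin X)
    · intro p hp
      simpa [monSize_single] using hp
    · exact (Finsupp.single_left_injective one_ne_zero).injOn
  obtain ⟨C, hC, hCX⟩ := exists_linear_upper_bound hfin hδ' htot
  have hsum : Summable fun p => ((N p : ℝ) ^ 2)⁻¹ := by
    refine summable_inv_sq_of_linear_bound (fun p => by have := hN p; omega) hfinP hC fun X hX => ?_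
    refine le_trans ?_ (hCX X hX)
    unfold sizeCount
    norm_cast
    refine Set.ncard_le_ncard_of_injOn (fun p : P => Finsupp.single p 1) ?_
      (Finsupp.single_left_injective one_ne_zero).injOn (finite hfin _ _)
    intro p hp
    simpa [monSize_single] using hp
  obtain ⟨C', hC', hCM⟩ := tupleCount_mul_le hfin h1 hone hδ' htot k
  set M := tupleCount (monSize N) (k + 1)
  have hMpos : ∀ᶠ X in atTop, 0 < M X := by
    filter_upwards [eventually_ge_atTop 1] with X hX
    exact tupleCount_pos hone hfin h1 _ hX
  have hMtop : Tendsto M atTop atTop := tendsto_tupleCount_atTop hfin h1 hone hδ' htot k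
  have hscal : ∀ p, Tendsto (fun X => M (X / N p) / M X) atTop (𝓝 (N p : ℝ)⁻¹) := fun p =>
    tupleCount_scaling hfin h1 hone hδ' htot k (by have := hN p; exact_mod_cast (by omega : 1 ≤ N p))
  set b : ℝ := (Fintype.card (Fin (k + 1) → G) : ℝ)⁻¹
  have hb : 0 < b := by
    have : 0 < Fintype.card (Fin (k + 1) → G) := Fintype.card_pos
    positivity
  have hdens : HasClassDensity N κ M (Set.univ : Set (Fin (k + 1) → P →₀ ℕ)) b := by
    intro g
    rw [Set.univ_inter]
    exact tendsto_classTuples_div hfin h1 hone κ hδ hlim g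
  have hfs := fun S => hdens.finset_sum_le_one hN hMpos hscal hfinT S
  set w : P → ℝ := fun p => sieveFactor (k + 1) (N p)
  have hwpos : ∀ p, 0 < w p := fun p => sieveFactor_pos _ (hN p)
  have hk : (0 : ℝ) < ((k + 1 : ℕ) : ℝ) ^ 2 := by positivity
  -- finite sets of primes with small tails
  have htail : ∀ τ > 0, ∃ S : Finset P, ∀ t : Finset P, Disjoint t S →
      ∑ p ∈ t, ((N p : ℝ) ^ 2)⁻¹ ≤ τ := by
    intro τ hτ
    obtain ⟨S, hS⟩ := (summable_iff_vanishing_norm.1 hsum) τ hτ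
    exact ⟨S, fun t ht => (le_abs_self _).trans (hS t ht).le⟩
  obtain ⟨S₀, hS₀⟩ := htail ((2 * ((k + 1 : ℕ) : ℝ) ^ 2)⁻¹) (by positivity)
  set β := b * ∏ p ∈ S₀, w p with hβdef
  have hβ : 0 < β := mul_pos hb (Finset.prod_pos fun p _ => hwpos p)
  have hlower : ∀ S, S₀ ⊆ S → β / 2 ≤ b * ∏ p ∈ S, w p := by
    intro S hS
    rw [← Finset.prod_sdiff hS, mul_comm (∏ p ∈ S \ S₀, w p), ← mul_assoc, ← hβdef, div_eq_mul_inv]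
    gcongr
    have hx : ∑ p ∈ S \ S₀, ((k + 1 : ℕ) : ℝ) ^ 2 * ((N p : ℝ) ^ 2)⁻¹ ≤ 2⁻¹ := by
      rw [← Finset.mul_sum]
      calc _ ≤ ((k + 1 : ℕ) : ℝ) ^ 2 * (2 * ((k + 1 : ℕ) : ℝ) ^ 2)⁻¹ := by
            gcongr
            exact hS₀ _ Finset.sdiff_disjoint
        _ = 2⁻¹ := by field_simp
    have := one_sub_sum_le_prod (S \ S₀) (fun p => ((k + 1 : ℕ) : ℝ) ^ 2 * ((N p : ℝ) ^ 2)⁻¹) w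
      (fun p => by positivity) (fun p => (hwpos p).le) (hx.trans (by norm_num))
      (fun p => le_sieveFactor (k + 1) (hN p))
    linarith
  set Ag : (Fin (k + 1) → G) → ℝ → ℝ := fun g X =>
    sizeCount (tupleSize (monSize N)) (reducedTuples P (k + 1) ∩ classTuples κ g) X with hAg
  -- approximation of the reduced count
  have happrox : ∀ ε > 0, ∃ b' ≥ β / 2, ∀ g, ∀ᶠ X in atTop, |Ag g X / M X - b'| ≤ ε := by
    intro ε hε
    obtain ⟨S₁, hS₁⟩ := htail (ε / 2 / (((k + 1 : ℕ) : ℝ) ^ 2 * C')) (by positivity)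
    refine ⟨b * ∏ p ∈ S₀ ∪ S₁, w p, hlower _ Finset.subset_union_left, fun g => ?_⟩
    have hlimS := hfs (S₀ ∪ S₁) g
    filter_upwards [(Metric.tendsto_nhds.1 hlimS) (ε / 2) (by positivity), hMpos] with X hX hMX
    rw [Real.dist_eq] at hX
    have hup := sizeCount_finset_sub_reduced hN hfinT hfinP hC'.le hCM (S₀ ∪ S₁)
      (ε / 2 / (((k + 1 : ℕ) : ℝ) ^ 2 * C')) (fun t ht => hS₁ t
        (ht.mono_right Finset.subset_union_right)) (classTuples κ g) X
    have hlo : Ag g X ≤ sizeCount (tupleSize (monSize N))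
        ({m | ∀ p ∈ S₀ ∪ S₁, ∑ j, m j p ≤ 1} ∩ classTuples κ g) X :=
      by
      refine SizeCount.mono hfinT (Set.inter_subset_inter_left _ ?_) le_rfl
      exact fun m hm p _ => hm p
    rw [mul_div_cancel₀ _ (by positivity)] at hup
    set B := sizeCount (tupleSize (monSize N))
        ({m | ∀ p ∈ S₀ ∪ S₁, ∑ j, m j p ≤ 1} ∩ classTuples κ g) X
    have h5 : B / M X ≤ Ag g X / M X + ε / 2 := by
      rw [div_add' _ _ _ hMX.ne']
      gcongr
    have h6 : Ag g X / M X ≤ B / M X := by gcongr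
    rw [abs_le]
    rw [abs_lt] at hX
    constructor <;> linarith [hX.1, hX.2]
  refine ⟨Ag 0, ?_, fun g => ?_⟩
  · obtain ⟨b', hb', happ⟩ := happrox (β / 4) (by positivity)
    refine tendsto_atTop_mono' atTop ?_ (hMtop.const_mul_atTop (show 0 < β / 4 by positivity))
    filter_upwards [happ 0, hMpos] with X hX hMX
    rw [abs_le] at hX
    have : β / 4 ≤ Ag 0 X / M X := by linarith [hX.1]
    rwa [le_div_iff₀ hMX] at this
  · rw [Metric.tendsto_nhds]
    intro ε hε
    set η := min (β / 4) (ε * β / 16)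
    have hη : 0 < η := by positivity
    obtain ⟨b', hb', happ⟩ := happrox η hη
    filter_upwards [happ 0, happ g, hMpos] with X hX hXg hMX
    have hη1 : η ≤ β / 4 := min_le_left _ _
    have hη2 : η ≤ ε * β / 16 := min_le_right _ _
    rw [abs_le] at hX hXg
    have hu : β / 4 ≤ Ag 0 X / M X := by linarith [hX.1]
    have hu0 : 0 < Ag 0 X / M X := by linarith
    have hA0 : 0 < Ag 0 X := by
      rwa [div_pos_iff_of_pos_right hMX] at hu0
    have hrw : Ag g X / Ag 0 X = (Ag g X / M X) / (Ag 0 X / M X) := by field_simp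
    change dist (Ag g X / Ag 0 X) 1 < ε
    rw [hrw, Real.dist_eq, div_sub_one hu0.ne', abs_div, abs_of_pos hu0, div_lt_iff₀ hu0, abs_lt]
    constructor <;> nlinarith [hX.1, hX.2, hXg.1, hXg.2]

end Tail

section CosetCount

open Module MeasureTheory Bornology Pointwise

variable {E : Type*} [NormedAddCommGroup E] [InnerProductSpace ℝ E] [FiniteDimensional ℝ E]
  [MeasurableSpace E] [BorelSpace E]
  (L : Submodule ℤ E) [DiscreteTopology L] [IsZLattice ℝ L]

/-- The points of a coset `v + L` of a lattice in a sublevel set of `F` on `X`. -/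
def cosetPoints (X : Set E) (F : E → ℝ) (v : E) (c : ℝ) : Set E :=
  {x | x ∈ X ∧ F x ≤ c ∧ x - v ∈ L}

theorem cosetPoints_mono (X : Set E) (F : E → ℝ) (v : E) {c c' : ℝ} (h : c ≤ c') :
    cosetPoints L X F v c ⊆ cosetPoints L X F v c' :=
  fun _ hx => ⟨hx.1, hx.2.1.trans h, hx.2.2⟩

variable {L} {X : Set E} {F : E → ℝ}

theorem mem_smul_sublevel_iff
    (hX : ∀ ⦃x⦄ ⦃r : ℝ⦄, x ∈ X → 0 < r → r • x ∈ X)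
    (h₁ : ∀ x ⦃r : ℝ⦄, 0 ≤ r → F (r • x) = r ^ finrank ℝ E * (F x)) {t : ℝ} (ht : 0 < t) (x : E) :
    (t • x ∈ X ∧ F (t • x) ≤ t ^ finrank ℝ E) ↔ (x ∈ X ∧ F x ≤ 1) := by
  rw [h₁ _ ht.le]
  refine and_congr ⟨fun h => ?_, fun h => hX h ht⟩ ?_
  · simpa [smul_smul, inv_mul_cancel₀ ht.ne'] using hX h (inv_pos.2 ht)
  · exact mul_le_iff_le_one_right (pow_pos ht _)

theorem cosetPoints_finite
    (hX : ∀ ⦃x⦄ ⦃r : ℝ⦄, x ∈ X → 0 < r → r • x ∈ X)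
    (h₁ : ∀ x ⦃r : ℝ⦄, 0 ≤ r → F (r • x) = r ^ finrank ℝ E * (F x))
    (h₂ : IsBounded {x ∈ X | F x ≤ 1}) (v : E) {t : ℝ} (ht : 0 < t) :
    (cosetPoints L X F v (t ^ finrank ℝ E)).Finite := by
  have hb : IsBounded ((fun x => t • x - v) '' {x ∈ X | F x ≤ 1}) := by
    have h := (h₂.smul₀ t).sub (isBounded_singleton (x := v))
    refine h.subset ?_
    rintro _ ⟨x, hx, rfl⟩
    exact Set.sub_mem_sub (Set.smul_mem_smul_set hx) rfl
  have hfin := Metric.finite_isBounded_inter_isClosed (s := (L : Set E))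
    (DiscreteTopology.isDiscrete) hb (by
      have : IsClosed (L.toAddSubgroup : Set E) := inferInstance
      exact this)
  refine (hfin.image (fun x => x + v)).subset ?_
  rintro x ⟨hx1, hx2, hx3⟩
  refine ⟨x - v, ⟨⟨t⁻¹ • x, ?_, ?_⟩, hx3⟩, by simp⟩
  · refine (mem_smul_sublevel_iff hX h₁ ht _).1 ?_
    rw [smul_inv_smul₀ ht.ne']
    exact ⟨hx1, hx2⟩
  · simp [smul_inv_smul₀ ht.ne']

/-- For `n ≡ 1` modulo the order of `v` in `E / L`, points of `v + L` in the dilation by `n`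
are points of the rescaled lattice in a translate. -/
theorem card_cosetPoints_pow
    (hX : ∀ ⦃x⦄ ⦃r : ℝ⦄, x ∈ X → 0 < r → r • x ∈ X)
    (h₁ : ∀ x ⦃r : ℝ⦄, 0 ≤ r → F (r • x) = r ^ finrank ℝ E * (F x))
    (v : E) {q : ℕ} (hqv : (q : ℤ) • v ∈ L) (m : ℕ) :
    Nat.card (cosetPoints L X F v (((q * m + 1 : ℕ) : ℝ) ^ finrank ℝ E)) =
      Nat.card (((fun y => y + v) ⁻¹' {x ∈ X | F x ≤ 1}) ∩
        (((q * m + 1 : ℕ) : ℝ)⁻¹ • (L : Set E)) : Set E) := by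
  set n : ℕ := q * m + 1 with hn
  have hn0 : (0 : ℝ) < n := by rw [hn]; positivity
  have hv : (n : ℝ) • v - v ∈ L := by
    have h := L.smul_mem (m : ℤ) hqv
    convert h using 1
    rw [smul_smul, ← Int.cast_smul_eq_zsmul ℝ, hn]
    push_cast
    rw [add_smul, one_smul, add_sub_cancel_right, mul_comm]
  refine (Nat.card_congr ?_).symm
  refine Equiv.subtypeEquiv ((Equiv.addRight v).trans (Equiv.smulRight hn0.ne')) fun y => ?_
  have e : ((Equiv.addRight v).trans (Equiv.smulRight hn0.ne')) y = (n : ℝ) • (y + v) := rfl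
  rw [e]
  have h1 := mem_smul_sublevel_iff hX h₁ hn0 (y + v)
  have h2 : y ∈ ((n : ℝ)⁻¹ • (L : Set E)) ↔ (n : ℝ) • (y + v) - v ∈ L := by
    rw [Set.mem_smul_set_iff_inv_smul_mem₀ (inv_ne_zero hn0.ne'), inv_inv, SetLike.mem_coe,
      smul_add, add_sub_assoc]
    exact (L.add_mem_iff_left hv).symm
  change (y + v ∈ X ∧ F (y + v) ≤ 1) ∧ _ ↔ _ ∧ _ ∧ _
  rw [h2, ← h1, and_assoc]

theorem tendsto_card_cosetPoints_pow
    (hX : ∀ ⦃x⦄ ⦃r : ℝ⦄, x ∈ X → 0 < r → r • x ∈ X)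
    (h₁ : ∀ x ⦃r : ℝ⦄, 0 ≤ r → F (r • x) = r ^ finrank ℝ E * (F x))
    (h₂ : IsBounded {x ∈ X | F x ≤ 1}) (h₃ : MeasurableSet {x ∈ X | F x ≤ 1})
    (h₄ : volume (frontier {x ∈ X | F x ≤ 1}) = 0)
    (v : E) {q : ℕ} (hq : 0 < q) (hqv : (q : ℤ) • v ∈ L) :
    Tendsto (fun m : ℕ => (Nat.card (cosetPoints L X F v
        (((q * m + 1 : ℕ) : ℝ) ^ finrank ℝ E)) : ℝ) / ((q * m + 1 : ℕ) : ℝ) ^ finrank ℝ E)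
      atTop (𝓝 (volume.real {x ∈ X | F x ≤ 1} / ZLattice.covolume L)) := by
  have hvol : volume.real ((fun y => y + v) ⁻¹' {x ∈ X | F x ≤ 1}) =
      volume.real {x ∈ X | F x ≤ 1} := by
    simp only [Measure.real, measure_preimage_add_right]
  rw [← hvol]
  have hs1 : IsBounded ((fun y => y + v) ⁻¹' {x ∈ X | F x ≤ 1}) := by
    have h := h₂.sub (isBounded_singleton (x := v))
    refine h.subset fun y hy => ?_
    rw [show y = (y + v) - v by simp]
    exact Set.sub_mem_sub hy rfl
  have hs2 : MeasurableSet ((fun y => y + v) ⁻¹' {x ∈ X | F x ≤ 1}) :=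
    (measurable_add_const v) h₃
  have hs3 : volume (frontier ((fun y => y + v) ⁻¹' {x ∈ X | F x ≤ 1})) = 0 := by
    have h := (Homeomorph.addRight v).preimage_frontier {x ∈ X | F x ≤ 1}
    rw [Homeomorph.coe_addRight] at h
    rw [← h, measure_preimage_add_right, h₄]
  have hlim := (ZLattice.covolume.tendsto_card_div_pow' L hs1 hs2 hs3).comp
    (show Tendsto (fun m : ℕ => q * m + 1) atTop atTop from
      tendsto_atTop_mono (fun m => show m ≤ q * m + 1 by nlinarith) tendsto_id)
  refine hlim.congr fun m => ?_
  simp only [Function.comp]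
  rw [card_cosetPoints_pow hX h₁ v hqv m]

/-- Lattice point count in a coset of a lattice, for the sublevel sets of a homogeneous
function on a cone. -/
theorem tendsto_card_cosetPoints_div [Nontrivial E]
    (hX : ∀ ⦃x⦄ ⦃r : ℝ⦄, x ∈ X → 0 < r → r • x ∈ X)
    (h₁ : ∀ x ⦃r : ℝ⦄, 0 ≤ r → F (r • x) = r ^ finrank ℝ E * (F x))
    (h₂ : IsBounded {x ∈ X | F x ≤ 1}) (h₃ : MeasurableSet {x ∈ X | F x ≤ 1})
    (h₄ : volume (frontier {x ∈ X | F x ≤ 1}) = 0)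
    (v : E) {q : ℕ} (hq : 0 < q) (hqv : (q : ℤ) • v ∈ L) :
    Tendsto (fun c : ℝ => (Nat.card (cosetPoints L X F v c) : ℝ) / c)
      atTop (𝓝 (volume.real {x ∈ X | F x ≤ 1} / ZLattice.covolume L)) := by
  set d := finrank ℝ E with hd
  have hd0 : (d : ℝ) ≠ 0 := Nat.cast_ne_zero.2 finrank_pos.ne'
  set V := volume.real {x ∈ X | F x ≤ 1} / ZLattice.covolume L
  set A : ℕ → ℝ := fun m => (Nat.card (cosetPoints L X F v (((q * m + 1 : ℕ) : ℝ) ^ d)) : ℝ)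
    with hA
  set n : ℕ → ℝ := fun m => ((q * m + 1 : ℕ) : ℝ) with hn
  have hnpos : ∀ m, 0 < n m := fun m => by simp only [hn]; positivity
  have hlim : Tendsto (fun m => A m / n m ^ d) atTop (𝓝 V) :=
    tendsto_card_cosetPoints_pow hX h₁ h₂ h₃ h₄ v hq hqv
  have hlim' : Tendsto (fun m => A (m + 1) / n (m + 1) ^ d) atTop (𝓝 V) :=
    hlim.comp (tendsto_add_atTop_nat 1)
  have hntop : Tendsto n atTop atTop := by
    refine tendsto_natCast_atTop_atTop.comp
      (tendsto_atTop_mono (fun m => ?_) tendsto_id)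
    change m ≤ q * m + 1
    nlinarith
  have hsucc : ∀ m, n (m + 1) = n m + q := fun m => by simp only [hn]; push_cast; ring
  have hratio : Tendsto (fun m => n (m + 1) / n m) atTop (𝓝 1) := by
    have h := (tendsto_const_nhds (x := (q : ℝ))).div_atTop hntop
    have h' := h.const_add 1
    rw [add_zero] at h'
    refine h'.congr fun m => ?_
    rw [hsucc, add_div, div_self (hnpos m).ne']
  have hup : Tendsto (fun m => A (m + 1) / n m ^ d) atTop (𝓝 V) := by
    have h := hlim'.mul (hratio.pow d)
    rw [one_pow, mul_one] at h
    refine h.congr fun m => ?_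
    have := (hnpos m).ne'
    have := (hnpos (m + 1)).ne'
    rw [div_pow]
    field_simp
  have hlow : Tendsto (fun m => A m / n (m + 1) ^ d) atTop (𝓝 V) := by
    have h := hlim.mul ((hratio.inv₀ one_ne_zero).pow d)
    rw [inv_one, one_pow, mul_one] at h
    refine h.congr fun m => ?_
    have := (hnpos m).ne'
    have := (hnpos (m + 1)).ne'
    rw [inv_div, div_pow]
    field_simp
  set μ : ℝ → ℕ := fun c => ⌊(c ^ (d : ℝ)⁻¹ - 1) / q⌋₊ with hμ
  have hq' : (0 : ℝ) < q := Nat.cast_pos.2 hq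
  have hμtop : Tendsto μ atTop atTop := by
    refine tendsto_nat_floor_atTop.comp (Tendsto.atTop_div_const hq' ?_)
    exact tendsto_atTop_add_const_right _ _ (tendsto_rpow_atTop (by positivity))
  refine tendsto_of_tendsto_of_tendsto_of_le_of_le' (hlow.comp hμtop) (hup.comp hμtop) ?_ ?_
  all_goals
    filter_upwards [eventually_ge_atTop 1] with c hc
    have hc0 : 0 < c := by linarith
    set t := c ^ (d : ℝ)⁻¹ with ht
    have htc : t ^ d = c := by
      rw [ht, ← Real.rpow_natCast, Real.rpow_inv_rpow hc0.le hd0]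
    have ht1 : 1 ≤ t := Real.one_le_rpow hc (by positivity)
    have hnonneg : 0 ≤ (t - 1) / q := div_nonneg (by linarith) hq'.le
    have hl : n (μ c) ≤ t := by
      have := Nat.floor_le hnonneg
      rw [le_div_iff₀ hq'] at this
      simp only [hn, hμ]
      push_cast
      linarith
    have hu : t ≤ n (μ c + 1) := by
      have := (Nat.lt_floor_add_one ((t - 1) / q)).le
      rw [div_le_iff₀ hq'] at this
      simp only [hn, hμ]
      push_cast
      linarith
    have hl' : n (μ c) ^ d ≤ c := htc ▸ pow_le_pow_left₀ (hnpos _).le hl d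
    have hu' : c ≤ n (μ c + 1) ^ d := htc ▸ pow_le_pow_left₀ (by linarith) hu d
    simp only [Function.comp]
  · refine div_le_div₀ (Nat.cast_nonneg _) (Nat.cast_le.2 ?_) hc0 hu'
    refine Nat.card_mono ?_ (cosetPoints_mono L X F v hl')
    rw [← htc]
    exact cosetPoints_finite hX h₁ h₂ v (by linarith)
  · refine div_le_div₀ (Nat.cast_nonneg _) (Nat.cast_le.2 ?_) (pow_pos (hnpos _) _) hl'
    exact Nat.card_mono (cosetPoints_finite hX h₁ h₂ v (hnpos _)) (cosetPoints_mono L X F v hu')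

end CosetCount

section RayCount

open NumberField Ideal InfinitePlace mixedEmbedding euclidean fundamentalCone Submodule Units
open scoped nonZeroDivisors Real Classical

variable (K : Type*) [Field K] [NumberField K]

theorem card_isPrincipal_norm_le_mul_torsion (p : Ideal (𝓞 K) → Prop) (s : ℝ) :
    Nat.card {I : (Ideal (𝓞 K))⁰ // IsPrincipal (I : Ideal (𝓞 K)) ∧ p I ∧
      (absNorm (I : Ideal (𝓞 K)) : ℝ) ≤ s} * torsionOrder K =
    Nat.card {a : integerSet K // p (span {(preimageOfMemIntegerSet a : 𝓞 K)}) ∧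
      mixedEmbedding.norm (a : mixedSpace K) ≤ s} := by
  rw [torsionOrder, ← Nat.card_prod]
  refine Nat.card_congr ?_
  calc _ ≃ {I : {I : (Ideal (𝓞 K))⁰ // IsPrincipal (I : Ideal (𝓞 K))} // p I.1 ∧
            (absNorm (I.1 : Ideal (𝓞 K)) : ℝ) ≤ s} × torsion K :=
        Equiv.prodCongrLeft fun _ => (Equiv.subtypeSubtypeEquivSubtypeInter
          (fun I : (Ideal (𝓞 K))⁰ => IsPrincipal (I : Ideal (𝓞 K)))
          (fun I => p I ∧ (absNorm (I : Ideal (𝓞 K)) : ℝ) ≤ s)).symm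
    _ ≃ {y : {I : (Ideal (𝓞 K))⁰ // IsPrincipal (I : Ideal (𝓞 K))} × torsion K // p y.1.1 ∧
            (absNorm (y.1.1 : Ideal (𝓞 K)) : ℝ) ≤ s} :=
        (Equiv.prodSubtypeFstEquivSubtypeProd
          (p := fun I : {I : (Ideal (𝓞 K))⁰ // IsPrincipal (I : Ideal (𝓞 K))} =>
            p I.1 ∧ (absNorm (I.1 : Ideal (𝓞 K)) : ℝ) ≤ s)).symm
    _ ≃ _ := (Equiv.subtypeEquiv (integerSetEquiv K) fun a => by
        rw [integerSetEquiv_apply_fst, ← intNorm_coe, absNorm_span_singleton]; rfl).symm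

/-- The fundamental cone, seen in the Euclidean mixed space. -/
def euclideanCone : Set (euclidean.mixedSpace K) := toMixed K ⁻¹' fundamentalCone K

/-- The norm on the Euclidean mixed space. -/
def euclideanNorm (x : euclidean.mixedSpace K) : ℝ := mixedEmbedding.norm (toMixed K x)

/-- The lattice of an ideal, seen in the Euclidean mixed space. -/
abbrev euclideanLattice (J : (Ideal (𝓞 K))⁰) : Submodule ℤ (euclidean.mixedSpace K) :=
  ZLattice.comap ℝ (idealLattice K (FractionalIdeal.mk0 K J)) (toMixed K).toLinearMap

/-- The image of an integer in the Euclidean mixed space. -/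
def euclideanEmbed (x : 𝓞 K) : euclidean.mixedSpace K := (toMixed K).symm (mixedEmbedding K x)

variable {K}

theorem euclideanEmbed_injective : Function.Injective (euclideanEmbed K) :=
  (toMixed K).symm.injective.comp
    ((mixedEmbedding_injective K).comp RingOfIntegers.coe_injective)

theorem mem_euclideanLattice (J : (Ideal (𝓞 K))⁰) (y : euclidean.mixedSpace K) :
    y ∈ euclideanLattice K J ↔ ∃ x ∈ (J : Ideal (𝓞 K)), euclideanEmbed K x = y := by
  have h : y ∈ euclideanLattice K J ↔
      toMixed K y ∈ idealLattice K (FractionalIdeal.mk0 K J) := Iff.rfl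
  rw [h, mem_idealLattice]
  simp only [FractionalIdeal.coe_mk0, euclideanEmbed]
  constructor
  · rintro ⟨x, hx, hxy⟩
    obtain ⟨x', hx', rfl⟩ := (FractionalIdeal.mem_coeIdeal _).1 hx
    exact ⟨x', hx', by rw [hxy]; simp⟩
  · rintro ⟨x, hx, rfl⟩
    exact ⟨x, (FractionalIdeal.mem_coeIdeal _).2 ⟨x, hx, rfl⟩, by simp⟩

theorem euclideanEmbed_sub_mem_iff (J : (Ideal (𝓞 K))⁰) (x v : 𝓞 K) :
    euclideanEmbed K x - euclideanEmbed K v ∈ euclideanLattice K J ↔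
      x - v ∈ (J : Ideal (𝓞 K)) := by
  have h : euclideanEmbed K x - euclideanEmbed K v = euclideanEmbed K (x - v) := by
    simp [euclideanEmbed]
  rw [h, mem_euclideanLattice]
  exact ⟨fun ⟨y, hy, hyx⟩ => euclideanEmbed_injective hyx ▸ hy, fun h => ⟨_, h, rfl⟩⟩

variable (K) in
/-- The volume of the set of points of norm at most one in the fundamental cone. -/
def coneVolume : ℝ :=
  MeasureTheory.volume.real {x | x ∈ euclideanCone K ∧ euclideanNorm K x ≤ 1}

variable (K) in
theorem setOf_euclideanCone_eq :
    {x | x ∈ euclideanCone K ∧ euclideanNorm K x ≤ 1} = toMixed K ⁻¹' normLeOne K := by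
  ext; simp [euclideanCone, euclideanNorm]

variable (K) in
theorem coneVolume_pos : 0 < coneVolume K := by
  rw [coneVolume, setOf_euclideanCone_eq, MeasureTheory.measureReal_def,
    (volumePreserving_toMixed K).measure_preimage (measurableSet_normLeOne K).nullMeasurableSet,
    volume_normLeOne]
  have := regulator_pos K
  simp only [ENNReal.toReal_mul, ENNReal.toReal_pow, ENNReal.toReal_ofNat,
    ENNReal.toReal_ofReal this.le]
  have : (0 : ℝ) < NNReal.toReal NNReal.pi := Real.pi_pos
  simp only [ENNReal.coe_toReal]
  positivity

theorem smul_mem_euclideanCone ⦃x : euclidean.mixedSpace K⦄ ⦃r : ℝ⦄ (h : x ∈ euclideanCone K)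
    (hr : 0 < r) : r • x ∈ euclideanCone K := by
  change toMixed K (r • x) ∈ fundamentalCone K
  rw [map_smul, smul_mem_iff_mem hr.ne']
  exact h

theorem euclideanNorm_smul (x : euclidean.mixedSpace K) ⦃r : ℝ⦄ (h : 0 ≤ r) :
    euclideanNorm K (r • x) =
      r ^ Module.finrank ℝ (euclidean.mixedSpace K) * euclideanNorm K x := by
  rw [euclideanNorm, map_smul, mixedEmbedding.norm_smul, euclidean.finrank, abs_of_nonneg h,
    euclideanNorm]

variable (K) in
theorem isBounded_euclideanCone :
    Bornology.IsBounded {x | x ∈ euclideanCone K ∧ euclideanNorm K x ≤ 1} := by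
  rw [setOf_euclideanCone_eq]
  exact (toMixed K).antilipschitz.isBounded_preimage (isBounded_normLeOne K)

theorem finite_idealCoset (J : (Ideal (𝓞 K))⁰) (v : euclidean.mixedSpace K) {s : ℝ}
    (hs : 0 < s) : (cosetPoints (euclideanLattice K J) (euclideanCone K)
      (euclideanNorm K) v s).Finite := by
  have h := cosetPoints_finite (L := euclideanLattice K J) (smul_mem_euclideanCone (K := K))
    euclideanNorm_smul (isBounded_euclideanCone K) v
    (Real.rpow_pos_of_pos hs (Module.finrank ℚ K : ℝ)⁻¹)
  have hd : (Module.finrank ℚ K : ℝ) ≠ 0 := Nat.cast_ne_zero.2 Module.finrank_pos.ne'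
  rwa [euclidean.finrank, ← Real.rpow_natCast, Real.rpow_inv_rpow hs.le hd] at h

theorem tendsto_card_idealCoset (J : (Ideal (𝓞 K))⁰) (v : 𝓞 K) {q : ℕ} (hq : 0 < q)
    (hqv : (q : 𝓞 K) * v ∈ (J : Ideal (𝓞 K))) :
    Tendsto (fun s : ℝ => (Nat.card (cosetPoints (euclideanLattice K J) (euclideanCone K)
      (euclideanNorm K) (euclideanEmbed K v) s) : ℝ) / s) atTop
      (𝓝 (coneVolume K / ZLattice.covolume (euclideanLattice K J))) := by
  refine tendsto_card_cosetPoints_div (L := euclideanLattice K J)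
    (smul_mem_euclideanCone (K := K)) (euclideanNorm_smul (K := K))
    (isBounded_euclideanCone K) ?_ ?_ (euclideanEmbed K v) hq ?_
  · rw [setOf_euclideanCone_eq]
    exact (toMixed K).continuous.measurable (measurableSet_normLeOne K)
  · rw [setOf_euclideanCone_eq, ← (toMixed K).coe_toHomeomorph, ← Homeomorph.preimage_frontier,
      (toMixed K).coe_toHomeomorph, (volumePreserving_toMixed K).measure_preimage
      measurableSet_frontier.nullMeasurableSet, volume_frontier_normLeOne]
  · have h : (q : ℤ) • euclideanEmbed K v = euclideanEmbed K ((q : 𝓞 K) * v) - euclideanEmbed K 0 := by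
      rw [natCast_zsmul, ← nsmul_eq_mul]
      simp only [euclideanEmbed, map_nsmul, map_zero, sub_zero]
    rw [h, euclideanEmbed_sub_mem_iff]
    simpa using hqv

variable (K) in
/-- The covolume of the lattice of integers in the Euclidean mixed space. -/
def integerCovolume : ℝ :=
  (2⁻¹ : ℝ) ^ nrComplexPlaces K * Real.sqrt |(NumberField.discr K : ℝ)|

variable (K) in
theorem integerCovolume_pos : 0 < integerCovolume K := by
  have : (NumberField.discr K : ℝ) ≠ 0 := Int.cast_ne_zero.2 (discr_ne_zero K)
  unfold integerCovolume
  positivity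

theorem covolume_euclideanLattice (J : (Ideal (𝓞 K))⁰) :
    ZLattice.covolume (euclideanLattice K J) =
      (absNorm (J : Ideal (𝓞 K)) : ℝ) * integerCovolume K := by
  rw [euclideanLattice, ZLattice.covolume_comap _ _ _ (volumePreserving_toMixed K),
    covolume_idealLattice, FractionalIdeal.coe_mk0, FractionalIdeal.coeIdeal_absNorm,
    Rat.cast_natCast, integerCovolume]
  ring

/-- Integers congruent to a unit modulo `Q`, up to units, are the generators of ideals having a
generator congruent to `1`. -/
theorem exists_generator_iff (J Q : Ideal (𝓞 K)) (y : 𝓞 K) :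
    (∃ x, span {y} = span {x} ∧ x ∈ J ∧ x - 1 ∈ Q) ↔
      y ∈ J ∧ Ideal.Quotient.mk Q y ∈
        Set.range (fun u : (𝓞 K)ˣ => Ideal.Quotient.mk Q (u : 𝓞 K)) := by
  constructor
  · rintro ⟨x, hxy, hxJ, hxQ⟩
    obtain ⟨u, rfl⟩ := Ideal.span_singleton_eq_span_singleton.1 hxy
    refine ⟨(Ideal.mul_unit_mem_iff_mem J u.isUnit).1 hxJ, u⁻¹, ?_⟩
    rw [← Ideal.Quotient.eq, _root_.map_one, _root_.map_mul] at hxQ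
    have h1 : Ideal.Quotient.mk Q (u : 𝓞 K) * Ideal.Quotient.mk Q ((u⁻¹ : (𝓞 K)ˣ) : 𝓞 K) = 1 := by
      rw [← _root_.map_mul, Units.mul_inv, _root_.map_one]
    change Ideal.Quotient.mk Q ((u⁻¹ : (𝓞 K)ˣ) : 𝓞 K) = _
    rw [← mul_one (Ideal.Quotient.mk Q y), ← h1, ← mul_assoc, hxQ, one_mul]
  · rintro ⟨hy, u, hu⟩
    refine ⟨y * (u⁻¹ : (𝓞 K)ˣ), Ideal.span_singleton_eq_span_singleton.2 ⟨u⁻¹, rfl⟩,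
      Ideal.mul_mem_right _ _ hy, ?_⟩
    rw [← Ideal.Quotient.eq, _root_.map_one, _root_.map_mul, ← hu]
    change Ideal.Quotient.mk Q (u : 𝓞 K) * _ = 1
    rw [← _root_.map_mul, Units.mul_inv, _root_.map_one]

theorem sigma_subtype_ext {ι α : Type*} {T : ι → Set α} {a b : Σ i, T i} (h : a.1 = b.1)
    (h' : (a.2 : α) = b.2) : a = b := by
  obtain ⟨i, x, hx⟩ := a
  obtain ⟨j, y, hy⟩ := b
  obtain rfl : i = j := h
  obtain rfl : x = y := h'
  rfl

theorem card_integerSet_congruent (J Q : (Ideal (𝓞 K))⁰)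
    (v : (Set.range fun u : (𝓞 K)ˣ => Ideal.Quotient.mk (Q : Ideal (𝓞 K)) (u : 𝓞 K)) → 𝓞 K)
    (hvJ : ∀ c, v c ∈ (J : Ideal (𝓞 K))) (hvQ : ∀ c, Ideal.Quotient.mk (Q : Ideal (𝓞 K)) (v c) = c)
    (hJQ : (J : Ideal (𝓞 K)) ⊓ Q = J * Q) (s : ℝ) :
    Nat.card {a : integerSet K // (∃ x, span {(preimageOfMemIntegerSet a : 𝓞 K)} = span {x} ∧
      x ∈ (J : Ideal (𝓞 K)) ∧ x - 1 ∈ (Q : Ideal (𝓞 K))) ∧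
      mixedEmbedding.norm (a : mixedSpace K) ≤ s} =
    Nat.card (Σ c, cosetPoints (euclideanLattice K (J * Q)) (euclideanCone K)
      (euclideanNorm K) (euclideanEmbed K (v c)) s) := by
  have key : ∀ (x : 𝓞 K) (c), x - v c ∈ ((J * Q : (Ideal (𝓞 K))⁰) : Ideal (𝓞 K)) ↔
      x ∈ (J : Ideal (𝓞 K)) ∧ Ideal.Quotient.mk (Q : Ideal (𝓞 K)) x = c := by
    intro x c
    rw [Submonoid.coe_mul, ← hJQ, Submodule.mem_inf, ← hvQ c, Ideal.Quotient.eq,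
      (J : Ideal (𝓞 K)).sub_mem_iff_left (hvJ c)]
  have hpre : ∀ (a : integerSet K), euclideanEmbed K (preimageOfMemIntegerSet a : 𝓞 K) =
      (toMixed K).symm (a : mixedSpace K) := fun a => by simp [euclideanEmbed]
  have hex : ∀ (y : euclidean.mixedSpace K) c, y - euclideanEmbed K (v c) ∈
      euclideanLattice K (J * Q) → ∃ x, euclideanEmbed K x = y := by
    intro y c h
    obtain ⟨x, hx, hxy⟩ := (mem_euclideanLattice _ _).1 h
    refine ⟨x + v c, ?_⟩
    rw [← sub_add_cancel y (euclideanEmbed K (v c)), ← hxy]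
    simp [euclideanEmbed]
  refine Nat.card_congr (Equiv.ofBijective (fun a => ⟨⟨_, ((exists_generator_iff _ _ _).1 a.2.1).2⟩,
    (toMixed K).symm (a.1 : mixedSpace K), ?_, ?_, ?_⟩) ⟨?_, ?_⟩)
  · change toMixed K ((toMixed K).symm _) ∈ fundamentalCone K
    rw [ContinuousLinearEquiv.apply_symm_apply]
    exact a.1.2.1
  · rw [euclideanNorm, ContinuousLinearEquiv.apply_symm_apply]
    exact a.2.2
  · rw [← hpre, euclideanEmbed_sub_mem_iff, key]
    exact ⟨((exists_generator_iff _ _ _).1 a.2.1).1, rfl⟩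
  · intro a b hab
    have h3 : (toMixed K).symm (a.1 : mixedSpace K) = (toMixed K).symm (b.1 : mixedSpace K) :=
      congrArg (fun t => (t.2 : euclidean.mixedSpace K)) hab
    exact Subtype.ext (Subtype.ext ((toMixed K).symm.injective h3))
  · rintro ⟨c, y, hy1, hy2, hy3⟩
    obtain ⟨x, rfl⟩ := hex y c hy3
    have hx := (key x c).1 ((euclideanEmbed_sub_mem_iff _ _ _).1 hy3)
    have hmem : mixedEmbedding K x ∈ integerSet K := by
      refine mem_integerSet.2 ⟨?_, x, rfl⟩
      have : toMixed K (euclideanEmbed K x) ∈ fundamentalCone K := hy1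
      rwa [euclideanEmbed, ContinuousLinearEquiv.apply_symm_apply] at this
    have hpx := preimageOfMemIntegerSet_mixedEmbedding hmem
    refine ⟨⟨⟨mixedEmbedding K x, hmem⟩, ?_, ?_⟩, ?_⟩
    · rw [exists_generator_iff, hpx, hx.2]
      exact ⟨hx.1, c.2⟩
    · have : euclideanNorm K (euclideanEmbed K x) ≤ s := hy2
      rwa [euclideanNorm, euclideanEmbed, ContinuousLinearEquiv.apply_symm_apply] at this
    · exact sigma_subtype_ext (Subtype.ext (by simp only [hpx, hx.2])) rfl

theorem card_ray_mul (J Q : (Ideal (𝓞 K))⁰) (s : ℝ) :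
    Nat.card {I : (Ideal (𝓞 K))⁰ //
    (∃ x, (J * I : Ideal (𝓞 K)) = span {x} ∧ x - 1 ∈ (Q : Ideal (𝓞 K))) ∧
    (absNorm (I : Ideal (𝓞 K)) : ℝ) ≤ s} = Nat.card {I : (Ideal (𝓞 K))⁰ //
  IsPrincipal (I : Ideal (𝓞 K)) ∧ (∃ x, (I : Ideal (𝓞 K)) = span {x} ∧
  x ∈ (J : Ideal (𝓞 K)) ∧ x - 1 ∈ (Q : Ideal (𝓞 K))) ∧
  (absNorm (I : Ideal (𝓞 K)) : ℝ) ≤ s * absNorm (J : Ideal (𝓞 K))} := by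
  have hJ : (0 : ℝ) < absNorm (J : Ideal (𝓞 K)) :=
    Nat.cast_pos.2 (absNorm_pos_of_nonZeroDivisors J)
  refine Nat.card_congr (Equiv.ofBijective (fun I => ⟨J * I.1, ?_, ?_, ?_⟩) ⟨?_, ?_⟩)
  · obtain ⟨x, hx, -⟩ := I.2.1
    exact ⟨x, hx⟩
  · obtain ⟨x, hx, hx1⟩ := I.2.1
    have hx' : x ∈ span {x} := Ideal.mem_span_singleton_self x
    rw [← hx] at hx'
    have hle : (J * I.1 : Ideal (𝓞 K)) ≤ J := Ideal.mul_le_left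
    exact ⟨x, hx, hle hx', hx1⟩
  · rw [Submonoid.coe_mul, _root_.map_mul, Nat.cast_mul, mul_comm]
    exact mul_le_mul_of_nonneg_right I.2.2 hJ.le
  · intro I I' h
    have h' : (J : Ideal (𝓞 K)) * I.1 = J * I'.1 := Subtype.ext_iff.1 (Subtype.ext_iff.1 h)
    exact Subtype.ext (Subtype.ext (mul_left_cancel₀ (nonZeroDivisors.coe_ne_zero J) h'))
  · rintro ⟨I, -, ⟨x, hx, hxJ, hxQ⟩, hs⟩
    have hdvd : (J : Ideal (𝓞 K)) ∣ I := by
      rw [Ideal.dvd_iff_le, hx, Ideal.span_singleton_le_iff_mem]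
      exact hxJ
    obtain ⟨I', hI'⟩ := hdvd
    have hI0 : I' ≠ 0 := by
      rintro rfl
      exact nonZeroDivisors.coe_ne_zero I (by rw [hI', mul_zero])
    refine ⟨⟨⟨I', mem_nonZeroDivisors_of_ne_zero hI0⟩, ⟨x, by rw [← hx, hI'], hxQ⟩, ?_⟩, ?_⟩
    · rw [hI', _root_.map_mul, Nat.cast_mul, mul_comm] at hs
      exact le_of_mul_le_mul_right hs hJ
    · exact Subtype.ext (Subtype.ext hI'.symm)

/-- Ideals in a coset of the ray modulo `Q` are equidistributed. -/
theorem exists_tendsto_card_ray (Q : (Ideal (𝓞 K))⁰) : ∃ δ : ℝ, 0 < δ ∧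
    ∀ J : (Ideal (𝓞 K))⁰, IsCoprime (J : Ideal (𝓞 K)) Q →
      Tendsto (fun s : ℝ => (Nat.card {I : (Ideal (𝓞 K))⁰ //
        (∃ x, (J * I : Ideal (𝓞 K)) = span {x} ∧ x - 1 ∈ (Q : Ideal (𝓞 K))) ∧
        (absNorm (I : Ideal (𝓞 K)) : ℝ) ≤ s} : ℝ) / s) atTop (𝓝 δ) := by
  set H := Set.range fun u : (𝓞 K)ˣ => Ideal.Quotient.mk (Q : Ideal (𝓞 K)) (u : 𝓞 K) with hH
  have : Finite (𝓞 K ⧸ (Q : Ideal (𝓞 K))) :=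
    Ideal.finiteQuotientOfFreeOfNeBot _ (nonZeroDivisors.coe_ne_zero Q)
  have : Fintype H := Fintype.ofFinite H
  have hHpos : (0 : ℝ) < Fintype.card H := by
    have : Nonempty H := ⟨⟨_, 1, rfl⟩⟩
    exact Nat.cast_pos.2 Fintype.card_pos
  have hN : ∀ J : (Ideal (𝓞 K))⁰, (0 : ℝ) < absNorm (J : Ideal (𝓞 K)) := fun J =>
    Nat.cast_pos.2 (absNorm_pos_of_nonZeroDivisors J)
  have hw : (0 : ℝ) < torsionOrder K := Nat.cast_pos.2 (torsionOrder_pos K)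
  refine ⟨Fintype.card H * (coneVolume K / (absNorm (Q : Ideal (𝓞 K)) * integerCovolume K)) /
    torsionOrder K, ?_, fun J hJQ => ?_⟩
  · have := coneVolume_pos K
    have := integerCovolume_pos K
    have := hN Q
    positivity
  have hv : ∀ c : H, ∃ v ∈ (J : Ideal (𝓞 K)), Ideal.Quotient.mk (Q : Ideal (𝓞 K)) v = c := by
    rintro ⟨_, u, rfl⟩
    obtain ⟨a, ha, b, hb, hab⟩ := (Ideal.isCoprime_iff_exists).1 hJQ
    refine ⟨a * u, Ideal.mul_mem_right _ _ ha, ?_⟩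
    refine Ideal.Quotient.eq.2 ?_
    rw [show a * (u : 𝓞 K) - u = -(b * u) by linear_combination (u : 𝓞 K) * hab]
    exact neg_mem (Ideal.mul_mem_right _ _ hb)
  choose v hvJ hvQ using hv
  have hinf : (J : Ideal (𝓞 K)) ⊓ Q = J * Q := (Ideal.mul_eq_inf_of_isCoprime hJQ).symm
  have hlim : Tendsto (fun s : ℝ => (Nat.card {I : (Ideal (𝓞 K))⁰ //
      IsPrincipal (I : Ideal (𝓞 K)) ∧ (∃ x, (I : Ideal (𝓞 K)) = span {x} ∧
      x ∈ (J : Ideal (𝓞 K)) ∧ x - 1 ∈ (Q : Ideal (𝓞 K))) ∧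
      (absNorm (I : Ideal (𝓞 K)) : ℝ) ≤ s} : ℝ) / s) atTop
      (𝓝 (Fintype.card H * (coneVolume K / ZLattice.covolume (euclideanLattice K (J * Q))) /
        torsionOrder K)) := by
    have hq : 0 < absNorm (Q : Ideal (𝓞 K)) := absNorm_pos_of_nonZeroDivisors Q
    have h := (tendsto_finsetSum Finset.univ (fun c (_ : c ∈ Finset.univ) =>
      tendsto_card_idealCoset (J * Q) (v c) hq (by
        rw [Submonoid.coe_mul, mul_comm _ (v c)]
        exact Ideal.mul_mem_mul (hvJ c) (Ideal.absNorm_mem _)))).div_const (torsionOrder K : ℝ)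
    rw [Finset.sum_const, Finset.card_univ, nsmul_eq_mul] at h
    refine h.congr' ?_
    filter_upwards [eventually_gt_atTop 0] with s hs
    have h1 := card_isPrincipal_norm_le_mul_torsion K (fun I => ∃ x, I = span {x} ∧
      x ∈ (J : Ideal (𝓞 K)) ∧ x - 1 ∈ (Q : Ideal (𝓞 K))) s
    have hfin : ∀ c, Finite (cosetPoints (euclideanLattice K (J * Q)) (euclideanCone K)
      (euclideanNorm K) (euclideanEmbed K (v c)) s) := fun c => finite_idealCoset _ _ hs
    rw [card_integerSet_congruent J Q v hvJ hvQ hinf s, Nat.card_sigma] at h1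
    have h2 := congrArg (Nat.cast (R := ℝ)) h1
    push_cast at h2
    rw [← Finset.sum_div, ← h2]
    field_simp
  have hJ := hN J
  have h := (hlim.mul_const (absNorm (J : Ideal (𝓞 K)) : ℝ)).comp
    (tendsto_id.atTop_mul_const hJ)
  rw [covolume_euclideanLattice, Submonoid.coe_mul, _root_.map_mul, Nat.cast_mul] at h
  convert! h using 2 with s
  · rw [card_ray_mul J Q s]
    simp only [Function.comp, id]
    field_simp
  · have := (hN Q).ne'
    have := (integerCovolume_pos K).ne'
    field_simp

end RayCount

section OrdAt
open IsDedekindDomain WithZero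
open scoped nonZeroDivisors

variable {R : Type*} [CommRing R] [IsDedekindDomain R] {K : Type*} [Field K] [Algebra R K]
  [IsFractionRing R K]

/-- The order of `x` at the prime `p`, with the convention that `0` has order `0`. -/
def ordAt (p : HeightOneSpectrum R) (x : K) : ℤ := -log (p.valuation K x)

variable (p : HeightOneSpectrum R)

theorem le_ordAt_iff {x : K} (hx : x ≠ 0) (n : ℤ) :
    n ≤ ordAt p x ↔ p.valuation K x ≤ exp (-n) := by
  rw [ordAt, ← log_le_iff_le_exp ((Valuation.ne_zero_iff _).2 hx)]
  omega

theorem valuation_eq_exp_ordAt {x : K} (hx : x ≠ 0) :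
    p.valuation K x = exp (-ordAt p x) := by
  rw [ordAt, neg_neg, exp_log ((Valuation.ne_zero_iff _).2 hx)]

theorem ordAt_nonneg_iff {x : K} (hx : x ≠ 0) : 0 ≤ ordAt p x ↔ p.valuation K x ≤ 1 := by
  simpa using le_ordAt_iff p hx 0

theorem ordAt_mul {x y : K} (hx : x ≠ 0) (hy : y ≠ 0) :
    ordAt p (x * y) = ordAt p x + ordAt p y := by
  rw [ordAt, map_mul, log_mul ((Valuation.ne_zero_iff _).2 hx) ((Valuation.ne_zero_iff _).2 hy)]
  simp only [ordAt]; ring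

theorem ordAt_one : ordAt p (1 : K) = 0 := by simp [ordAt]

theorem ordAt_inv (x : K) : ordAt p x⁻¹ = - ordAt p x := by
  simp [ordAt, log_inv]

theorem ordAt_pow (x : K) (n : ℕ) : ordAt p (x ^ n) = n * ordAt p x := by
  simp [ordAt, log_pow]

theorem ordAt_neg (x : K) : ordAt p (-x) = ordAt p x := by
  simp [ordAt, Valuation.map_neg]

theorem ordAt_div {x y : K} (hx : x ≠ 0) (hy : y ≠ 0) :
    ordAt p (x / y) = ordAt p x - ordAt p y := by
  rw [div_eq_mul_inv, ordAt_mul p hx (inv_ne_zero hy), ordAt_inv]; ring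

theorem ordAt_prod {ι : Type*} (s : Finset ι) (f : ι → K) (hf : ∀ i ∈ s, f i ≠ 0) :
    ordAt p (∏ i ∈ s, f i) = ∑ i ∈ s, ordAt p (f i) := by
  classical
  induction s using Finset.induction_on with
  | empty => simp [ordAt_one]
  | insert a s ha ih =>
    rw [Finset.prod_insert ha, Finset.sum_insert ha, ordAt_mul p (hf a (by simp))
      (Finset.prod_ne_zero_iff.2 fun i hi => hf i (by simp [hi])),
      ih fun i hi => hf i (by simp [hi])]

/-- An ideal is contained in `p ^ n` exactly when its multiplicity is at least `n`. -/
theorem le_multiplicity_iff {I : Ideal R} (hI : I ≠ ⊥) (n : ℕ) :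
    n ≤ multiplicity p.asIdeal I ↔ I ≤ p.asIdeal ^ n := by
  rw [← Ideal.dvd_iff_le,
    (FiniteMultiplicity.of_prime_left p.prime hI).pow_dvd_iff_le_multiplicity]

theorem ordAt_algebraMap {x : R} (hx : x ≠ 0) :
    ordAt p (algebraMap R K x) = multiplicity p.asIdeal (Ideal.span {x}) := by
  rw [ordAt, HeightOneSpectrum.valuation_of_algebraMap,
    HeightOneSpectrum.intValuation_eq_exp_neg_multiplicity _ hx]
  simp

theorem le_ordAt_algebraMap_iff {x : R} (hx : x ≠ 0) (n : ℕ) :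
    (n : ℤ) ≤ ordAt p (algebraMap R K x) ↔ x ∈ p.asIdeal ^ n := by
  rw [ordAt_algebraMap p hx, Nat.cast_le, le_multiplicity_iff _ (by simpa using hx),
    Ideal.span_singleton_le_iff_mem]

/-- The multiplicity of the ideal spanned by a set is the least order of its elements. -/
theorem isLeast_ordAt_span (s : Set R) (hs : Ideal.span s ≠ ⊥) :
    IsLeast {n : ℤ | ∃ x ∈ s, x ≠ 0 ∧ ordAt p (algebraMap R K x) = n}
      (multiplicity p.asIdeal (Ideal.span s)) := by
  have key : ∀ n : ℕ, n ≤ multiplicity p.asIdeal (Ideal.span s) ↔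
      ∀ x ∈ s, x ≠ 0 → (n : ℤ) ≤ ordAt p (algebraMap R K x) := by
    intro n
    rw [le_multiplicity_iff p hs, Ideal.span_le]
    constructor
    · intro h x hx h0
      rw [le_ordAt_algebraMap_iff p h0]; exact h hx
    · intro h x hx
      by_cases h0 : x = 0
      · rw [h0]; exact Ideal.zero_mem _
      · exact (le_ordAt_algebraMap_iff p h0 n).1 (h x hx h0)
  refine ⟨?_, ?_⟩
  · by_contra hcon
    have := (key (multiplicity p.asIdeal (Ideal.span s) + 1)).2 fun x hx h0 => by
      have h1 := (key _).1 le_rfl x hx h0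
      rcases h1.lt_or_eq with h | h
      · push_cast; omega
      · exact absurd ⟨x, hx, h0, h.symm⟩ hcon
    omega
  · rintro n ⟨x, hx, h0, rfl⟩
    exact (key _).1 le_rfl x hx h0

theorem idealMult_mul {I J : Ideal R} (hI : I ≠ ⊥) (hJ : J ≠ ⊥) :
    multiplicity p.asIdeal (I * J) = multiplicity p.asIdeal I + multiplicity p.asIdeal J :=
  _root_.multiplicity_mul p.prime (FiniteMultiplicity.of_prime_left p.prime (mul_ne_zero hI hJ))

theorem idealMult_pow {I : Ideal R} (hI : I ≠ ⊥) (n : ℕ) :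
    multiplicity p.asIdeal (I ^ n) = n * multiplicity p.asIdeal I :=
  (FiniteMultiplicity.of_prime_left p.prime hI).multiplicity_pow p.prime

open Classical in
theorem idealMult_prime (q : HeightOneSpectrum R) :
    multiplicity p.asIdeal q.asIdeal = if q = p then 1 else 0 := by
  split_ifs with h
  · subst h
    simp
  · rw [multiplicity_eq_zero]
    intro hd
    rw [Ideal.dvd_iff_le] at hd
    exact h (HeightOneSpectrum.ext (q.isMaximal.eq_of_le p.isPrime.ne_top hd))

/-- The ideal with prescribed exponents. -/
def divIdeal (n : HeightOneSpectrum R →₀ ℕ) : Ideal R := n.prod fun q e => q.asIdeal ^ e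

theorem divIdeal_ne_bot (n : HeightOneSpectrum R →₀ ℕ) : divIdeal n ≠ ⊥ := by
  rw [divIdeal, Finsupp.prod]
  exact Finset.prod_ne_zero_iff.2 fun q _ => pow_ne_zero _ q.ne_bot

theorem divIdeal_add (m n : HeightOneSpectrum R →₀ ℕ) :
    divIdeal (m + n) = divIdeal m * divIdeal n :=
  Finsupp.prod_add_index' (fun _ => pow_zero _) fun _ _ _ => pow_add _ _ _

theorem divIdeal_single (q : HeightOneSpectrum R) (e : ℕ) :
    divIdeal (Finsupp.single q e) = q.asIdeal ^ e :=
  Finsupp.prod_single_index (pow_zero _)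

theorem multiplicity_divIdeal (n : HeightOneSpectrum R →₀ ℕ) :
    multiplicity p.asIdeal (divIdeal n) = n p := by
  classical
  induction n using Finsupp.induction_linear with
  | zero => simp [divIdeal, multiplicity_eq_zero, Ideal.dvd_iff_le, p.isPrime.ne_top]
  | add f g hf hg =>
    rw [divIdeal_add, idealMult_mul _ (divIdeal_ne_bot _) (divIdeal_ne_bot _), hf, hg]; rfl
  | single q e =>
    rw [divIdeal_single, idealMult_pow _ q.ne_bot, idealMult_prime, Finsupp.single_apply]
    split_ifs <;> simp

/-- The exponents in the factorization of a nonzero ideal. -/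
def idealDiv (I : (Ideal R)⁰) : HeightOneSpectrum R →₀ ℕ :=
  Finsupp.ofSupportFinite (fun p => multiplicity p.asIdeal (I : Ideal R)) (by
    refine (Ideal.finite_factors (nonZeroDivisors.coe_ne_zero I)).subset ?_
    intro p hp
    rw [Function.mem_support, Ne, multiplicity_eq_zero, not_not] at hp
    exact hp)

theorem idealDiv_apply (I : (Ideal R)⁰) : idealDiv I p = multiplicity p.asIdeal (I : Ideal R) := rfl

theorem divIdeal_idealDiv (I : (Ideal R)⁰) : divIdeal (idealDiv I) = I := by
  conv_rhs => rw [← Ideal.finprod_heightOneSpectrum_pow_multiplicity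
    (nonZeroDivisors.coe_ne_zero I)]
  rw [divIdeal, Finsupp.prod, finprod_eq_prod_of_mulSupport_subset]
  · rfl
  · intro q hq
    rw [Function.mem_mulSupport] at hq
    simp only [Finset.mem_coe, Finsupp.mem_support_iff, idealDiv_apply]
    intro h
    rw [h, pow_zero] at hq
    exact hq rfl

theorem ideal_eq_of_multiplicity {I J : Ideal R} (hI : I ≠ ⊥) (hJ : J ≠ ⊥)
    (h : ∀ p : HeightOneSpectrum R, multiplicity p.asIdeal I = multiplicity p.asIdeal J) :
    I = J := by
  have h1 := divIdeal_idealDiv ⟨I, mem_nonZeroDivisors_of_ne_zero hI⟩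
  have h2 := divIdeal_idealDiv ⟨J, mem_nonZeroDivisors_of_ne_zero hJ⟩
  rw [← show (_ : Ideal R) = I from h1, ← show (_ : Ideal R) = J from h2]
  congr 1
  ext p
  exact h p

/-- The class of a divisor. -/
def divClass : (HeightOneSpectrum R →₀ ℤ) →+ Additive (ClassGroup R) :=
  Finsupp.liftAddHom fun q => zmultiplesHom _
    (Additive.ofMul (ClassGroup.mk0 ⟨q.asIdeal, mem_nonZeroDivisors_of_ne_zero q.ne_bot⟩))

/-- A nonnegative divisor, viewed as a divisor. -/
def natDiv {P : Type*} : (P →₀ ℕ) →+ (P →₀ ℤ) :=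
  Finsupp.mapRange.addMonoidHom (Nat.castAddMonoidHom ℤ)

@[simp] theorem natDiv_apply {P : Type*} (n : P →₀ ℕ) (q : P) : natDiv n q = n q := by
  simp [natDiv]

@[simp] theorem natDiv_single {P : Type*} (q : P) (e : ℕ) :
    natDiv (Finsupp.single q e) = Finsupp.single q (e : ℤ) := by
  simp [natDiv]

theorem divClass_natDiv (n : HeightOneSpectrum R →₀ ℕ) :
    divClass (natDiv n) = Additive.ofMul (ClassGroup.mk0
      ⟨divIdeal n, mem_nonZeroDivisors_of_ne_zero (divIdeal_ne_bot n)⟩) := by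
  induction n using Finsupp.induction_linear with
  | zero =>
    rw [map_zero, map_zero]
    symm
    rw [ofMul_eq_zero, ClassGroup.mk0_eq_one_iff]
    simp [divIdeal, top_isPrincipal, Ideal.one_eq_top]
  | add f g hf hg =>
    rw [map_add, map_add, hf, hg, ← ofMul_mul, ← map_mul]
    congr 2
    ext1
    exact (divIdeal_add f g).symm
  | single q e =>
    rw [natDiv_single, divClass, Finsupp.liftAddHom_apply_single]
    simp only [zmultiplesHom_apply, natCast_zsmul]
    rw [← ofMul_pow, ← map_pow]
    congr 2
    ext1
    exact (divIdeal_single q e).symm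

theorem divClass_idealDiv (I : (Ideal R)⁰) :
    divClass (natDiv (idealDiv I)) = Additive.ofMul (ClassGroup.mk0 I) := by
  rw [divClass_natDiv]
  congr 2
  ext1
  exact divIdeal_idealDiv I

theorem finite_support_ordAt (x : Kˣ) :
    (Function.support fun p : HeightOneSpectrum R => ordAt p (x : K)).Finite := by
  obtain ⟨a, b, hb, hx⟩ := IsFractionRing.div_surjective (A := R) (x : K)
  have hb0 : b ≠ 0 := nonZeroDivisors.ne_zero hb
  have ha0 : a ≠ 0 := by
    rintro rfl
    exact x.ne_zero (by rw [← hx]; simp)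
  have hA : algebraMap R K a ≠ 0 := by simpa using ha0
  have hB : algebraMap R K b ≠ 0 := by simpa using hb0
  refine ((Ideal.finite_factors (I := Ideal.span {a}) (by simpa using ha0)).union
    (Ideal.finite_factors (I := Ideal.span {b}) (by simpa using hb0))).subset ?_
  intro p hp
  by_contra hcon
  rw [Set.mem_union, not_or] at hcon
  refine hp ?_
  simp only
  rw [← hx, ordAt_div p hA hB, ordAt_algebraMap p ha0, ordAt_algebraMap p hb0,
    multiplicity_eq_zero.2 hcon.1, multiplicity_eq_zero.2 hcon.2]
  simp

/-- The divisor of a nonzero element of the fraction field. -/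
def prinDiv (x : Kˣ) : HeightOneSpectrum R →₀ ℤ :=
  Finsupp.ofSupportFinite (fun p => ordAt p (x : K)) (finite_support_ordAt x)

@[simp] theorem prinDiv_apply (x : Kˣ) : prinDiv x p = ordAt p (x : K) := rfl

theorem prinDiv_mul (x y : Kˣ) :
    (prinDiv (x * y) : HeightOneSpectrum R →₀ ℤ) = prinDiv x + prinDiv y := by
  ext p
  simp [ordAt_mul p x.ne_zero y.ne_zero]

theorem prinDiv_inv (x : Kˣ) :
    (prinDiv x⁻¹ : HeightOneSpectrum R →₀ ℤ) = -prinDiv x := by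
  ext p
  simp [ordAt_inv]

theorem prinDiv_pow (x : Kˣ) (n : ℕ) :
    (prinDiv (x ^ n) : HeightOneSpectrum R →₀ ℤ) = n • prinDiv x := by
  ext p
  simp [ordAt_pow]

theorem divClass_prinDiv (x : Kˣ) :
    divClass (prinDiv x : HeightOneSpectrum R →₀ ℤ) = 0 := by
  have key : ∀ (a : R) (ha : a ≠ 0) (y : Kˣ), (y : K) = algebraMap R K a →
      divClass (prinDiv y : HeightOneSpectrum R →₀ ℤ) = 0 := by
    intro a ha y hy
    have hne : (Ideal.span {a} : Ideal R) ≠ 0 := by simpa using ha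
    have : (prinDiv y : HeightOneSpectrum R →₀ ℤ) =
        natDiv (idealDiv ⟨Ideal.span {a}, mem_nonZeroDivisors_of_ne_zero hne⟩) := by
      ext p
      rw [natDiv_apply, idealDiv_apply, prinDiv_apply, hy, ordAt_algebraMap p ha]
    rw [this, divClass_idealDiv, ofMul_eq_zero, ClassGroup.mk0_eq_one_iff]
    exact ⟨a, rfl⟩
  obtain ⟨a, b, hb, hx⟩ := IsFractionRing.div_surjective (A := R) (x : K)
  have hb0 : b ≠ 0 := nonZeroDivisors.ne_zero hb
  have ha0 : a ≠ 0 := by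
    rintro rfl
    exact x.ne_zero (by rw [← hx]; simp)
  have hA : algebraMap R K a ≠ 0 := by simpa using ha0
  have hB : algebraMap R K b ≠ 0 := by simpa using hb0
  have hxx : x = Units.mk0 _ hA * (Units.mk0 _ hB)⁻¹ := by
    ext
    simp [← hx, div_eq_mul_inv]
  rw [hxx, prinDiv_mul, prinDiv_inv, map_add, map_neg, key a ha0 _ rfl, key b hb0 _ rfl]
  simp

theorem exists_natDiv_sub {P : Type*} (n : P →₀ ℤ) : ∃ a b : P →₀ ℕ, n = natDiv a - natDiv b := by
  refine ⟨n.mapRange Int.toNat rfl, (-n).mapRange Int.toNat rfl, ?_⟩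
  ext q
  simp only [Finsupp.coe_sub, Pi.sub_apply, natDiv_apply, Finsupp.mapRange_apply,
    Finsupp.neg_apply]
  omega

theorem ideal_mul_span_multiplicity {I : Ideal R} (hI : I ≠ ⊥) {x : R} (hx : x ≠ 0) :
    (multiplicity p.asIdeal (Ideal.span {x} * I) : ℤ) =
      ordAt p (algebraMap R K x) + multiplicity p.asIdeal I := by
  rw [idealMult_mul _ (by simpa using hx) hI, ordAt_algebraMap p hx]
  push_cast; rfl

variable (K) in
theorem exists_prinDiv_eq {n : HeightOneSpectrum R →₀ ℤ} (hn : divClass n = 0) :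
    ∃ x : Kˣ, prinDiv x = n := by
  obtain ⟨a, b, rfl⟩ := exists_natDiv_sub n
  rw [map_sub, sub_eq_zero, divClass_natDiv, divClass_natDiv] at hn
  have h := Additive.ofMul.injective hn
  rw [ClassGroup.mk0_eq_mk0_iff] at h
  obtain ⟨x, y, hx, hy, hxy⟩ := h
  have hX : algebraMap R K x ≠ 0 := by simpa using hx
  have hY : algebraMap R K y ≠ 0 := by simpa using hy
  refine ⟨Units.mk0 _ hY * (Units.mk0 _ hX)⁻¹, ?_⟩
  rw [prinDiv_mul, prinDiv_inv]
  ext p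
  have h1 := ideal_mul_span_multiplicity (K := K) p (divIdeal_ne_bot a) hx
  have h2 := ideal_mul_span_multiplicity (K := K) p (divIdeal_ne_bot b) hy
  simp only at hxy
  rw [hxy, h2, multiplicity_divIdeal, multiplicity_divIdeal] at h1
  simp only [Finsupp.coe_add, Finsupp.coe_neg, Pi.add_apply, Pi.neg_apply, prinDiv_apply,
    Units.val_mk0, Finsupp.coe_sub, Pi.sub_apply, natDiv_apply]
  omega

end OrdAt

section Steinitz
open scoped nonZeroDivisors

variable {R : Type*} [CommRing R] [IsDedekindDomain R]

theorem projective_of_finite_torsionFree (M : Type*) [AddCommGroup M] [Module R M]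
    [Module.Finite R M] [Module.IsTorsionFree R M] : Module.Projective R M := by
  have : Module.FinitePresentation R M :=
    Module.finitePresentation_of_finite R M
  exact Module.Flat.projective_of_finitePresentation

theorem nonempty_equiv_ker_prod {M N : Type*} [AddCommGroup M] [Module R M] [AddCommGroup N]
    [Module R N] [Module.Projective R N] (f : M →ₗ[R] N) (hf : Function.Surjective f) :
    Nonempty (M ≃ₗ[R] (LinearMap.ker f × N)) := by
  obtain ⟨s, hs⟩ := Module.projective_lifting_property f LinearMap.id hf
  exact ⟨(lequivProdOfRightSplitExact (j := (LinearMap.ker f).subtype) (g := f) (f := s)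
    (Submodule.injective_subtype _) (by simp) hs).symm⟩

theorem exists_quotient_linearMap {I : Ideal R} {a b : R} (ha : a ≠ 0)
    (h : ∀ j ∈ I, a ∣ b * j) : ∃ ψ : I →ₗ[R] R, ∀ j : I, a * ψ j = b * j := by
  choose f hf using fun j : I => h j j.2
  refine ⟨{ toFun := f, map_add' := fun x y => ?_, map_smul' := fun r x => ?_ },
    fun j => (hf j).symm⟩
  · apply mul_left_cancel₀ ha
    rw [← hf, mul_add, ← hf, ← hf]
    push_cast
    ring
  · apply mul_left_cancel₀ ha
    rw [← hf, smul_eq_mul, RingHom.id_apply, mul_left_comm, ← hf]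
    push_cast
    rw [smul_eq_mul]
    ring

/-- A direct sum of two nonzero ideals is the sum of a free module of rank one and an ideal. -/
theorem exists_prod_ideal_equiv (I J : Ideal R) (hI : I ≠ ⊥) (hJ : J ≠ ⊥) :
    ∃ I' : Ideal R, I' ≠ ⊥ ∧ Nonempty ((I × J) ≃ₗ[R] (I' × R)) := by
  obtain ⟨a, haJ, ha0⟩ := Submodule.exists_mem_ne_zero_of_ne_bot hJ
  obtain ⟨Js, hJs⟩ : J ∣ Ideal.span {a} := by
    rwa [Ideal.dvd_span_singleton]
  have hJs0 : Js ≠ ⊥ := by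
    rintro rfl
    rw [Ideal.mul_bot] at hJs
    exact ha0 (by simpa using hJs)
  obtain ⟨b, hb⟩ := IsDedekindDomain.exists_sup_span_eq (I := I * Js) (J := Js)
    Ideal.mul_le_right (mul_ne_zero hI hJs0)
  have hbJs : b ∈ Js := by
    rw [← hb]; exact Ideal.mem_sup_right (Ideal.mem_span_singleton_self b)
  have hdiv : ∀ j ∈ J, a ∣ b * j := by
    intro j hj
    rw [← Ideal.mem_span_singleton, hJs, mul_comm b j]
    exact Ideal.mul_mem_mul hj hbJs
  obtain ⟨ψ, hψ⟩ := exists_quotient_linearMap ha0 hdiv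
  let φ : (I × J) →ₗ[R] R := I.subtype.coprod ψ
  have hφ : Function.Surjective φ := by
    rw [← LinearMap.range_eq_top]
    have h1 : (1 : R) ∈ LinearMap.range φ := by
      have hmem : a ∈ Ideal.span {a} * I ⊔ Ideal.span {b} * J := by
        have : Ideal.span {a} = Ideal.span {a} * I ⊔ Ideal.span {b} * J := by
          conv_lhs => rw [hJs, ← hb, Ideal.mul_sup, mul_comm I Js, ← mul_assoc, ← hJs]
          rw [mul_comm J]
        rw [← this]; exact Ideal.mem_span_singleton_self a
      obtain ⟨x, hx, y, hy, hxy⟩ := Submodule.mem_sup.1 hmem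
      obtain ⟨i, hi, rfl⟩ := Ideal.mem_span_singleton_mul.1 hx
      obtain ⟨j, hj, rfl⟩ := Ideal.mem_span_singleton_mul.1 hy
      refine ⟨(⟨i, hi⟩, ⟨j, hj⟩), ?_⟩
      apply mul_left_cancel₀ ha0
      simp only [φ, LinearMap.coprod_apply, Submodule.subtype_apply, mul_add, hψ, mul_one]
      exact hxy
    exact (Ideal.eq_top_iff_one (LinearMap.range φ)).2 h1
  obtain ⟨e⟩ := nonempty_equiv_ker_prod φ hφ
  let pr : LinearMap.ker φ →ₗ[R] R := J.subtype ∘ₗ LinearMap.snd R I J ∘ₗ (LinearMap.ker φ).subtype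
  have hpr : Function.Injective pr := by
    rw [← LinearMap.ker_eq_bot, LinearMap.ker_eq_bot']
    rintro ⟨⟨i, j⟩, hij⟩ h0
    have hj : j = 0 := by
      apply Subtype.ext
      simpa [pr] using h0
    subst hj
    have hi : i = 0 := by
      apply Subtype.ext
      simpa [φ] using hij
    subst hi
    rfl
  refine ⟨LinearMap.range pr, ?_, ⟨e.trans
    (LinearEquiv.prodCongr (LinearEquiv.ofInjective pr hpr) (LinearEquiv.refl R R))⟩⟩
  obtain ⟨i, hi, hi0⟩ := Submodule.exists_mem_ne_zero_of_ne_bot hI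
  intro hbot
  have hmem : a * i * a ∈ LinearMap.range pr := by
    refine ⟨⟨(⟨-(b * i * a), ?_⟩, ⟨a * i * a, J.mul_mem_left _ haJ⟩), ?_⟩, ?_⟩
    · exact I.neg_mem (by rw [mul_assoc, mul_left_comm]; exact I.mul_mem_right _ hi)
    · rw [LinearMap.mem_ker]
      apply mul_left_cancel₀ ha0
      simp only [φ, LinearMap.coprod_apply, Submodule.subtype_apply, mul_add, hψ, mul_zero]
      ring
    · rfl
  rw [hbot] at hmem
  have := (Submodule.mem_bot R).1 hmem
  simp [ha0, hi0] at this

/-- A submodule of a free module of finite rank over a Dedekind domain is zero or the sum of a free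
module and a nonzero ideal. -/
theorem exists_equiv_free_prod_ideal (n : ℕ) : ∀ (M : Type _) [AddCommGroup M] [Module R M]
    (f : M →ₗ[R] (Fin n → R)), Function.Injective f → Subsingleton M ∨
      ∃ (k : ℕ) (I : Ideal R), I ≠ ⊥ ∧ Nonempty (M ≃ₗ[R] ((Fin k → R) × I)) := by
  induction n with
  | zero =>
    intro M _ _ f hf
    exact Or.inl hf.subsingleton
  | succ n ih =>
    intro M _ _ f hf
    let g : M →ₗ[R] R := LinearMap.proj (Fin.last n) ∘ₗ f
    let h : LinearMap.ker g →ₗ[R] (Fin n → R) :=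
      LinearMap.pi (fun i => LinearMap.proj i.castSucc) ∘ₗ f ∘ₗ (LinearMap.ker g).subtype
    have hh : Function.Injective h := by
      rw [← LinearMap.ker_eq_bot, LinearMap.ker_eq_bot']
      rintro ⟨x, hx⟩ h0
      have : f x = 0 := by
        ext i
        induction i using Fin.lastCases with
        | last => exact hx
        | cast i => exact congrFun h0 i
      apply Subtype.ext
      exact hf (by rw [this]; simp)
    have : Module.Projective R (LinearMap.range g) := projective_of_finite_torsionFree _
    obtain ⟨e⟩ := nonempty_equiv_ker_prod g.rangeRestrict g.surjective_rangeRestrict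
    rw [LinearMap.ker_rangeRestrict] at e
    by_cases hJ : LinearMap.range g = ⊥
    · have hg : LinearMap.ker g = ⊤ := by rw [LinearMap.ker_eq_top, ← LinearMap.range_eq_bot, hJ]
      let e' : M ≃ₗ[R] LinearMap.ker g := (LinearEquiv.ofTop _ hg).symm
      rcases ih (LinearMap.ker g) h hh with h1 | ⟨k, I, hI, ⟨e2⟩⟩
      · exact Or.inl e'.toEquiv.subsingleton
      · exact Or.inr ⟨k, I, hI, ⟨e'.trans e2⟩⟩
    · right
      rcases ih (LinearMap.ker g) h hh with h1 | ⟨k, I, hI, ⟨e2⟩⟩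
      · refine ⟨0, LinearMap.range g, hJ, ⟨e.trans (LinearEquiv.prodCongr ?_ (LinearEquiv.refl _ _))⟩⟩
        exact LinearEquiv.ofSubsingleton _ _
      · obtain ⟨I', hI', ⟨e3⟩⟩ := exists_prod_ideal_equiv I (LinearMap.range g) hI hJ
        refine ⟨k + 1, I', hI', ⟨e.trans ((LinearEquiv.prodCongr e2 (LinearEquiv.refl _ _)).trans
          ((LinearEquiv.prodAssoc R _ _ _).trans ((LinearEquiv.prodCongr (LinearEquiv.refl _ _)
          (e3.trans (LinearEquiv.prodComm R _ _))).trans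
          ((LinearEquiv.prodAssoc R _ _ _).symm.trans
          (LinearEquiv.prodCongr ?_ (LinearEquiv.refl _ _))))))⟩⟩
        exact (LinearEquiv.prodComm R _ _).trans (Fin.consLinearEquiv R fun _ => R)

end Steinitz

section DetLattice
open IsDedekindDomain NumberField
open scoped nonZeroDivisors

variable {K L : Type*} [Field K] [NumberField K] [Field L] [NumberField L] [Algebra K L]

/-- The orders at `p` of the nonzero determinants, with respect to the basis `b`, of tuples of
algebraic integers. -/
def detOrders {n : ℕ} (p : HeightOneSpectrum (𝓞 K)) (b : Module.Basis (Fin n) K L) : Set ℤ :=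
  {m | ∃ x : Fin n → L, (∀ i, IsIntegral ℤ (x i)) ∧ b.det x ≠ 0 ∧ ordAt p (b.det x) = m}

theorem exists_basis_of_equiv {k : ℕ} {I : Ideal (𝓞 K)}
    (φ : (𝓞 L) ≃ₗ[𝓞 K] ((Fin k → 𝓞 K) × I)) (a : I) (ha : a ≠ 0) :
    ∃ B : Module.Basis (Fin (k + 1)) K L,
      (∀ j : Fin k, B j.castSucc = (φ.symm (Pi.single j 1, 0) : 𝓞 L)) ∧
      (B (Fin.last k) = (φ.symm (0, a) : 𝓞 L)) ∧
      ∀ y : 𝓞 L, (y : L) = ∑ j : Fin k, algebraMap (𝓞 K) K ((φ y).1 j) • B j.castSucc +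
        (algebraMap (𝓞 K) K (φ y).2 / algebraMap (𝓞 K) K a) • B (Fin.last k) := by
  have ha0 : (a : 𝓞 K) ≠ 0 := fun h => ha (Subtype.ext h)
  have haK : algebraMap (𝓞 K) K a ≠ 0 := by simpa using ha0
  let E : Fin (k + 1) → 𝓞 L := Fin.lastCases (φ.symm (0, a)) fun j => φ.symm (Pi.single j 1, 0)
  have hE1 : ∀ j : Fin k, E j.castSucc = φ.symm (Pi.single j 1, 0) := fun j => by simp [E]
  have hE2 : E (Fin.last k) = φ.symm (0, a) := by simp [E]
  have hcomb : ∀ (r : Fin (k + 1) → 𝓞 K), φ (∑ i, r i • E i) =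
      (fun j => r j.castSucc, r (Fin.last k) • a) := by
    intro r
    rw [map_sum, Fin.sum_univ_castSucc]
    simp only [map_smul, hE1, hE2, LinearEquiv.apply_symm_apply]
    apply Prod.ext
    · simp only [Prod.fst_add, Prod.fst_sum, Prod.smul_fst, smul_zero, add_zero]
      ext j
      simp [Finset.sum_apply, Pi.single_apply]
    · simp [Prod.snd_sum]
  have hli : LinearIndependent (𝓞 K) E := by
    rw [Fintype.linearIndependent_iff]
    intro r hr i
    have := hcomb r
    rw [hr, map_zero] at this
    induction i using Fin.lastCases with
    | last =>
      have h2 := congrArg (fun z => (z.2 : 𝓞 K)) this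
      simp only [Prod.snd_zero, ZeroMemClass.coe_zero, Submodule.coe_smul, smul_eq_mul] at h2
      rcases mul_eq_zero.1 h2.symm with h | h
      · exact h
      · exact absurd h ha0
    | cast j => exact (congrFun (congrArg Prod.fst this) j).symm
  have hliL : LinearIndependent (𝓞 K) fun i => (E i : L) := by
    have := hli.map' (IsScalarTower.toAlgHom (𝓞 K) (𝓞 L) L).toLinearMap
      (LinearMap.ker_eq_bot.2 RingOfIntegers.coe_injective)
    exact this
  have hliK : LinearIndependent K fun i => (E i : L) :=
    (LinearIndependent.iff_fractionRing (𝓞 K) K).1 hliL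
  have hexp : ∀ y : 𝓞 L, (y : L) = ∑ j : Fin k, algebraMap (𝓞 K) K ((φ y).1 j) •
      (E j.castSucc : L) +
        (algebraMap (𝓞 K) K (φ y).2 / algebraMap (𝓞 K) K a) • (E (Fin.last k) : L) := by
    intro y
    have h1 : (a : 𝓞 K) • y = ∑ i, (Fin.lastCases ((φ y).2 : 𝓞 K)
        (fun j => a * (φ y).1 j) i : 𝓞 K) • E i := by
      apply φ.injective
      rw [hcomb, map_smul]
      simp only [Fin.lastCases_castSucc, Fin.lastCases_last]
      apply Prod.ext
      · ext j; simp
      · apply Subtype.ext; simp [mul_comm]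
    have h2 := congrArg (fun z : 𝓞 L => (z : L)) h1
    rw [Fin.sum_univ_castSucc] at h2
    simp only [Fin.lastCases_castSucc, Fin.lastCases_last, Algebra.smul_def, map_add, map_sum,
      map_mul, ← IsScalarTower.algebraMap_apply (𝓞 K) (𝓞 L) L,
      IsScalarTower.algebraMap_apply (𝓞 K) K L] at h2
    have hL : algebraMap K L (algebraMap (𝓞 K) K a) ≠ 0 := by simpa using haK
    simp only [Algebra.smul_def, map_div₀]
    apply mul_left_cancel₀ hL
    rw [h2, mul_add, Finset.mul_sum]
    congr 1
    · exact Finset.sum_congr rfl fun j _ => by ring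
    · field_simp
  have hspan : ⊤ ≤ Submodule.span K (Set.range fun i => (E i : L)) := by
    intro y _
    obtain ⟨m, hm⟩ := IsIntegral.exists_multiple_integral_of_isLocalization (𝓞 K)⁰ (Rₘ := K) y
      (Algebra.IsIntegral.isIntegral y)
    have hm' : IsIntegral ℤ (m • y) := isIntegral_trans _ hm
    have hmK : algebraMap (𝓞 K) K m ≠ 0 := by
      simp
    obtain ⟨z, hz⟩ : ∃ z : 𝓞 L, (z : L) = (m : 𝓞 K) • y := ⟨⟨m • y, hm'⟩, rfl⟩
    have h4 : y = (algebraMap (𝓞 K) K m)⁻¹ • (z : L) := by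
      rw [hz, ← algebraMap_smul K (m : 𝓞 K) y, smul_smul, inv_mul_cancel₀ hmK, one_smul]
    rw [h4, hexp z]
    exact Submodule.smul_mem _ _ (Submodule.add_mem _ (Submodule.sum_mem _ fun j _ =>
      Submodule.smul_mem _ _ (Submodule.subset_span ⟨_, rfl⟩))
      (Submodule.smul_mem _ _ (Submodule.subset_span ⟨_, rfl⟩)))
  refine ⟨Module.Basis.mk hliK hspan, ?_, ?_, ?_⟩
  · intro j; simp [hE1]
  · simp [hE2]
  · intro y; simpa using hexp y

theorem exists_det_eq_of_entries {R F : Type*} [CommRing R] [CommRing F] [Algebra R F] {k : ℕ}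
    (I : Ideal R) (M : Matrix (Fin (k + 1)) (Fin (k + 1)) F)
    (h1 : ∀ (j : Fin k) i, ∃ r : R, algebraMap R F r = M j.castSucc i)
    (h2 : ∀ i, ∃ r ∈ I, algebraMap R F r = M (Fin.last k) i) :
    ∃ r ∈ I, algebraMap R F r = M.det := by
  choose f hf using h1
  choose g hgI hg using h2
  let N : Matrix (Fin (k + 1)) (Fin (k + 1)) R := fun j i => Fin.lastCases (g i) (fun j => f j i) j
  have hN : M = N.map (algebraMap R F) := by
    ext j i
    induction j using Fin.lastCases with
    | last => rw [Matrix.map_apply]; simp [N, hg]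
    | cast j => rw [Matrix.map_apply]; simp [N, hf]
  refine ⟨N.det, ?_, ?_⟩
  · rw [Matrix.det_succ_row N (Fin.last k)]
    refine Ideal.sum_mem _ fun j _ => Ideal.mul_mem_right _ _ (Ideal.mul_mem_left _ _ ?_)
    simpa [N] using hgI j
  · rw [hN, RingHom.map_det]; rfl

/-- If the ring of integers is isomorphic to the sum of a free module and an ideal `I`, then the
ideal of determinants is a principal multiple of `I`. -/
theorem exists_isLeast_detOrders_of_equiv {k n : ℕ} {I : Ideal (𝓞 K)} (hI : I ≠ ⊥)
    (φ : (𝓞 L) ≃ₗ[𝓞 K] ((Fin k → 𝓞 K) × I)) (b : Module.Basis (Fin n) K L) :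
    n = k + 1 ∧ ∃ d : Kˣ, ∀ p : HeightOneSpectrum (𝓞 K),
      IsLeast (detOrders p b) (ordAt p (d : K) + multiplicity p.asIdeal I) := by
  obtain ⟨a, haI, ha0⟩ := Submodule.exists_mem_ne_zero_of_ne_bot hI
  have haK : algebraMap (𝓞 K) K a ≠ 0 := by simpa using ha0
  obtain ⟨B, hB1, hB2, hB⟩ := exists_basis_of_equiv φ ⟨a, haI⟩
    (fun h => ha0 (congrArg Subtype.val h))
  have hn : n = k + 1 := by
    have h1 := Module.finrank_eq_card_basis b
    have h2 := Module.finrank_eq_card_basis B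
    simp only [Fintype.card_fin] at h1 h2
    omega
  subst hn
  refine ⟨rfl, ?_⟩
  have hrepr : ∀ y : 𝓞 L, (∀ j : Fin k, B.repr y j.castSucc = algebraMap (𝓞 K) K ((φ y).1 j)) ∧
      B.repr y (Fin.last k) = algebraMap (𝓞 K) K (φ y).2 / algebraMap (𝓞 K) K a := by
    intro y
    have h3 : (y : L) = ∑ i, (Fin.lastCases (algebraMap (𝓞 K) K (φ y).2 / algebraMap (𝓞 K) K a)
        (fun j => algebraMap (𝓞 K) K ((φ y).1 j)) i : K) • B i := by
      rw [Fin.sum_univ_castSucc]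
      simpa using hB y
    have h4 := B.repr_sum_self (fun i => (Fin.lastCases (algebraMap (𝓞 K) K (φ y).2 /
      algebraMap (𝓞 K) K a) (fun j => algebraMap (𝓞 K) K ((φ y).1 j)) i : K))
    rw [← h3] at h4
    exact ⟨fun j => by rw [h4]; simp, by rw [h4]; simp⟩
  have hbB : b.det B ≠ 0 := (b.isUnit_det B).ne_zero
  have hmul : ∀ x : Fin (k + 1) → L, b.det x = b.det B * B.det x := by
    intro x
    rw [Module.Basis.det_apply, Module.Basis.det_apply, Module.Basis.det_apply, ← Matrix.det_mul,
      Module.Basis.toMatrix_mul_toMatrix]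
  have hintegral : ∀ x : Fin (k + 1) → L, (∀ i, IsIntegral ℤ (x i)) →
      ∃ r ∈ I, algebraMap (𝓞 K) K r = algebraMap (𝓞 K) K a * B.det x := by
    intro x hx
    let v : Fin (k + 1) → K := Fin.lastCases (algebraMap (𝓞 K) K a) fun _ => 1
    have hv : ∏ i, v i = algebraMap (𝓞 K) K a := by
      rw [Fin.prod_univ_castSucc]; simp [v]
    rw [Module.Basis.det_apply, ← hv, ← Matrix.det_mul_column]
    apply exists_det_eq_of_entries
    · intro j i
      refine ⟨(φ ⟨x i, hx i⟩).1 j, ?_⟩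
      simp only [Matrix.of_apply, v, Fin.lastCases_castSucc, one_mul, Module.Basis.toMatrix_apply]
      exact ((hrepr ⟨x i, hx i⟩).1 j).symm
    · intro i
      refine ⟨(φ ⟨x i, hx i⟩).2, (φ ⟨x i, hx i⟩).2.2, ?_⟩
      simp only [Matrix.of_apply, v, Fin.lastCases_last, Module.Basis.toMatrix_apply]
      rw [show B.repr (x i) (Fin.last k) = _ from (hrepr ⟨x i, hx i⟩).2]
      field_simp
  have hrealize : ∀ r ∈ I, ∃ x : Fin (k + 1) → L, (∀ i, IsIntegral ℤ (x i)) ∧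
      algebraMap (𝓞 K) K r = algebraMap (𝓞 K) K a * B.det x := by
    intro r hr
    let v : Fin (k + 1) → K :=
      Fin.lastCases (algebraMap (𝓞 K) K r / algebraMap (𝓞 K) K a) fun _ => 1
    have hv : ∏ i, v i = algebraMap (𝓞 K) K r / algebraMap (𝓞 K) K a := by
      rw [Fin.prod_univ_castSucc]; simp [v]
    refine ⟨fun i => v i • B i, ?_, ?_⟩
    · intro i
      induction i using Fin.lastCases with
      | last =>
        have h5 := hB (φ.symm (0, ⟨r, hr⟩))
        simp only [LinearEquiv.apply_symm_apply, Pi.zero_apply, map_zero, zero_smul,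
          Finset.sum_const_zero, zero_add] at h5
        simp only [v, Fin.lastCases_last]
        rw [← h5]
        exact RingOfIntegers.isIntegral_coe _
      | cast j =>
        simp only [v, Fin.lastCases_castSucc, one_smul, hB1]
        exact RingOfIntegers.isIntegral_coe _
    · have := B.det.map_smul_univ v B
      rw [this, hv, Module.Basis.det_self]
      simp only [smul_eq_mul, mul_one]
      field_simp
  refine ⟨Units.mk0 (b.det B) hbB * (Units.mk0 _ haK)⁻¹, fun p => ?_⟩
  have hspan : (Ideal.span (I : Set (𝓞 K))) = I := Ideal.span_eq I
  have hleast := isLeast_ordAt_span (K := K) p (I : Set (𝓞 K)) (by rwa [hspan])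
  rw [hspan] at hleast
  have hord : ordAt p ((Units.mk0 (b.det B) hbB * (Units.mk0 _ haK)⁻¹ : Kˣ) : K) =
      ordAt p (b.det B) - ordAt p (algebraMap (𝓞 K) K a) := by
    simp only [Units.val_mul, Units.val_mk0, Units.val_inv_eq_inv_val]
    rw [ordAt_mul p hbB (inv_ne_zero haK), ordAt_inv]; ring
  rw [hord]
  constructor
  · obtain ⟨r, hr, hr0, hrm⟩ := hleast.1
    obtain ⟨x, hx, hrx⟩ := hrealize r hr
    have hBx : B.det x ≠ 0 := by
      intro h
      rw [h, mul_zero] at hrx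
      exact hr0 (by simpa using hrx)
    refine ⟨x, hx, by rw [hmul]; exact mul_ne_zero hbB hBx, ?_⟩
    rw [hrx, ordAt_mul p haK hBx] at hrm
    rw [hmul x, ordAt_mul p hbB hBx]
    omega
  · rintro m ⟨x, hx, hx0, rfl⟩
    obtain ⟨r, hr, hrx⟩ := hintegral x hx
    rw [hmul] at hx0
    have hBx := right_ne_zero_of_mul hx0
    have hr0 : r ≠ 0 := by
      rintro rfl
      rw [map_zero] at hrx
      exact mul_ne_zero haK hBx hrx.symm
    have := hleast.2 ⟨r, hr, hr0, rfl⟩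
    rw [hrx, ordAt_mul p haK hBx] at this
    rw [hmul x, ordAt_mul p hbB hBx]
    omega

theorem exists_isSteinitzClass : ∃ c, IsSteinitzClass K L c := by
  have := projective_of_finite_torsionFree (R := 𝓞 K) (𝓞 L)
  obtain ⟨n, f, g, -, hg, hfg⟩ := Module.Finite.exists_comp_eq_id_of_projective (𝓞 K) (𝓞 L)
  rcases exists_equiv_free_prod_ideal n (𝓞 L) g hg with h | ⟨k, I, hI, ⟨φ⟩⟩
  · exact absurd h (not_subsingleton _)
  · have hk := (exists_isLeast_detOrders_of_equiv hI φ (Module.finBasis K L)).1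
    refine ⟨_, ⟨I, mem_nonZeroDivisors_of_ne_zero hI⟩, rfl, ?_⟩
    rw [hk, Nat.add_sub_cancel]
    exact ⟨φ⟩

theorem discr_eq_det_sq_mul {n : ℕ} (b : Module.Basis (Fin n) K L) (x : Fin n → L) :
    Algebra.discr K x = b.det x ^ 2 * Algebra.discr K b := by
  rw [Module.Basis.det_apply, ← Algebra.discr_of_matrix_vecMul]
  congr 1
  ext i
  conv_lhs => rw [← b.sum_repr (x i)]
  simp [Matrix.vecMul, dotProduct, Module.Basis.toMatrix_apply, Algebra.smul_def, mul_comm]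

theorem relDisc_ne_bot_and_multiplicity (b : Module.Basis (Fin (Module.finrank K L)) K L) :
    relDisc K L ≠ ⊥ ∧ ∀ (p : HeightOneSpectrum (𝓞 K)) (c : ℤ), IsLeast (detOrders p b) c →
      (multiplicity p.asIdeal (relDisc K L) : ℤ) = 2 * c + ordAt p (Algebra.discr K b) := by
  have hd0 := Algebra.discr_not_zero_of_basis K b
  have hbasis : ∀ x : Fin (Module.finrank K L) → L, (∀ i, IsIntegral ℤ (x i)) → b.det x ≠ 0 →
      ∃ d : 𝓞 K, d ≠ 0 ∧ algebraMap (𝓞 K) K d = b.det x ^ 2 * Algebra.discr K b ∧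
      d ∈ {d : 𝓞 K | ∃ b : Module.Basis (Fin (Module.finrank K L)) K L,
        (∀ i, IsIntegral ℤ (b i)) ∧ algebraMap (𝓞 K) K d = Algebra.discr K ⇑b} := by
    intro x hx h0
    have hintegral : IsIntegral ℤ (Algebra.discr K x) := Algebra.discr_isIntegral K hx
    have hbas := b.is_basis_iff_det.2 (isUnit_iff_ne_zero.2 h0)
    have heq := discr_eq_det_sq_mul b x
    refine ⟨⟨_, hintegral⟩, ?_, heq, Module.Basis.mk hbas.1 hbas.2.ge, ?_, ?_⟩
    · intro h
      have h' : Algebra.discr K x = 0 := congrArg (algebraMap (𝓞 K) K) h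
      rw [heq] at h'
      exact mul_ne_zero (pow_ne_zero 2 h0) hd0 h'
    · intro i; simpa using hx i
    · rw [Module.Basis.coe_mk]; rfl
  have hne : relDisc K L ≠ ⊥ := by
    obtain ⟨c, I, -, ⟨φ⟩⟩ := exists_isSteinitzClass (K := K) (L := L)
    obtain ⟨-, d, hd⟩ := exists_isLeast_detOrders_of_equiv (nonZeroDivisors.coe_ne_zero I) φ b
    intro hbot
    obtain ⟨x, hx, h0⟩ : ∃ x : Fin (Module.finrank K L) → L, (∀ i, IsIntegral ℤ (x i)) ∧
        b.det x ≠ 0 := by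
      classical
      obtain ⟨m, hm⟩ : ∃ m : ℤ, m ≠ 0 ∧ ∀ z ∈ Finset.univ.image b, IsIntegral ℤ (m • z) :=
        exists_integral_multiples ℤ ℚ (Finset.univ.image b)
      have hmK : ((m : ℤ) : K) ≠ 0 := by exact_mod_cast hm.1
      refine ⟨fun i => m • b i, fun i => hm.2 _ (by simp), ?_⟩
      have h1 : (fun i => m • b i) = fun i => ((fun _ => (m : K)) i) • b i := by
        ext i; simp [Algebra.smul_def]
      rw [h1]
      have := b.det.map_smul_univ (fun _ => (m : K)) b
      rw [this, Module.Basis.det_self]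
      simp [hmK]
    obtain ⟨d, hd0', -, hdm⟩ := hbasis x hx h0
    have : d ∈ relDisc K L := Ideal.subset_span hdm
    rw [hbot] at this
    exact hd0' this
  refine ⟨hne, fun p c hc => ?_⟩
  have hleast := isLeast_ordAt_span (K := K) p _ hne
  change IsLeast _ (multiplicity p.asIdeal (relDisc K L) : ℤ) at hleast
  refine hleast.unique ⟨?_, ?_⟩
  · obtain ⟨x, hx, h0, rfl⟩ := hc.1
    obtain ⟨d, hd0', hd, hdm⟩ := hbasis x hx h0
    refine ⟨d, hdm, hd0', ?_⟩
    rw [hd, ordAt_mul p (pow_ne_zero 2 h0) hd0, ordAt_pow]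
    norm_num
  · rintro m ⟨d, ⟨x, hx, hd⟩, hd0', rfl⟩
    have h0 : b.det x ≠ 0 := (b.isUnit_det x).ne_zero
    have h1 := hc.2 ⟨x, hx, h0, rfl⟩
    rw [hd, discr_eq_det_sq_mul b x, ordAt_mul p (pow_ne_zero 2 h0) hd0, ordAt_pow]
    push_cast
    linarith

/-- The Steinitz class is the class of the ideal of determinants. -/
theorem isSteinitzClass_iff (b : Module.Basis (Fin (Module.finrank K L)) K L)
    (D : HeightOneSpectrum (𝓞 K) →₀ ℤ) (hD : ∀ p, IsLeast (detOrders p b) (D p))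
    (c : ClassGroup (𝓞 K)) :
    IsSteinitzClass K L c ↔ Additive.ofMul c = divClass D := by
  have key : ∀ c, IsSteinitzClass K L c → Additive.ofMul c = divClass D := by
    rintro c ⟨I, rfl, ⟨φ⟩⟩
    obtain ⟨-, d, hd⟩ := exists_isLeast_detOrders_of_equiv (nonZeroDivisors.coe_ne_zero I) φ b
    have : D = prinDiv d + natDiv (idealDiv I) := by
      ext p
      simp only [Finsupp.coe_add, Pi.add_apply, prinDiv_apply, natDiv_apply, idealDiv_apply]
      exact (hD p).unique (hd p)
    rw [this, map_add, divClass_prinDiv, zero_add, divClass_idealDiv]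
  refine ⟨key c, fun h => ?_⟩
  obtain ⟨c', hc'⟩ := exists_isSteinitzClass (K := K) (L := L)
  have := key c' hc'
  rw [← h] at this
  rw [← Additive.ofMul.injective this]
  exact hc'

theorem exists_detDiv (b : Module.Basis (Fin (Module.finrank K L)) K L) :
    ∃ D : HeightOneSpectrum (𝓞 K) →₀ ℤ, ∀ p, IsLeast (detOrders p b) (D p) := by
  obtain ⟨c, I, -, ⟨φ⟩⟩ := exists_isSteinitzClass (K := K) (L := L)
  obtain ⟨-, d, hd⟩ := exists_isLeast_detOrders_of_equiv (nonZeroDivisors.coe_ne_zero I) φ b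
  exact ⟨prinDiv d + natDiv (idealDiv I), fun p => by simpa [idealDiv_apply] using hd p⟩

end DetLattice

section LocalIntegral
open IsDedekindDomain NumberField HeightOneSpectrum
open scoped nonZeroDivisors

variable {K L : Type*} [Field K] [NumberField K] [Field L] [NumberField L] [Algebra K L]
variable (p : HeightOneSpectrum (𝓞 K))

/-- The valuation subring `W` of `L` contains the valuation ring of `p`. -/
def IsOver (W : ValuationSubring L) : Prop :=
  ∀ a : K, p.valuation K a ≤ 1 → algebraMap K L a ∈ W

/-- `x` is integral at `p`: it lies in every valuation ring above `p`. -/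
def LocallyIntegral (x : L) : Prop := ∀ W : ValuationSubring L, IsOver p W → x ∈ W

variable {p}

theorem mem_valuationSubring_of_isIntegral_int (W : ValuationSubring L) {x : L}
    (hx : IsIntegral ℤ x) : x ∈ W := by
  have h1 : IsIntegral W x := hx.tower_top
  obtain ⟨y, hy⟩ := IsIntegrallyClosed.isIntegral_iff.1 h1
  rw [← hy]
  exact y.2

theorem locallyIntegral_of_isIntegral {x : L} (hx : IsIntegral ℤ x) : LocallyIntegral p x :=
  fun W _ => mem_valuationSubring_of_isIntegral_int W hx

theorem LocallyIntegral.pow {x : L} (hx : LocallyIntegral p x) (n : ℕ) :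
    LocallyIntegral p (x ^ n) := fun W hW => pow_mem (hx W hW) n

theorem exists_smul_isIntegral_of_locallyIntegral {x : L} (hx : LocallyIntegral p x) :
    ∃ s : 𝓞 K, s ∉ p.asIdeal ∧ IsIntegral ℤ (s • x) := by
  have : IsScalarTower (𝓞 K) (valuationSubringAtPrime K p) L :=
    IsScalarTower.of_algebraMap_eq fun _ => rfl
  have hintegral : IsIntegral (valuationSubringAtPrime K p) x := by
    by_contra hcon
    have hcl : IsIntegrallyClosedIn
        (integralClosure (valuationSubringAtPrime K p) L).toSubring L :=
      inferInstanceAs (IsIntegrallyClosedIn (integralClosure (valuationSubringAtPrime K p) L) L)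
    obtain ⟨V, hV, hxV⟩ := Subring.exists_le_valuationSubring_of_isIntegrallyClosedIn
      (R := (integralClosure (valuationSubringAtPrime K p) L).toSubring) (x := x) hcon
    refine hxV (hx V fun a ha => hV ?_)
    have ha' : a ∈ valuationSubringAtPrime K p := by
      rw [valuationSubringAtPrime_eq_valuationSubring]; exact ha
    exact isIntegral_algebraMap (R := valuationSubringAtPrime K p) (A := L) (x := ⟨a, ha'⟩)
  obtain ⟨m, hm⟩ := IsIntegral.exists_multiple_integral_of_isLocalization p.asIdeal.primeCompl
    (Rₘ := valuationSubringAtPrime K p) x hintegral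
  exact ⟨m, m.2, isIntegral_trans _ hm⟩

theorem ordAt_eq_zero_of_notMem {s : 𝓞 K} (hs : s ∉ p.asIdeal) :
    ordAt p (algebraMap (𝓞 K) K s) = 0 := by
  rw [ordAt, (p.valuation_eq_one_iff_notMem (K := K)).2 hs]; simp

theorem det_smul_const {n : ℕ} (b : Module.Basis (Fin n) K L) (r : K) (x : Fin n → L) :
    b.det (fun i => r • x i) = r ^ n * b.det x := by
  have := b.det.map_smul_univ (fun _ => r) x
  simpa using this

theorem mem_detOrders_iff {n : ℕ} (b : Module.Basis (Fin n) K L) (m : ℤ) :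
    m ∈ detOrders p b ↔ ∃ x : Fin n → L, (∀ i, LocallyIntegral p (x i)) ∧ b.det x ≠ 0 ∧
      ordAt p (b.det x) = m := by
  constructor
  · rintro ⟨x, hx, h⟩
    exact ⟨x, fun i => locallyIntegral_of_isIntegral (hx i), h⟩
  · rintro ⟨x, hx, h0, rfl⟩
    choose s hs hsx using fun i => exists_smul_isIntegral_of_locallyIntegral (hx i)
    let t : 𝓞 K := ∏ i, s i
    have ht : t ∉ p.asIdeal := by
      intro h
      obtain ⟨i, -, hi⟩ := (p.isPrime.prod_mem_iff).1 h
      exact hs i hi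
    have ht0 : algebraMap (𝓞 K) K t ≠ 0 := by
      intro h
      exact ht (by rw [show t = 0 by simpa using h]; exact zero_mem _)
    refine ⟨fun i => algebraMap (𝓞 K) K t • x i, fun i => ?_, ?_, ?_⟩
    · beta_reduce
      rw [algebraMap_smul, show t = (∏ j ∈ Finset.univ.erase i, s j) * s i from
        (Finset.prod_erase_mul _ _ (Finset.mem_univ i)).symm, mul_smul, Algebra.smul_def]
      exact IsIntegral.mul ((RingOfIntegers.isIntegral _).map
        (IsScalarTower.toAlgHom ℤ (𝓞 K) L)) (hsx i)
    · rw [det_smul_const]; exact mul_ne_zero (pow_ne_zero _ ht0) h0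
    · rw [det_smul_const, ordAt_mul p (pow_ne_zero _ ht0) h0, ordAt_pow,
        ordAt_eq_zero_of_notMem ht]
      simp

theorem IsOver.eq_top_or {W : ValuationSubring L} (hW : IsOver p W) :
    (∀ x : L, x ∈ W) ∨ ∀ a : K, algebraMap K L a ∈ W ↔ p.valuation K a ≤ 1 := by
  by_cases h : ∃ a : K, algebraMap K L a ∈ W ∧ 1 < p.valuation K a
  · left
    obtain ⟨a, haW, ha⟩ := h
    have ha0 : a ≠ 0 := by rintro rfl; simp at ha
    have hK : ∀ y : K, algebraMap K L y ∈ W := by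
      intro y
      by_cases hy : y = 0
      · rw [hy, map_zero]; exact W.zero_mem
      have hao : ordAt p a < 0 := by
        by_contra hcon
        exact absurd ((ordAt_nonneg_iff p ha0).1 (not_lt.1 hcon)) (not_le.2 ha)
      let m : ℕ := (ordAt p y).natAbs
      have h1 : p.valuation K (y / a ^ m) ≤ 1 := by
        rw [← ordAt_nonneg_iff p (div_ne_zero hy (pow_ne_zero _ ha0)),
          ordAt_div p hy (pow_ne_zero _ ha0), ordAt_pow]
        have : (m : ℤ) = |ordAt p y| := by simp [m]
        rw [this]
        have h2 := neg_abs_le (ordAt p y)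
        nlinarith [abs_nonneg (ordAt p y)]
      have h2 := W.mul_mem _ _ (hW _ h1) (pow_mem haW m)
      rwa [← map_pow, ← map_mul, div_mul_cancel₀ _ (pow_ne_zero _ ha0)] at h2
    intro x
    let _ : Algebra K W := ((algebraMap K L).codRestrict W.toSubring hK).toAlgebra
    have : IsScalarTower K W L := IsScalarTower.of_algebraMap_eq fun _ => rfl
    have h1 : IsIntegral W x := (Algebra.IsIntegral.isIntegral (R := K) x).tower_top
    obtain ⟨y, hy⟩ := IsIntegrallyClosed.isIntegral_iff.1 h1
    rw [← hy]
    exact y.2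
  · right
    push Not at h
    exact fun a => ⟨h a, hW a⟩

theorem valuation_algebraMap_le_iff {W : ValuationSubring L}
    (hW : ∀ a : K, algebraMap K L a ∈ W ↔ p.valuation K a ≤ 1) (a b : K) :
    W.valuation (algebraMap K L a) ≤ W.valuation (algebraMap K L b) ↔
      p.valuation K a ≤ p.valuation K b := by
  by_cases hb : b = 0
  · simp [hb]
  have h1 := hW (a / b)
  rw [← ValuationSubring.valuation_le_one_iff, map_div₀, map_div₀, map_div₀,
    div_le_one₀ (by simpa [zero_lt_iff] using hb), div_le_one₀ (by simpa [zero_lt_iff] using hb)] at h1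
  exact h1

theorem valuation_algebraMap_eq_iff {W : ValuationSubring L}
    (hW : ∀ a : K, algebraMap K L a ∈ W ↔ p.valuation K a ≤ 1) (a b : K) :
    W.valuation (algebraMap K L a) = W.valuation (algebraMap K L b) ↔
      p.valuation K a = p.valuation K b := by
  rw [le_antisymm_iff, le_antisymm_iff, valuation_algebraMap_le_iff hW,
    valuation_algebraMap_le_iff hW]

/-- Change of basis. -/
theorem isLeast_detOrders_of_basis {n : ℕ} {b e : Module.Basis (Fin n) K L} {c : ℤ}
    (h : IsLeast (detOrders p e) c) : IsLeast (detOrders p b) (c + ordAt p (b.det e)) := by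
  have hbe : b.det e ≠ 0 := (b.isUnit_det e).ne_zero
  have hmul : ∀ x : Fin n → L, b.det x = b.det e * e.det x := by
    intro x
    rw [Module.Basis.det_apply, Module.Basis.det_apply, Module.Basis.det_apply, ← Matrix.det_mul,
      Module.Basis.toMatrix_mul_toMatrix]
  constructor
  · obtain ⟨x, hx, h0, hc⟩ := h.1
    refine ⟨x, hx, by rw [hmul x]; exact mul_ne_zero hbe h0, ?_⟩
    rw [hmul x, ordAt_mul p hbe h0, hc, add_comm]
  · rintro m ⟨x, hx, h0, rfl⟩
    rw [hmul x] at h0 ⊢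
    have h1 := right_ne_zero_of_mul h0
    rw [ordAt_mul p hbe h1]
    have := h.2 ⟨x, hx, h1, rfl⟩
    omega

/-- A locally diagonal lattice. -/
theorem isLeast_detOrders_diag {n : ℕ} (b : Module.Basis (Fin n) K L) (t : Fin n → ℤ)
    (h1 : ∀ x : L, LocallyIntegral p x → ∀ j, b.repr x j ≠ 0 → -t j ≤ ordAt p (b.repr x j))
    (h2 : ∀ j, ∃ r : K, r ≠ 0 ∧ ordAt p r = - t j ∧ LocallyIntegral p (r • b j)) :
    IsLeast (detOrders p b) (-∑ j, t j) := by
  choose r hr0 hr hintegral using h2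
  have hdet : b.det (fun i => r i • b i) = ∏ i, r i := by
    rw [b.det.map_smul_univ r b, b.det_self]; simp
  have hprod : ∏ i, r i ≠ 0 := Finset.prod_ne_zero_iff.2 fun i _ => hr0 i
  have hordp : ordAt p (∏ i, r i) = -∑ j, t j := by
    rw [ordAt_prod p _ _ fun i _ => hr0 i]; simp [hr]
  constructor
  · rw [mem_detOrders_iff]
    exact ⟨fun i => r i • b i, hintegral, by rwa [hdet], by rw [hdet, hordp]⟩
  · intro m hm
    rw [mem_detOrders_iff] at hm
    obtain ⟨x, hx, h0, rfl⟩ := hm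
    have h3 : b.det x = (∏ i, r i) * (Matrix.of fun i j => (r i)⁻¹ * b.toMatrix x i j).det := by
      rw [Matrix.det_mul_column, Module.Basis.det_apply, ← mul_assoc, ← Finset.prod_mul_distrib]
      simp [hr0]
    rw [h3] at h0 ⊢
    have h4 := right_ne_zero_of_mul h0
    rw [ordAt_mul p hprod h4, hordp]
    have : 0 ≤ ordAt p (Matrix.of fun i j => (r i)⁻¹ * b.toMatrix x i j).det := by
      rw [ordAt_nonneg_iff p h4]
      have hent : ∀ i j, p.valuation K ((r i)⁻¹ * b.toMatrix x i j) ≤ 1 := by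
        intro i j
        by_cases hz : b.toMatrix x i j = 0
        · simp [hz]
        rw [← ordAt_nonneg_iff p (mul_ne_zero (inv_ne_zero (hr0 i)) hz),
          ordAt_mul p (inv_ne_zero (hr0 i)) hz, ordAt_inv, hr]
        have := h1 (x j) (hx j) i (by simpa [Module.Basis.toMatrix_apply] using hz)
        rw [Module.Basis.toMatrix_apply]
        omega
      rw [Matrix.det_apply]
      refine Valuation.map_sum_le _ fun σ _ => ?_
      rw [Units.smul_def, zsmul_eq_mul, map_mul, map_prod]
      refine mul_le_one' ?_ (Finset.prod_le_one' fun i _ => hent _ _)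
      rcases Int.units_eq_one_or (Equiv.Perm.sign σ) with h | h <;> simp [h]
    omega

/-- A locally integral basis with unit discriminant generates the local lattice. -/
theorem isLeast_detOrders_of_discr {n : ℕ} (b : Module.Basis (Fin n) K L) (h1 : ∀ j, LocallyIntegral p (b j))
    (h2 : ordAt p (Algebra.discr K b) = 0) : IsLeast (detOrders p b) 0 := by
  obtain rfl : n = Module.finrank K L := by simp [Module.finrank_eq_card_basis b]
  obtain ⟨D, hD⟩ := exists_detDiv b
  have h3 := (relDisc_ne_bot_and_multiplicity b).2 p _ (hD p)
  have h4 : (0 : ℤ) ∈ detOrders p b := by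
    rw [mem_detOrders_iff]
    exact ⟨b, h1, by simp [b.det_self], by simp [b.det_self, ordAt_one]⟩
  have h5 := (hD p).2 h4
  have h6 : D p = 0 := by omega
  rw [← h6]; exact hD p

end LocalIntegral

section LocalKummer
open IsDedekindDomain NumberField HeightOneSpectrum
open scoped nonZeroDivisors

variable {K L : Type*} [Field K] [NumberField K] [Field L] [NumberField L] [Algebra K L]
variable {p : HeightOneSpectrum (𝓞 K)}

theorem valuation_le_one_of_locallyIntegral {y : K}
    (hy : LocallyIntegral p (algebraMap K L y)) : p.valuation K y ≤ 1 := by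
  obtain ⟨s, hs, hintegral⟩ := exists_smul_isIntegral_of_locallyIntegral hy
  have h1 : IsIntegral ℤ (algebraMap (𝓞 K) K s * y) := by
    rw [← algebraMap_smul K s, Algebra.smul_def, ← map_mul] at hintegral
    exact (isIntegral_algebraMap_iff (algebraMap K L).injective).1 hintegral
  have h2 := p.valuation_le_one (K := K) (⟨_, h1⟩ : 𝓞 K)
  have h3 : p.valuation K (algebraMap (𝓞 K) K s * y) ≤ 1 := h2
  rwa [map_mul, (p.valuation_eq_one_iff_notMem (K := K)).2 hs, one_mul] at h3

theorem exists_ordAt_eq (n : ℤ) : ∃ r : K, r ≠ 0 ∧ ordAt p r = n := by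
  obtain ⟨π, hπ⟩ := p.valuation_exists_uniformizer K
  have hπ0 : π ≠ 0 := by rintro rfl; rw [map_zero] at hπ; exact WithZero.exp_ne_zero hπ.symm
  refine ⟨π ^ n, zpow_ne_zero _ hπ0, ?_⟩
  rw [ordAt, map_zpow₀, hπ, WithZero.log_zpow]
  simp

variable (L p) in
theorem exists_isOver_iff : ∃ W : ValuationSubring L, IsOver p W ∧
    ∀ a : K, algebraMap K L a ∈ W ↔ p.valuation K a ≤ 1 := by
  obtain ⟨r, hr0, hr⟩ := exists_ordAt_eq (p := p) (-1)
  have h1 : ¬ LocallyIntegral p (algebraMap K L r) := by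
    intro h
    have := (ordAt_nonneg_iff p hr0).2 (valuation_le_one_of_locallyIntegral h)
    omega
  unfold LocallyIntegral at h1
  push Not at h1
  obtain ⟨W, hW, hrW⟩ := h1
  refine ⟨W, hW, hW.eq_top_or.resolve_left fun h => hrW (h _)⟩

/-- If the terms of a finite sum have pairwise distinct valuations unless they vanish, then each
of them is bounded by the sum. -/
theorem valuation_le_valuation_sum {ι F Γ : Type*} [Fintype ι] [Field F]
    [LinearOrderedCommGroupWithZero Γ] (v : Valuation F Γ) (f : ι → F)
    (hf : ∀ i j, i ≠ j → f i ≠ 0 → v (f i) ≠ v (f j)) (i : ι) : v (f i) ≤ v (∑ j, f j) := by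
  classical
  obtain ⟨k, -, hk⟩ := Finset.exists_max_image Finset.univ (fun i => v (f i)) ⟨i, Finset.mem_univ i⟩
  refine (hk i (Finset.mem_univ i)).trans ?_
  by_cases h0 : f k = 0
  · simp [h0]
  rw [← Finset.add_sum_erase _ _ (Finset.mem_univ k), Valuation.map_add_eq_of_lt_left]
  refine Valuation.map_sum_lt _ (by simpa using h0) fun j hj => ?_
  exact lt_of_le_of_ne (hk j (Finset.mem_univ j)) (hf k j (Finset.ne_of_mem_erase hj).symm h0).symm

/-- The local lattice when the generator has valuation of denominator `ℓ`. -/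
theorem isLeast_detOrders_of_ramified {ℓ : ℕ} (hℓ : ℓ.Prime) (b : Module.Basis (Fin ℓ) K L)
    {ξ : L} (hb : ∀ j, b j = ξ ^ (j : ℕ)) {a : K} (ha : a ≠ 0) (hd : ¬ (ℓ : ℤ) ∣ ordAt p a)
    (hξ : ∀ W : ValuationSubring L, (∀ a : K, algebraMap K L a ∈ W ↔ p.valuation K a ≤ 1) →
      W.valuation ξ ^ ℓ = W.valuation (algebraMap K L a)) :
    IsLeast (detOrders p b) (-∑ j : Fin ℓ, ((j : ℕ) * ordAt p a) / ℓ) := by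
  have hℓ0 : (0 : ℤ) < ℓ := by exact_mod_cast hℓ.pos
  have hterm : ∀ (W : ValuationSubring L), (∀ a : K, algebraMap K L a ∈ W ↔ p.valuation K a ≤ 1) →
      ∀ (r : K) (j : Fin ℓ), W.valuation (r • b j) ^ ℓ =
        W.valuation (algebraMap K L (r ^ ℓ * a ^ (j : ℕ))) := by
    intro W hW r j
    rw [hb, Algebra.smul_def, map_mul, mul_pow, map_pow, ← pow_mul, mul_comm (j : ℕ), pow_mul,
      hξ W hW]
    simp only [map_mul, map_pow]
  have hord : ∀ (r : K) (j : Fin ℓ), r ≠ 0 →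
      ordAt p (r ^ ℓ * a ^ (j : ℕ)) = ℓ * ordAt p r + j * ordAt p a := by
    intro r j hr
    rw [ordAt_mul p (pow_ne_zero _ hr) (pow_ne_zero _ ha), ordAt_pow, ordAt_pow]
  apply isLeast_detOrders_diag
  · intro x hx j hj
    obtain ⟨W, hW, hWp⟩ := exists_isOver_iff L p
    have h1 : W.valuation (b.repr x j • b j) ≤ W.valuation (∑ i, b.repr x i • b i) := by
      refine valuation_le_valuation_sum W.valuation (fun i => b.repr x i • b i) ?_ j
      intro i k hik hi heq
      have hi0 : b.repr x i ≠ 0 := fun h => hi (by simp [h])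
      have hk0 : b.repr x k ≠ 0 := by
        intro h
        rw [h, zero_smul, map_zero, Valuation.zero_iff] at heq
        exact hi heq
      have h2 : W.valuation (algebraMap K L (b.repr x i ^ ℓ * a ^ (i : ℕ))) =
          W.valuation (algebraMap K L (b.repr x k ^ ℓ * a ^ (k : ℕ))) := by
        rw [← hterm W hWp, ← hterm W hWp, heq]
      rw [valuation_algebraMap_eq_iff hWp] at h2
      have h3 : ordAt p (b.repr x i ^ ℓ * a ^ (i : ℕ)) =
          ordAt p (b.repr x k ^ ℓ * a ^ (k : ℕ)) := by
        rw [ordAt, h2, ordAt]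
      rw [hord _ _ hi0, hord _ _ hk0] at h3
      have h4 : (ℓ : ℤ) ∣ ((i : ℕ) - (k : ℕ) : ℤ) * ordAt p a :=
        ⟨ordAt p (b.repr x k) - ordAt p (b.repr x i), by linarith⟩
      rcases (Nat.prime_iff_prime_int.1 hℓ).dvd_or_dvd h4 with h5 | h5
      · have h6 := Int.eq_zero_of_abs_lt_dvd h5 (by
          rw [abs_lt]; constructor <;> [have := k.2; have := i.2] <;> omega)
        exact hik (Fin.ext (by omega))
      · exact hd h5
    rw [b.sum_repr] at h1
    have h2 := h1.trans ((W.valuation_le_one_iff x).2 (hx W hW))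
    have h3 := pow_le_one₀ (n := ℓ) zero_le h2
    rw [hterm W hWp, ValuationSubring.valuation_le_one_iff, hWp, ← ordAt_nonneg_iff p
      (mul_ne_zero (pow_ne_zero _ hj) (pow_ne_zero _ ha)), hord _ _ hj] at h3
    rw [neg_le, Int.le_ediv_iff_mul_le hℓ0]
    linarith
  · intro j
    obtain ⟨r, hr0, hr⟩ := exists_ordAt_eq (p := p) (-(((j : ℕ) * ordAt p a) / ℓ))
    refine ⟨r, hr0, hr, fun W hW => ?_⟩
    rcases hW.eq_top_or with h | h
    · exact h _
    rw [← ValuationSubring.valuation_le_one_iff, ← pow_le_one_iff_of_nonneg zero_le hℓ.ne_zero,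
      hterm W h, ValuationSubring.valuation_le_one_iff, h, ← ordAt_nonneg_iff p
      (mul_ne_zero (pow_ne_zero _ hr0) (pow_ne_zero _ ha)), hord _ _ hr0, hr]
    have := Int.mul_ediv_self_le (x := (j : ℕ) * ordAt p a) hℓ0.ne'
    linarith

theorem valuation_sub_one_cases {ℓ : ℕ} (hℓ : ℓ.Prime) {l α : K}
    (hl : p.valuation K l ^ (ℓ - 1) = p.valuation K (ℓ : K)) (hα : p.valuation K α ≤ 1) {ξ : L}
    (hξ : (ξ + 1) ^ ℓ = algebraMap K L α) {W : ValuationSubring L}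
    (hW : ∀ a : K, algebraMap K L a ∈ W ↔ p.valuation K a ≤ 1) :
    (W.valuation ξ ≤ W.valuation (algebraMap K L l) ∧
      p.valuation K (α - 1) ≤ p.valuation K l ^ ℓ) ∨
    (W.valuation (algebraMap K L l) < W.valuation ξ ∧
      W.valuation ξ ^ ℓ = W.valuation (algebraMap K L (α - 1))) := by
  have hξW : ξ ∈ W := by
    have h1 : ξ + 1 ∈ W := by
      rw [← ValuationSubring.valuation_le_one_iff, ← pow_le_one_iff_of_nonneg zero_le hℓ.ne_zero,
        ← map_pow, hξ, ValuationSubring.valuation_le_one_iff, hW]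
      exact hα
    simpa using sub_mem h1 W.one_mem
  obtain ⟨r, hr⟩ := exists_add_pow_prime_eq hℓ (⟨ξ, hξW⟩ : W) 1
  have hr' : (ξ + 1) ^ ℓ = ξ ^ ℓ + 1 ^ ℓ + ℓ * ξ * 1 * (r : L) := by
    simpa using congrArg (Subtype.val) hr
  have ha : algebraMap K L (α - 1) = ξ ^ ℓ + ℓ * ξ * r := by
    rw [map_sub, ← hξ, hr', map_one]; ring
  have hlW : W.valuation (algebraMap K L l) ^ (ℓ - 1) = W.valuation (ℓ : L) := by
    rw [← map_pow, ← map_pow, ← map_natCast (algebraMap K L) ℓ, valuation_algebraMap_eq_iff hW,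
      map_pow, hl]
  have hterm : W.valuation (ℓ * ξ * r) ≤
      W.valuation (algebraMap K L l) ^ (ℓ - 1) * W.valuation ξ := by
    rw [map_mul, map_mul, hlW]
    exact mul_le_of_le_one_right' ((W.valuation_le_one_iff _).2 r.2)
  have hℓ1 : ℓ = (ℓ - 1) + 1 := by have := hℓ.pos; omega
  rcases le_or_gt (W.valuation ξ) (W.valuation (algebraMap K L l)) with h | h
  · left
    refine ⟨h, ?_⟩
    rw [← map_pow, ← valuation_algebraMap_le_iff hW, ha, map_pow, map_pow]
    refine (Valuation.map_add _ _ _).trans (max_le ?_ (hterm.trans ?_))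
    · rw [map_pow]; exact pow_le_pow_left₀ zero_le h _
    · conv_rhs => rw [hℓ1, pow_succ]
      exact mul_le_mul_right h _
  · right
    refine ⟨h, ?_⟩
    rw [ha, Valuation.map_add_eq_of_lt_left, map_pow]
    refine hterm.trans_lt ?_
    rw [map_pow]
    conv_rhs => rw [hℓ1, pow_succ]
    exact mul_lt_mul_of_pos_right (pow_lt_pow_left₀ h zero_le (by have := hℓ.two_le; omega))
      (lt_of_le_of_lt zero_le h)

/-- The determinant of the powers of an affine transform of the generator. -/
theorem det_affine_pow {n : ℕ} (b : Module.Basis (Fin n) K L) {θ : L}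
    (hb : ∀ j, b j = θ ^ (j : ℕ)) (r s : K) :
    b.det (fun j : Fin n => (r • θ + algebraMap K L s) ^ (j : ℕ)) = r ^ (n.choose 2) := by
  have hco : ∀ (j : Fin n), (r • θ + algebraMap K L s) ^ (j : ℕ) =
      ∑ i : Fin n, (((j : ℕ).choose i : K) * r ^ (i : ℕ) * s ^ ((j : ℕ) - i)) • b i := by
    intro j
    rw [add_pow]
    have h1 : ∑ i : Fin n, (((j : ℕ).choose i : K) * r ^ (i : ℕ) * s ^ ((j : ℕ) - i)) • b i =
        ∑ i ∈ Finset.range n, (((j : ℕ).choose i : K) * r ^ i * s ^ ((j : ℕ) - i)) • θ ^ i := by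
      rw [Finset.sum_range]
      exact Finset.sum_congr rfl fun i _ => by rw [hb]
    rw [h1]
    rw [← Finset.sum_subset (Finset.range_mono (show (j : ℕ) + 1 ≤ n from j.2))]
    · refine Finset.sum_congr rfl fun i _ => ?_
      rw [Algebra.smul_def, Algebra.smul_def, mul_pow, map_mul, map_mul, map_pow, map_pow,
        map_natCast]
      ring
    · intro i _ hi
      rw [Nat.choose_eq_zero_of_lt (by simpa using hi)]
      simp
  rw [Module.Basis.det_apply]
  have hent : ∀ i j : Fin n, b.toMatrix (fun j : Fin n => (r • θ + algebraMap K L s) ^ (j : ℕ)) i j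
      = ((j : ℕ).choose i : K) * r ^ (i : ℕ) * s ^ ((j : ℕ) - i) := by
    intro i j
    rw [Module.Basis.toMatrix_apply, hco, b.repr_sum_self]
  rw [Matrix.det_of_isUpperTriangular]
  · simp only [hent]
    simp only [Nat.choose_self, Nat.cast_one, one_mul, Nat.sub_self, pow_zero, mul_one]
    rw [Finset.prod_pow_eq_pow_sum, ← Finset.sum_range (fun i => i), Finset.sum_range_id,
      Nat.choose_two_right]
  · intro i j hij
    rw [hent, Nat.choose_eq_zero_of_lt (by exact hij)]
    simp

end LocalKummer

section KummerOrders
open IsDedekindDomain NumberField HeightOneSpectrum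
open scoped nonZeroDivisors

variable {K L : Type*} [Field K] [NumberField K] [Field L] [NumberField L] [Algebra K L]
variable {p : HeightOneSpectrum (𝓞 K)}

open Polynomial in
/-- The discriminant of a Kummer basis, locally. -/
theorem ordAt_discr_kummer {ℓ : ℕ} (hℓ : ℓ.Prime) (b : Module.Basis (Fin ℓ) K L)
    {θ : L} (hb : ∀ j, b j = θ ^ (j : ℕ)) {α : K} (hα : α ≠ 0) (hθ : θ ^ ℓ = algebraMap K L α) :
    ordAt p (Algebra.discr K b) = ℓ * ordAt p (ℓ : K) + (ℓ - 1) * ordAt p α := by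
  have hℓK : (ℓ : K) ≠ 0 := Nat.cast_ne_zero.2 hℓ.ne_zero
  have hθ0 : θ ≠ 0 := by
    rintro rfl
    rw [zero_pow hℓ.ne_zero] at hθ
    exact hα ((map_eq_zero _).1 hθ.symm)
  let pb : PowerBasis K L := ⟨θ, ℓ, b, hb⟩
  have hfin : Module.finrank K L = ℓ := by rw [Module.finrank_eq_card_basis b, Fintype.card_fin]
  have hmin : minpoly K θ = X ^ ℓ - C α := by
    have hdeg : (minpoly K θ).natDegree = ℓ := pb.natDegree_minpoly
    symm
    refine Polynomial.eq_of_monic_of_dvd_of_natDegree_le (minpoly.monic pb.isIntegral_gen)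
      (monic_X_pow_sub_C _ hℓ.ne_zero) (minpoly.dvd K θ ?_) ?_
    · simp [hθ]
    · rw [hdeg, natDegree_X_pow_sub_C]
  have hnorm : ordAt p (Algebra.norm K θ) = ordAt p α := by
    have h1 : Algebra.norm K θ ^ ℓ = α ^ ℓ := by
      rw [← map_pow, hθ, Algebra.norm_algebraMap, hfin]
    have h2 := congrArg (ordAt p) h1
    rw [ordAt_pow, ordAt_pow] at h2
    exact mul_left_cancel₀ (by exact_mod_cast hℓ.ne_zero) h2
  have h := Algebra.discr_powerBasis_eq_norm K pb
  have h' : Algebra.discr K b = Algebra.discr K pb.basis := rfl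
  have hN0 : Algebra.norm K θ ≠ 0 := (Algebra.norm_ne_zero_iff).2 hθ0
  have hgen : pb.gen = θ := rfl
  rw [h', h, hgen, hmin]
  simp only [derivative_sub, derivative_X_pow, derivative_C, sub_zero, map_mul, map_pow,
    aeval_X, map_natCast]
  have h3 : Algebra.norm K (ℓ : L) = (ℓ : K) ^ ℓ := by
    have : Algebra.norm K (algebraMap K L (ℓ : K)) = _ := Algebra.norm_algebraMap _
    rwa [map_natCast, hfin] at this
  rw [h3]
  have hs : ∀ n : ℕ, ∀ y : K, ordAt p ((-1) ^ n * y) = ordAt p y := by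
    intro n y
    rcases neg_one_pow_eq_or K n with h | h <;> simp [h, ordAt_neg]
  rw [hs, ordAt_mul p (pow_ne_zero _ hℓK) (pow_ne_zero _ hN0), ordAt_pow, ordAt_pow, hnorm,
    Nat.cast_sub hℓ.one_le]
  simp

end KummerOrders

section KummerOrders
open IsDedekindDomain NumberField HeightOneSpectrum
open scoped nonZeroDivisors

variable {K L : Type*} [Field K] [NumberField K] [Field L] [NumberField L] [Algebra K L]

theorem exists_valuation_pow_eq {ℓ : ℕ} (hℓ : ℓ.Prime) {ζ : K} (hζ : IsPrimitiveRoot ζ ℓ) :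
    ∃ l : K, l ≠ 0 ∧ ∀ p : HeightOneSpectrum (𝓞 K),
      p.valuation K l ≤ 1 ∧ p.valuation K l ^ (ℓ - 1) = p.valuation K (ℓ : K) := by
  have : NeZero ℓ := ⟨hℓ.ne_zero⟩
  have hz := hζ.toInteger_isPrimitiveRoot
  set z : 𝓞 K := hζ.toInteger
  obtain ⟨k, rfl⟩ : ∃ k, ℓ = k + 1 := ⟨ℓ - 1, by have := hℓ.pos; omega⟩
  have hprod := congrArg (algebraMap (𝓞 K) K) hz.prod_pow_sub_one_eq_order
  refine ⟨algebraMap (𝓞 K) K (z - 1), ?_, fun p => ⟨p.valuation_le_one _, ?_⟩⟩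
  · rw [Ne, map_eq_zero_iff _ (FaithfulSMul.algebraMap_injective _ _)]
    exact hz.sub_one_ne_zero hℓ.one_lt
  have h1 : ∀ j ∈ Finset.range k, p.valuation K (algebraMap (𝓞 K) K (z ^ (j + 1) - 1)) =
      p.valuation K (algebraMap (𝓞 K) K (z - 1)) := by
    intro j hj
    have hc : (j + 1).Coprime (k + 1) := by
      rw [Nat.coprime_comm, hℓ.coprime_iff_not_dvd]
      intro h
      have := Nat.le_of_dvd (by omega) h
      have := Finset.mem_range.1 hj
      omega
    obtain ⟨⟨u, w, hu, hw⟩, hu'⟩ := hz.associated_sub_one_pow_sub_one_of_coprime hc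
    rw [← hu', map_mul, map_mul]
    have h2 := congrArg (fun t => p.valuation K (algebraMap (𝓞 K) K t)) hu
    simp only [map_mul, map_one] at h2
    have h3 := p.valuation_le_one (K := K) u
    have h4 := p.valuation_le_one (K := K) w
    have h5 : p.valuation K (algebraMap (𝓞 K) K u) = 1 := by
      refine le_antisymm h3 ?_
      rw [← h2]
      exact mul_le_of_le_one_right' h4
    simp only [h5, mul_one]
  have h2 := congrArg (p.valuation K) hprod
  rw [map_mul, map_prod, map_mul, map_prod, Finset.prod_congr rfl h1, Finset.prod_const,
    Finset.card_range, map_pow, map_pow, map_neg, Valuation.map_neg, map_one, map_one, one_pow,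
    one_mul] at h2
  rw [Nat.add_sub_cancel, h2]
  simp

theorem exists_pow_sub_valuation_lt {p : HeightOneSpectrum (𝓞 K)} {ℓ : ℕ} (hℓ : ℓ.Prime)
    (hp : p.valuation K (ℓ : K) < 1) {u : K} (hu : p.valuation K u ≤ 1) :
    ∃ w : K, p.valuation K w ≤ 1 ∧ p.valuation K (w ^ ℓ - u) < 1 := by
  obtain ⟨a, ha⟩ := p.exists_valuation_sub_lt_of_integer hu 1
  have : p.asIdeal.IsMaximal := p.isMaximal
  let _ : Field (𝓞 K ⧸ p.asIdeal) := Ideal.Quotient.field _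
  have : Finite (𝓞 K ⧸ p.asIdeal) := Ideal.finiteQuotientOfFreeOfNeBot _ p.ne_bot
  have hmem : (ℓ : 𝓞 K) ∈ p.asIdeal := by
    rw [← p.valuation_lt_one_iff_mem (K := K)]; simpa using hp
  have : Fact ℓ.Prime := ⟨hℓ⟩
  have hch : CharP (𝓞 K ⧸ p.asIdeal) ℓ := by
    have h0 : ((ℓ : ℕ) : 𝓞 K ⧸ p.asIdeal) = 0 := by
      rw [← map_natCast (Ideal.Quotient.mk p.asIdeal), Ideal.Quotient.eq_zero_iff_mem]
      exact hmem
    exact (CharP.charP_iff_prime_eq_zero hℓ).2 h0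
  have hsurj := Finite.surjective_of_injective (frobenius_inj (𝓞 K ⧸ p.asIdeal) ℓ)
  obtain ⟨w, hw⟩ := hsurj (Ideal.Quotient.mk _ a)
  obtain ⟨w, rfl⟩ := Ideal.Quotient.mk_surjective w
  rw [frobenius_def, ← map_pow, Ideal.Quotient.eq, ← p.valuation_lt_one_iff_mem (K := K)] at hw
  refine ⟨algebraMap _ K w, p.valuation_le_one _, ?_⟩
  have : algebraMap (𝓞 K) K w ^ ℓ - u =
      algebraMap (𝓞 K) K (w ^ ℓ - a) + (algebraMap (𝓞 K) K a - u) := by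
    rw [map_sub, map_pow]; ring
  rw [this]
  exact Valuation.map_add_lt _ hw (by simpa using ha)

theorem exists_normalForm {p : HeightOneSpectrum (𝓞 K)} {ℓ : ℕ} (hℓ : ℓ.Prime) {l : K}
    (hl0 : l ≠ 0) (hl : p.valuation K l ^ (ℓ - 1) = p.valuation K (ℓ : K))
    (hp : p.valuation K (ℓ : K) < 1) {α : K} (hα : α ≠ 0) (hd : (ℓ : ℤ) ∣ ordAt p α) :
    ∃ y : K, y ≠ 0 ∧ p.valuation K (α / y ^ ℓ) = 1 ∧
      (p.valuation K (α / y ^ ℓ - 1) ≤ p.valuation K l ^ ℓ ∨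
        (¬ (ℓ : ℤ) ∣ ordAt p (α / y ^ ℓ - 1) ∧
          p.valuation K l ^ ℓ < p.valuation K (α / y ^ ℓ - 1))) := by
  set v := p.valuation K with hv
  by_contra hcon
  have key : ∀ n : ℕ, ∃ y : K, y ≠ 0 ∧ v (α / y ^ ℓ) = 1 ∧
      v (α / y ^ ℓ - 1) ≤ WithZero.exp (-(n : ℤ)) := by
    intro n
    induction n with
    | zero =>
      obtain ⟨m, hm⟩ := hd
      obtain ⟨y, hy0, hy⟩ := exists_ordAt_eq (p := p) m
      have h1 : v (α / y ^ ℓ) = 1 := by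
        rw [hv, valuation_eq_exp_ordAt p (div_ne_zero hα (pow_ne_zero _ hy0)),
          ordAt_div p hα (pow_ne_zero _ hy0), ordAt_pow, hy, hm, sub_self, neg_zero,
          WithZero.exp_zero]
      refine ⟨y, hy0, h1, ?_⟩
      simp only [Nat.cast_zero, neg_zero, WithZero.exp_zero]
      refine (Valuation.map_sub _ _ _).trans ?_
      rw [h1, map_one, max_self]
    | succ n ih =>
      obtain ⟨y, hy0, hu, hn⟩ := ih
      set u := α / y ^ ℓ with hu'
      have hlt : v l ^ ℓ < v (u - 1) := by
        by_contra h
        exact hcon ⟨y, hy0, hu, Or.inl (not_lt.1 h)⟩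
      have ha0 : u - 1 ≠ 0 := by
        intro h; rw [h, map_zero] at hlt; exact not_lt_zero hlt
      have hdvd : (ℓ : ℤ) ∣ ordAt p (u - 1) := by
        by_contra h
        exact hcon ⟨y, hy0, hu, Or.inr ⟨h, hlt⟩⟩
      obtain ⟨m, hm⟩ := hdvd
      obtain ⟨π, hπ0, hπ⟩ := exists_ordAt_eq (p := p) m
      have hπa : v π ^ ℓ = v (u - 1) := by
        rw [← map_pow, hv, valuation_eq_exp_ordAt p (pow_ne_zero _ hπ0),
          valuation_eq_exp_ordAt p ha0, ordAt_pow, hπ, hm]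
      have ha1 : v (u - 1) ≤ 1 := by
        refine hn.trans ?_
        rw [← WithZero.exp_zero, WithZero.exp_le_exp]; omega
      have hπ1 : v π ≤ 1 := by
        rwa [← pow_le_one_iff_of_nonneg zero_le hℓ.ne_zero, hπa]
      have hlπ : v l < v π := by
        by_contra h
        rw [← hπa] at hlt
        exact absurd hlt (not_lt.2 (pow_le_pow_left₀ zero_le (not_lt.1 h) _))
      have hvπ0 : 0 < v π := zero_lt_iff.2 ((Valuation.ne_zero_iff _).2 hπ0)
      have hua : v ((u - 1) / π ^ ℓ) = 1 := by
        rw [map_div₀, map_pow, hπa, div_self ((Valuation.ne_zero_iff _).2 ha0)]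
      obtain ⟨w, hw1, hw⟩ := exists_pow_sub_valuation_lt hℓ hp hua.le
      have hwπ : w * π ∈ v.valuationSubring := by
        rw [Valuation.mem_valuationSubring_iff, map_mul]
        exact mul_le_one' hw1 hπ1
      obtain ⟨r, hr⟩ := exists_add_pow_prime_eq hℓ (1 : v.valuationSubring) ⟨_, hwπ⟩
      have hr' : (1 + w * π) ^ ℓ = 1 ^ ℓ + (w * π) ^ ℓ + ℓ * 1 * (w * π) * (r : K) := by
        simpa using congrArg Subtype.val hr
      have hlast : v ((1 + w * π) ^ ℓ - u) < v (u - 1) := by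
        have e : (1 + w * π) ^ ℓ - u =
            (w ^ ℓ - (u - 1) / π ^ ℓ) * π ^ ℓ + ℓ * (w * π) * r := by
          rw [hr', sub_mul, div_mul_cancel₀ _ (pow_ne_zero _ hπ0)]; ring
        rw [e]
        refine Valuation.map_add_lt _ ?_ ?_
        · rw [map_mul, map_pow, hπa]
          exact mul_lt_of_lt_one_left (hπa ▸ pow_pos hvπ0 _) hw
        · rw [map_mul, map_mul, map_mul, ← hl, ← hπa]
          have h1 : v (r : K) ≤ 1 := r.2
          calc v l ^ (ℓ - 1) * (v w * v π) * v (r : K)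
              ≤ v l ^ (ℓ - 1) * (1 * v π) * 1 := by gcongr
            _ = v l ^ (ℓ - 1) * v π := by simp
            _ < v π ^ (ℓ - 1) * v π :=
              mul_lt_mul_of_pos_right (pow_lt_pow_left₀ hlπ zero_le
                (by have := hℓ.two_le; omega)) hvπ0
            _ = v π ^ ℓ := by rw [← pow_succ, Nat.sub_add_cancel hℓ.one_le]
      have hz1 : v ((1 + w * π) ^ ℓ) = 1 := by
        have := Valuation.map_eq_of_sub_lt v (x := u) (y := (1 + w * π) ^ ℓ)
          (by rw [hu]; exact hlast.trans_le ha1)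
        rw [this, hu]
      have hz0 : (1 + w * π) ^ ℓ ≠ 0 := by
        rw [← Valuation.ne_zero_iff v, hz1]; exact one_ne_zero
      have hdiv : α / (y * (1 + w * π)) ^ ℓ = u / (1 + w * π) ^ ℓ := by
        rw [mul_pow, hu', div_div]
      refine ⟨y * (1 + w * π), mul_ne_zero hy0 (fun h => hz0 (by rw [h, zero_pow hℓ.ne_zero])),
        ?_, ?_⟩
      · rw [hdiv, map_div₀, hz1, hu, div_one]
      · rw [hdiv]
        have e : u / (1 + w * π) ^ ℓ - 1 = -((1 + w * π) ^ ℓ - u) / (1 + w * π) ^ ℓ := by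
          rw [neg_sub, sub_div, div_self hz0]
        rw [e, map_div₀, hz1, Valuation.map_neg, div_one]
        have h2 := hlast.trans_le hn
        have h3 : (WithZero.exp (-(n : ℤ)) : WithZero (Multiplicative ℤ)) =
            WithZero.exp (-((n + 1 : ℕ) : ℤ)) * WithZero.exp 1 := by
          rw [← WithZero.exp_add]; congr 1; push_cast; ring
        rw [h3] at h2
        exact (WithZero.lt_mul_exp_iff_le WithZero.exp_ne_zero).1 h2
  obtain ⟨y, hy0, hu, hn⟩ := key (ordAt p (l ^ ℓ)).toNat
  refine hcon ⟨y, hy0, hu, Or.inl (hn.trans ?_)⟩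
  rw [← map_pow, hv, valuation_eq_exp_ordAt p (pow_ne_zero _ hl0), WithZero.exp_le_exp]
  have := Int.self_le_toNat (ordAt p (l ^ ℓ))
  omega

end KummerOrders

section KummerInvariants
open IsDedekindDomain NumberField HeightOneSpectrum
open scoped nonZeroDivisors

theorem two_mul_sum_ediv {ℓ : ℕ} (hℓ : ℓ.Prime) {n : ℤ} (hn : ¬ (ℓ : ℤ) ∣ n) :
    2 * ∑ j : Fin ℓ, (((j : ℕ) : ℤ) * n) / (ℓ : ℤ) = (ℓ - 1) * (n - 1) := by
  rw [Fin.sum_univ_eq_sum_range (fun j => ((j : ℤ) * n) / (ℓ : ℤ)) ℓ]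
  obtain ⟨k, rfl⟩ : ∃ k, ℓ = k + 1 := ⟨ℓ - 1, by have := hℓ.pos; omega⟩
  have hk : (0 : ℤ) < ((k + 1 : ℕ) : ℤ) := by positivity
  rw [Finset.sum_range_succ', two_mul]
  simp only [Nat.cast_zero, zero_mul, Int.zero_ediv, add_zero]
  conv_lhs => arg 2; rw [← Finset.sum_range_reflect]
  rw [← Finset.sum_add_distrib, Finset.sum_congr rfl (g := fun _ => n - 1)]
  · rw [Finset.sum_const, Finset.card_range, nsmul_eq_mul]
    push_cast; ring
  intro j hj
  have hj := Finset.mem_range.1 hj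
  set q : ℤ := ((k + 1 : ℕ) : ℤ) with hq
  have hc : ((k - 1 - j + 1 : ℕ) : ℤ) * n = -(((j + 1 : ℕ) : ℤ) * n) + n * q := by
    have : ((k - 1 - j + 1 : ℕ) : ℤ) = q - ((j + 1 : ℕ) : ℤ) := by
      rw [hq]; omega
    rw [this]; ring
  rw [hc, Int.add_mul_ediv_right _ _ hk.ne']
  have hnd : ¬ q ∣ ((j + 1 : ℕ) : ℤ) * n := by
    intro h
    rcases (Nat.prime_iff_prime_int.1 hℓ).dvd_or_dvd h with h | h
    · have := Nat.le_of_dvd (by omega) (Int.natCast_dvd_natCast.1 h)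
      omega
    · exact hn h
  set a := ((j + 1 : ℕ) : ℤ) * n
  have h1 := Int.mul_ediv_add_emod a q
  have h2 := Int.emod_nonneg a hk.ne'
  have h3 := Int.emod_lt_of_pos a hk
  have h4 : a % q ≠ 0 := fun h => hnd (Int.dvd_of_emod_eq_zero h)
  have : (-a) / q = - (a / q) - 1 := by
    rw [Int.ediv_eq_iff_of_pos hk]
    constructor
    · nlinarith [lt_of_le_of_ne h2 h4.symm]
    · nlinarith [lt_of_le_of_ne h2 h4.symm]
  rw [this]; ring

theorem sum_ediv_of_dvd {ℓ : ℕ} (hℓ : ℓ ≠ 0) (m : ℤ) :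
    ∑ j : Fin ℓ, (((j : ℕ) : ℤ) * (ℓ * m)) / (ℓ : ℤ) = ℓ.choose 2 * m := by
  have h1 : ∀ j : Fin ℓ, (((j : ℕ) : ℤ) * (ℓ * m)) / (ℓ : ℤ) = ((j : ℕ) : ℤ) * m := by
    intro j
    rw [mul_left_comm, Int.mul_ediv_cancel_left _ (by exact_mod_cast hℓ)]
  simp only [h1]
  rw [← Finset.sum_mul, Fin.sum_univ_eq_sum_range (fun j => (j : ℤ)) ℓ, ← Nat.cast_sum,
    Finset.sum_range_id, Nat.choose_two_right]

theorem two_mul_choose_two (ℓ : ℕ) : 2 * ((ℓ.choose 2 : ℕ) : ℤ) = ℓ * (ℓ - 1) := by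
  have h := congrArg (Nat.cast : ℕ → ℤ) (Finset.sum_range_id_mul_two ℓ)
  rw [Finset.sum_range_id, ← Nat.choose_two_right] at h
  rcases ℓ with _ | k
  · simp
  push_cast at h ⊢
  simpa [mul_comm] using h

variable {K L : Type*} [Field K] [NumberField K] [Field L] [NumberField L] [Algebra K L]
variable {p : HeightOneSpectrum (𝓞 K)}

theorem exists_basis_of_det {n : ℕ} (b : Module.Basis (Fin n) K L) (x : Fin n → L)
    (hx : b.det x ≠ 0) : ∃ e : Module.Basis (Fin n) K L, ⇑e = x := by
  obtain ⟨h1, h2⟩ := b.is_basis_iff_det.2 (isUnit_iff_ne_zero.2 hx)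
  exact ⟨Module.Basis.mk h1 h2.ge, Module.Basis.coe_mk _ _⟩

theorem ordAt_natCast_eq {ℓ : ℕ} {l : K}
    (hl : p.valuation K l ^ (ℓ - 1) = p.valuation K (ℓ : K)) :
    ordAt p (ℓ : K) = ((ℓ - 1 : ℕ) : ℤ) * ordAt p l := by
  rw [← ordAt_pow, ordAt, ordAt, map_pow, hl]

theorem ordAt_eq_of_valuation {x y : K} (h : p.valuation K x = p.valuation K y) :
    ordAt p x = ordAt p y := by rw [ordAt, ordAt, h]

theorem ordAt_eq_zero_of_valuation {x : K} (h : p.valuation K x = 1) : ordAt p x = 0 := by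
  rw [ordAt, h, WithZero.log_one, neg_zero]

/-- A generator whose affine transform is integral with unit discriminant. -/
theorem isLeast_detOrders_of_affine {ℓ : ℕ} (hℓ : ℓ.Prime) (b : Module.Basis (Fin ℓ) K L)
    {θ : L} (hb : ∀ j, b j = θ ^ (j : ℕ)) {α : K} (hα : α ≠ 0) (hθ : θ ^ ℓ = algebraMap K L α)
    {r s : K} (hr : r ≠ 0) (hintegral : LocallyIntegral p (r • θ + algebraMap K L s))
    (hord : ℓ * ordAt p (ℓ : K) + (ℓ - 1) * ordAt p α + ℓ * (ℓ - 1) * ordAt p r = 0) :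
    IsLeast (detOrders p b) (ℓ.choose 2 * ordAt p r) := by
  have hdet := det_affine_pow b hb r s
  obtain ⟨e, he⟩ := exists_basis_of_det b _ (by rw [hdet]; exact pow_ne_zero _ hr)
  have h0 : IsLeast (detOrders p e) 0 := by
    refine isLeast_detOrders_of_discr e (fun j => ?_) ?_
    · rw [he]; exact hintegral.pow _
    · rw [discr_eq_det_sq_mul b, he, hdet, ordAt_mul p (pow_ne_zero _ (pow_ne_zero _ hr))
        (Algebra.discr_not_zero_of_basis K b), ordAt_pow, ordAt_pow,
        ordAt_discr_kummer hℓ b hb hα hθ]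
      have := two_mul_choose_two ℓ
      push_cast
      linear_combination hord + this * ordAt p r
  have := isLeast_detOrders_of_basis (b := b) h0
  rwa [he, hdet, zero_add, ordAt_pow] at this

/-- The local lattice of a Kummer extension at a prime of residue characteristic other
than `ℓ`. -/
theorem isLeast_detOrders_of_tame {ℓ : ℕ} (hℓ : ℓ.Prime) (hp : p.valuation K (ℓ : K) = 1)
    (b : Module.Basis (Fin ℓ) K L) {θ : L} (hb : ∀ j, b j = θ ^ (j : ℕ)) {α : K} (hα : α ≠ 0)
    (hθ : θ ^ ℓ = algebraMap K L α) :
    IsLeast (detOrders p b) (-∑ j : Fin ℓ, ((j : ℕ) * ordAt p α) / ℓ) := by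
  by_cases hd : (ℓ : ℤ) ∣ ordAt p α
  · obtain ⟨m, hm⟩ := hd
    obtain ⟨r, hr0, hr⟩ := exists_ordAt_eq (p := p) (-m)
    rw [hm, sum_ediv_of_dvd hℓ.ne_zero, ← mul_neg, ← hr]
    refine isLeast_detOrders_of_affine hℓ b hb hα hθ hr0 (s := 0) (fun W hW => ?_) ?_
    · rcases hW.eq_top_or with h | h
      · exact h _
      rw [map_zero, add_zero, Algebra.smul_def, ← ValuationSubring.valuation_le_one_iff,
        ← pow_le_one_iff_of_nonneg zero_le hℓ.ne_zero, ← map_pow, mul_pow, hθ, ← map_pow,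
        ← map_mul, ValuationSubring.valuation_le_one_iff, h,
        ← ordAt_nonneg_iff p (mul_ne_zero (pow_ne_zero _ hr0) hα),
        ordAt_mul p (pow_ne_zero _ hr0) hα, ordAt_pow, hr, hm]
      linarith
    · rw [ordAt_eq_zero_of_valuation hp, hm, hr]; ring
  · refine isLeast_detOrders_of_ramified hℓ b hb hα hd fun W hW => ?_
    rw [← map_pow, hθ]

/-- The local lattice of a Kummer extension at a prime above `ℓ` depends only on the generator
up to multiplication by elements sufficiently close to `1`. -/
theorem exists_local_invariant.{u} {K : Type u} [Field K] [NumberField K]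
    {p : HeightOneSpectrum (𝓞 K)} {ℓ : ℕ} (hℓ : ℓ.Prime) {l : K}
    (hl0 : l ≠ 0)
    (hl : p.valuation K l ^ (ℓ - 1) = p.valuation K (ℓ : K))
    (hp : p.valuation K (ℓ : K) < 1) {α : K} (hα : α ≠ 0) :
    ∃ c : ℤ, (∀ k : ℕ, ℓ = 2 * k + 1 → (k : ℤ) ∣ c) ∧
      ∀ x : K, p.valuation K x = 1 → p.valuation K (x - 1) ≤ p.valuation K l ^ ℓ →
        ∀ (L : Type u) [Field L] [NumberField L] [Algebra K L] (b : Module.Basis (Fin ℓ) K L)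
          (θ : L), (∀ j, b j = θ ^ (j : ℕ)) → θ ^ ℓ = algebraMap K L (α * x) →
          IsLeast (detOrders p b) c := by
  have hx0 : ∀ {x : K}, p.valuation K x = 1 → x ≠ 0 := by
    rintro x h rfl
    rw [map_zero] at h
    exact zero_ne_one h
  have hsum : ∀ n : ℤ, ¬ (ℓ : ℤ) ∣ n → ∀ k : ℕ, ℓ = 2 * k + 1 →
      (k : ℤ) ∣ -∑ j : Fin ℓ, ((j : ℕ) * n) / (ℓ : ℤ) := by
    intro n hn k hk
    have h := two_mul_sum_ediv hℓ hn
    refine (dvd_neg).2 ⟨n - 1, ?_⟩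
    have h2 : ((ℓ : ℕ) : ℤ) = 2 * k + 1 := by exact_mod_cast hk
    have h3 : ((ℓ : ℤ) - 1) * (n - 1) = 2 * (k * (n - 1)) := by rw [h2]; ring
    linarith
  have hchoose : ∀ n : ℤ, ∀ k : ℕ, ℓ = 2 * k + 1 → (k : ℤ) ∣ ℓ.choose 2 * n := by
    intro n k hk
    have h := two_mul_choose_two ℓ
    have h2 : ((ℓ : ℕ) : ℤ) = 2 * k + 1 := by exact_mod_cast hk
    refine ⟨ℓ * n, ?_⟩
    have h3 : (ℓ : ℤ) * (ℓ - 1) = 2 * (k * ℓ) := by rw [h2]; ring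
    have h4 : ((ℓ.choose 2 : ℕ) : ℤ) = k * ℓ := by linarith
    rw [h4]; ring
  by_cases hd : (ℓ : ℤ) ∣ ordAt p α
  swap
  · refine ⟨_, hsum _ hd, fun x hx hx1 L _ _ _ b θ hb hθ => ?_⟩
    have hord : ordAt p (α * x) = ordAt p α :=
      ordAt_eq_of_valuation (by rw [map_mul, hx, mul_one])
    rw [← hord] at hd ⊢
    refine isLeast_detOrders_of_ramified hℓ b hb (mul_ne_zero hα (hx0 hx)) hd fun W hW => ?_
    rw [← map_pow, hθ]
  obtain ⟨y, hy0, hu, h⟩ := exists_normalForm hℓ hl0 hl hp hα hd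
  set u := α / y ^ ℓ with hu'
  have hαy : α = u * y ^ ℓ := (div_mul_cancel₀ _ (pow_ne_zero _ hy0)).symm
  have hordα : ordAt p α = ℓ * ordAt p y := by
    rw [hαy, ordAt_mul p (hx0 hu) (pow_ne_zero _ hy0), ordAt_pow,
      ordAt_eq_zero_of_valuation hu, zero_add]
  have hux : ∀ {x : K}, p.valuation K (x - 1) ≤ p.valuation K l ^ ℓ →
      p.valuation K (u * (x - 1)) ≤ p.valuation K l ^ ℓ := by
    intro x hx
    rwa [map_mul, hu, one_mul]
  have hsplit : ∀ x : K, u * x - 1 = u * (x - 1) + (u - 1) := fun x => by ring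
  have hroot : ∀ {L : Type u} [Field L] [Algebra K L] (θ : L) (x : K),
      θ ^ ℓ = algebraMap K L (α * x) →
      ((y⁻¹ • θ + algebraMap K L (-1)) + 1) ^ ℓ = algebraMap K L (u * x) := by
    intro L _ _ θ x hθ
    rw [map_neg, map_one, neg_add_cancel_right, Algebra.smul_def, mul_pow, hθ, ← map_pow,
      ← map_mul, hu', inv_pow]
    congr 1
    field_simp
  rcases h with h | ⟨h, h'⟩
  · refine ⟨_, hchoose (-(ordAt p y + ordAt p l)), fun x hx hx1 L _ _ _ b θ hb hθ => ?_⟩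
    have hr0 : (l⁻¹ * y⁻¹ : K) ≠ 0 := mul_ne_zero (inv_ne_zero hl0) (inv_ne_zero hy0)
    have hr : ordAt p (l⁻¹ * y⁻¹ : K) = -(ordAt p y + ordAt p l) := by
      rw [ordAt_mul p (inv_ne_zero hl0) (inv_ne_zero hy0), ordAt_inv, ordAt_inv]; ring
    rw [← hr]
    have hord : ordAt p (α * x) = ordAt p α :=
      ordAt_eq_of_valuation (by rw [map_mul, hx, mul_one])
    refine isLeast_detOrders_of_affine hℓ b hb (mul_ne_zero hα (hx0 hx)) hθ hr0
      (s := -l⁻¹) (fun W hW => ?_) ?_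
    · rcases hW.eq_top_or with hW | hW
      · exact hW _
      have e : (l⁻¹ * y⁻¹) • θ + algebraMap K L (-l⁻¹) =
          (algebraMap K L l)⁻¹ * (y⁻¹ • θ + algebraMap K L (-1)) := by
        rw [map_neg, map_neg, map_inv₀, map_one, mul_smul, Algebra.smul_def, map_inv₀]; ring
      have hwl : W.valuation (algebraMap K L l) ≠ 0 := by
        rw [Valuation.ne_zero_iff]; exact (map_ne_zero _).2 hl0
      have hmain : W.valuation (y⁻¹ • θ + algebraMap K L (-1)) ≤
          W.valuation (algebraMap K L l) := by
        rcases valuation_sub_one_cases hℓ hl (by rw [map_mul, hu, hx, one_mul])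
          (hroot θ x hθ) hW with h1 | ⟨h1, h2⟩
        · exact h1.1
        · exfalso
          have h3 : p.valuation K (u * x - 1) ≤ p.valuation K (l ^ ℓ) := by
            rw [hsplit, map_pow]
            exact Valuation.map_add_le _ (hux hx1) h
          rw [← valuation_algebraMap_le_iff hW, ← h2, map_pow, map_pow] at h3
          exact absurd h3 (not_le.2 (pow_lt_pow_left₀ h1 zero_le hℓ.ne_zero))
      rw [e, ← ValuationSubring.valuation_le_one_iff, map_mul, map_inv₀]
      calc _ ≤ (W.valuation (algebraMap K L l))⁻¹ * W.valuation (algebraMap K L l) := by gcongr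
        _ = 1 := inv_mul_cancel₀ hwl
    · rw [ordAt_natCast_eq hl, hord, hordα, hr, Nat.cast_sub hℓ.one_le]
      push_cast; ring
  · obtain ⟨c0, hc0⟩ : ∃ c0 : ℤ, c0 = -∑ j : Fin ℓ, ((j : ℕ) * ordAt p (u - 1)) / (ℓ : ℤ) :=
      ⟨_, rfl⟩
    refine ⟨c0 + ℓ.choose 2 * (-ordAt p y), fun k hk => dvd_add (hc0 ▸ hsum _ h k hk)
      (hchoose _ k hk), fun x hx hx1 L _ _ _ b θ hb hθ => ?_⟩
    have hv : p.valuation K (u * x - 1) = p.valuation K (u - 1) := by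
      rw [hsplit]
      exact Valuation.map_add_eq_of_lt_right _ ((hux hx1).trans_lt h')
    have hord := ordAt_eq_of_valuation hv
    have ha0 : u * x - 1 ≠ 0 := by
      rw [← Valuation.ne_zero_iff (p.valuation K), hv]
      exact (zero_le.trans_lt h').ne'
    have hdet := det_affine_pow b hb y⁻¹ (-1)
    obtain ⟨e, he⟩ := exists_basis_of_det b _ (by rw [hdet]; exact pow_ne_zero _ (inv_ne_zero hy0))
    have h0 : IsLeast (detOrders p e) c0 := by
      rw [hc0, ← hord]
      refine isLeast_detOrders_of_ramified hℓ e (ξ := y⁻¹ • θ + algebraMap K L (-1))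
        (fun j => by rw [he]) ha0 (by rwa [hord]) fun W hW => ?_
      rcases valuation_sub_one_cases hℓ hl (by rw [map_mul, hu, hx, one_mul])
          (hroot θ x hθ) hW with h1 | h1
      · exact absurd h1.2 (not_le.2 (hv ▸ h'))
      · exact h1.2
    have := isLeast_detOrders_of_basis (b := b) h0
    rwa [he, hdet, ordAt_pow, ordAt_inv] at this

end KummerInvariants

section RayGroup
open IsDedekindDomain NumberField HeightOneSpectrum
open scoped nonZeroDivisors

variable {K : Type*} [Field K] [NumberField K]

theorem exists_ordAt_eq_natCast (s : Finset (HeightOneSpectrum (𝓞 K)))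
    (n : HeightOneSpectrum (𝓞 K) → ℕ) : ∃ x : Kˣ, ∀ p ∈ s, ordAt p (x : K) = n p := by
  rcases s.eq_empty_or_nonempty with rfl | ⟨p0, hp0⟩
  · exact ⟨1, by simp⟩
  have hex : ∀ p : HeightOneSpectrum (𝓞 K),
      ∃ a : 𝓞 K, a ∈ p.asIdeal ^ n p ∧ a ∉ p.asIdeal ^ (n p + 1) := by
    intro p
    obtain ⟨a, h1, h2⟩ := SetLike.exists_of_lt (Ideal.pow_succ_lt_pow p.ne_bot (n p))
    exact ⟨a, h1, h2⟩
  choose a ha1 ha2 using hex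
  obtain ⟨y, hy⟩ := IsDedekindDomain.exists_forall_sub_mem_ideal (s := s)
    (fun p : HeightOneSpectrum (𝓞 K) => p.asIdeal) (fun p => n p + 1) (fun p _ => p.prime)
    (fun p _ q _ h h' => h (HeightOneSpectrum.ext h')) (fun p => a p)
  have hmem : ∀ p ∈ s, y ∈ p.asIdeal ^ n p ∧ y ∉ p.asIdeal ^ (n p + 1) := by
    intro p hp
    have h1 := hy p hp
    refine ⟨?_, fun h2 => ha2 p ?_⟩
    · have := (p.asIdeal ^ n p).add_mem (Ideal.pow_le_pow_right (Nat.le_succ _) h1) (ha1 p)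
      simpa using this
    · have := (p.asIdeal ^ (n p + 1)).sub_mem h2 h1
      simpa using this
  have hy0 : y ≠ 0 := by
    rintro rfl
    exact (hmem p0 hp0).2 (zero_mem _)
  refine ⟨Units.mk0 (algebraMap (𝓞 K) K y) ?_, fun p hp => ?_⟩
  · rwa [Ne, map_eq_zero_iff _ (FaithfulSMul.algebraMap_injective _ _)]
  have h1 := (le_ordAt_algebraMap_iff (K := K) p hy0 (n p)).2 (hmem p hp).1
  have h2 := (not_iff_not.2 (le_ordAt_algebraMap_iff (K := K) p hy0 (n p + 1))).2 (hmem p hp).2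
  rw [Units.val_mk0]
  push_cast at h2
  omega

theorem exists_forall_ordAt_eq (s : Finset (HeightOneSpectrum (𝓞 K)))
    (n : HeightOneSpectrum (𝓞 K) → ℤ) : ∃ x : Kˣ, ∀ p ∈ s, ordAt p (x : K) = n p := by
  obtain ⟨x, hx⟩ := exists_ordAt_eq_natCast s fun p => (n p).toNat
  obtain ⟨y, hy⟩ := exists_ordAt_eq_natCast s fun p => (-n p).toNat
  refine ⟨x / y, fun p hp => ?_⟩
  rw [Units.val_div_eq_div_val, ordAt_div p x.ne_zero y.ne_zero, hx p hp, hy p hp]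
  omega

variable (K) in
theorem finite_valuation_lt_one {ℓ : ℕ} (hℓ : ℓ ≠ 0) :
    {p : HeightOneSpectrum (𝓞 K) | p.valuation K (ℓ : K) < 1}.Finite := by
  have h := finite_support_ordAt (R := 𝓞 K) (Units.mk0 (ℓ : K) (Nat.cast_ne_zero.2 hℓ))
  refine h.subset fun p hp => ?_
  rw [Set.mem_ofPred_eq] at hp
  intro h0
  rw [Units.val_mk0] at h0
  rw [valuation_eq_exp_ordAt p (Nat.cast_ne_zero.2 hℓ)] at hp
  have h1 : ordAt p (ℓ : K) = 0 := h0
  rw [h1] at hp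
  simp at hp

/-- The finite set of primes above `ℓ`. -/
def wildPrimes (K : Type*) [Field K] [NumberField K] {ℓ : ℕ} (hℓ : ℓ ≠ 0) :
    Finset (HeightOneSpectrum (𝓞 K)) := (finite_valuation_lt_one K hℓ).toFinset

theorem mem_wildPrimes {ℓ : ℕ} (hℓ : ℓ ≠ 0) {p : HeightOneSpectrum (𝓞 K)} :
    p ∈ wildPrimes K hℓ ↔ p.valuation K (ℓ : K) < 1 := by
  simp [wildPrimes]

theorem valuation_natCast_le_one (p : HeightOneSpectrum (𝓞 K)) (ℓ : ℕ) :
    p.valuation K (ℓ : K) ≤ 1 := by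
  have := p.valuation_le_one (K := K) (ℓ : 𝓞 K)
  simpa using this

theorem valuation_natCast_cases (p : HeightOneSpectrum (𝓞 K)) (ℓ : ℕ) :
    p.valuation K (ℓ : K) < 1 ∨ p.valuation K (ℓ : K) = 1 :=
  (valuation_natCast_le_one p ℓ).lt_or_eq

theorem valuation_eq_one_of_sub_lt {p : HeightOneSpectrum (𝓞 K)} {x : K}
    (h : p.valuation K (x - 1) < 1) : p.valuation K x = 1 := by
  have := Valuation.map_eq_of_sub_lt (p.valuation K) (x := 1) (y := x) (by simpa using h)
  rwa [map_one] at this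

theorem valuation_sub_one_lt {p : HeightOneSpectrum (𝓞 K)} {ℓ : ℕ} {x : K}
    (hp : p.valuation K (ℓ : K) < 1) (h : p.valuation K (x - 1) ≤ p.valuation K (ℓ : K) ^ 2) :
    p.valuation K (x - 1) < 1 :=
  h.trans_lt (pow_lt_one₀ zero_le hp two_ne_zero)

/-- The elements congruent to `1` modulo `ℓ²` at all primes above `ℓ`. -/
def rayUnits (K : Type*) [Field K] [NumberField K] (ℓ : ℕ) : Subgroup Kˣ where
  carrier := {x | ∀ p : HeightOneSpectrum (𝓞 K), p.valuation K (ℓ : K) < 1 →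
    p.valuation K ((x : K) - 1) ≤ p.valuation K (ℓ : K) ^ 2}
  one_mem' := by
    intro p _
    simp
  mul_mem' := by
    intro x y hx hy p hp
    have hvx := valuation_eq_one_of_sub_lt (valuation_sub_one_lt hp (hx p hp))
    have e : ((x * y : Kˣ) : K) - 1 = x * ((y : K) - 1) + ((x : K) - 1) := by
      rw [Units.val_mul]; ring
    rw [e]
    refine Valuation.map_add_le _ ?_ (hx p hp)
    rw [map_mul, hvx, one_mul]
    exact hy p hp
  inv_mem' := by
    intro x hx p hp
    have hvx := valuation_eq_one_of_sub_lt (valuation_sub_one_lt hp (hx p hp))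
    have e : ((x⁻¹ : Kˣ) : K) - 1 = -(((x : K) - 1) / x) := by
      rw [Units.val_inv_eq_inv_val, sub_div, div_self x.ne_zero]; ring
    rw [e, Valuation.map_neg, map_div₀, hvx, div_one]
    exact hx p hp

theorem valuation_eq_one_of_mem_rayUnits {ℓ : ℕ} {x : Kˣ} (hx : x ∈ rayUnits K ℓ)
    {p : HeightOneSpectrum (𝓞 K)} (hp : p.valuation K (ℓ : K) < 1) :
    p.valuation K (x : K) = 1 :=
  valuation_eq_one_of_sub_lt (valuation_sub_one_lt hp (hx p hp))

/-- A local unit has finitely many residues modulo `ℓ²`. -/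
theorem exists_residue_map {ℓ : ℕ} (hℓ : ℓ ≠ 0) (p : HeightOneSpectrum (𝓞 K)) :
    ∃ f : K → 𝓞 K ⧸ Ideal.span {((ℓ : 𝓞 K) ^ 2)}, ∀ x y : K, p.valuation K x ≤ 1 →
      p.valuation K y ≤ 1 → f x = f y → p.valuation K (x - y) ≤ p.valuation K (ℓ : K) ^ 2 := by
  have hv0 : p.valuation K (ℓ : K) ^ 2 ≠ 0 :=
    pow_ne_zero _ ((Valuation.ne_zero_iff _).2 (Nat.cast_ne_zero.2 hℓ))
  have hex : ∀ x : K, ∃ a : 𝓞 K, p.valuation K x ≤ 1 →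
      p.valuation K (algebraMap (𝓞 K) K a - x) ≤ p.valuation K (ℓ : K) ^ 2 := by
    intro x
    by_cases hx : p.valuation K x ≤ 1
    · obtain ⟨a, ha⟩ := p.exists_valuation_sub_lt_of_integer hx (Units.mk0 _ hv0)
      exact ⟨a, fun _ => ha.le⟩
    · exact ⟨0, fun h => absurd h hx⟩
  choose a ha using hex
  refine ⟨fun x => Ideal.Quotient.mk _ (a x), fun x y hx hy hxy => ?_⟩
  rw [Ideal.Quotient.eq, Ideal.mem_span_singleton] at hxy
  obtain ⟨c, hc⟩ := hxy
  have h1 : p.valuation K (algebraMap (𝓞 K) K (a x - a y)) ≤ p.valuation K (ℓ : K) ^ 2 := by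
    rw [hc, map_mul, map_mul, map_pow, map_natCast, map_pow]
    exact mul_le_of_le_one_right' (p.valuation_le_one c)
  have e : x - y = (-(algebraMap (𝓞 K) K (a x) - x) + algebraMap (𝓞 K) K (a x - a y)) +
      (algebraMap (𝓞 K) K (a y) - y) := by rw [map_sub]; ring
  rw [e]
  refine Valuation.map_add_le _ (Valuation.map_add_le _ ?_ h1) (ha y hy)
  rw [Valuation.map_neg]
  exact ha x hx

/-- The elements prime to `ℓ` have finite index modulo the ray. -/
theorem exists_finite_ray_map.{u} {K : Type u} [Field K] [NumberField K] {ℓ : ℕ} (hℓ : ℓ ≠ 0) :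
    ∃ (F : Type u) (_ : Finite F) (f : Kˣ → F),
    ∀ x y : Kˣ, (∀ p ∈ wildPrimes K hℓ, p.valuation K (x : K) = 1) →
      (∀ p ∈ wildPrimes K hℓ, p.valuation K (y : K) = 1) → f x = f y →
      x / y ∈ rayUnits K ℓ := by
  choose f hf using fun p : HeightOneSpectrum (𝓞 K) => exists_residue_map (K := K) hℓ p
  have hne : Ideal.span {((ℓ : 𝓞 K) ^ 2)} ≠ ⊥ := by
    simpa using hℓ
  have : Finite (𝓞 K ⧸ Ideal.span {((ℓ : 𝓞 K) ^ 2)}) := Ideal.finiteQuotientOfFreeOfNeBot _ hne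
  refine ⟨wildPrimes K hℓ → 𝓞 K ⧸ Ideal.span {((ℓ : 𝓞 K) ^ 2)}, inferInstance,
    fun x p => f p x, fun x y hx hy hxy p hp => ?_⟩
  have hp' := (mem_wildPrimes hℓ).2 hp
  have h := hf p x y (hx p hp').le (hy p hp').le (congrFun hxy ⟨p, hp'⟩)
  have e : ((x / y : Kˣ) : K) - 1 = ((x : K) - y) / y := by
    rw [Units.val_div_eq_div_val, sub_div, div_self y.ne_zero]
  rw [e, map_div₀, hy p hp', div_one]
  exact h

/-- The subgroup of products of ray elements and `ℓ`-th powers. -/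
def rayPowers (K : Type*) [Field K] [NumberField K] (ℓ : ℕ) : Subgroup Kˣ :=
  rayUnits K ℓ ⊔ (powMonoidHom ℓ : Kˣ →* Kˣ).range

theorem mem_rayPowers {ℓ : ℕ} {x : Kˣ} :
    x ∈ rayPowers K ℓ ↔ ∃ y ∈ rayUnits K ℓ, ∃ t : Kˣ, x = y * t ^ ℓ := by
  rw [rayPowers, Subgroup.mem_sup]
  constructor
  · rintro ⟨y, hy, z, ⟨t, rfl⟩, rfl⟩
    exact ⟨y, hy, t, rfl⟩
  · rintro ⟨y, hy, t, rfl⟩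
    exact ⟨y, hy, _, ⟨t, rfl⟩, rfl⟩

theorem finite_of_map {A : Type*} [CommGroup A] (H : Subgroup A) {F : Type*} [Finite F] (f : A → F)
    (hf : ∀ x y, f x = f y → x / y ∈ H) : Finite (A ⧸ H) := by
  refine Finite.of_injective (fun q : A ⧸ H => f q.out) fun q r h => ?_
  have := hf _ _ h.symm
  rw [← QuotientGroup.out_eq' q, ← QuotientGroup.out_eq' r]
  rw [QuotientGroup.eq]
  rwa [div_eq_inv_mul, mul_comm, mul_comm] at this

theorem finite_quotient_rayPowers {ℓ : ℕ} (hℓ : ℓ ≠ 0) : Finite (Kˣ ⧸ rayPowers K ℓ) := by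
  have : NeZero ℓ := ⟨hℓ⟩
  have hdec : ∀ r : wildPrimes K hℓ → ZMod ℓ, ∃ t : Kˣ, ∀ x : Kˣ,
      (∀ p : wildPrimes K hℓ, ((ordAt (p : HeightOneSpectrum (𝓞 K)) (x : K) : ℤ) : ZMod ℓ) = r p) →
      ∃ a : Kˣ, ∀ p ∈ wildPrimes K hℓ, p.valuation K ((x / t / a ^ ℓ : Kˣ) : K) = 1 := by
    intro r
    by_cases hr : ∃ t : Kˣ, ∀ p : wildPrimes K hℓ,
        ((ordAt (p : HeightOneSpectrum (𝓞 K)) (t : K) : ℤ) : ZMod ℓ) = r p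
    swap
    · exact ⟨1, fun x hx => absurd ⟨x, hx⟩ hr⟩
    obtain ⟨t, ht⟩ := hr
    refine ⟨t, fun x hx => ?_⟩
    obtain ⟨a, ha⟩ := exists_forall_ordAt_eq (wildPrimes K hℓ)
      (fun p => ordAt p ((x / t : Kˣ) : K) / (ℓ : ℤ))
    refine ⟨a, fun p hp => ?_⟩
    have hd : (ℓ : ℤ) ∣ ordAt p ((x / t : Kˣ) : K) := by
      rw [← ZMod.intCast_zmod_eq_zero_iff_dvd, Units.val_div_eq_div_val,
        ordAt_div p x.ne_zero t.ne_zero, Int.cast_sub, hx ⟨p, hp⟩, ht ⟨p, hp⟩, sub_self]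
    rw [valuation_eq_exp_ordAt p (Units.ne_zero _), Units.val_div_eq_div_val,
      ordAt_div p (Units.ne_zero _) (Units.ne_zero _), Units.val_pow_eq_pow_val, ordAt_pow,
      ha p hp, Int.mul_ediv_cancel' hd, sub_self, neg_zero, WithZero.exp_zero]
  choose t ht using hdec
  let r : Kˣ → (wildPrimes K hℓ → ZMod ℓ) := fun x p =>
    ((ordAt (p : HeightOneSpectrum (𝓞 K)) (x : K) : ℤ) : ZMod ℓ)
  have hex : ∀ x : Kˣ, ∃ a : Kˣ, ∀ p ∈ wildPrimes K hℓ,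
      p.valuation K ((x / t (r x) / a ^ ℓ : Kˣ) : K) = 1 := fun x => ht (r x) x fun p => rfl
  choose a ha using hex
  obtain ⟨F, hF, f, hf⟩ := exists_finite_ray_map (K := K) hℓ
  refine finite_of_map _ (fun x => (r x, f (x / t (r x) / a x ^ ℓ))) fun x y hxy => ?_
  obtain ⟨h1, h2⟩ := Prod.mk.inj hxy
  have h3 := hf _ _ (ha x) (ha y) h2
  refine mem_rayPowers.2 ⟨_, h3, a x / a y, ?_⟩
  rw [h1]
  ext
  push_cast
  rw [div_pow]
  field_simp

end RayGroup

section RayClassGroup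
open IsDedekindDomain NumberField HeightOneSpectrum
open scoped nonZeroDivisors

variable {K : Type*} [Field K] [NumberField K] {ℓ : ℕ}

/-- The primes not dividing `ℓ`. -/
abbrev TamePrime (K : Type*) [Field K] [NumberField K] (ℓ : ℕ) :=
  {p : HeightOneSpectrum (𝓞 K) // p.valuation K (ℓ : K) = 1}

/-- Divisors supported on the primes not dividing `ℓ`, seen as divisors. -/
def extDiv : (TamePrime K ℓ →₀ ℤ) →+ (HeightOneSpectrum (𝓞 K) →₀ ℤ) :=
  Finsupp.mapDomain.addMonoidHom Subtype.val

/-- Effective divisors supported on the primes not dividing `ℓ`, seen as divisors. -/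
def extNat : (TamePrime K ℓ →₀ ℕ) →+ (HeightOneSpectrum (𝓞 K) →₀ ℕ) :=
  Finsupp.mapDomain.addMonoidHom Subtype.val

theorem extDiv_apply_tame (n : TamePrime K ℓ →₀ ℤ) (p : TamePrime K ℓ) :
    extDiv n (p : HeightOneSpectrum (𝓞 K)) = n p :=
  Finsupp.mapDomain_apply Subtype.val_injective _ _

theorem extDiv_apply_wild (n : TamePrime K ℓ →₀ ℤ) {p : HeightOneSpectrum (𝓞 K)}
    (hp : p.valuation K (ℓ : K) < 1) : extDiv n p = 0 := by
  refine Finsupp.mapDomain_of_notMem_range _ _ ?_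
  rintro ⟨q, rfl⟩
  exact hp.ne q.2

theorem extNat_apply_tame (n : TamePrime K ℓ →₀ ℕ) (p : TamePrime K ℓ) :
    extNat n (p : HeightOneSpectrum (𝓞 K)) = n p :=
  Finsupp.mapDomain_apply Subtype.val_injective _ _

theorem extNat_apply_wild (n : TamePrime K ℓ →₀ ℕ) {p : HeightOneSpectrum (𝓞 K)}
    (hp : p.valuation K (ℓ : K) < 1) : extNat n p = 0 := by
  refine Finsupp.mapDomain_of_notMem_range _ _ ?_
  rintro ⟨q, rfl⟩
  exact hp.ne q.2

variable (ℓ) in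
/-- The part prime to `ℓ` of the divisor of `x`. -/
def tameDiv (x : Kˣ) : TamePrime K ℓ →₀ ℤ := (prinDiv x).subtypeDomain _

@[simp]
theorem tameDiv_apply (x : Kˣ) (p : TamePrime K ℓ) :
    tameDiv ℓ x p = ordAt (p : HeightOneSpectrum (𝓞 K)) (x : K) := rfl

theorem tameDiv_mul (x y : Kˣ) : tameDiv ℓ (x * y) = tameDiv ℓ x + tameDiv ℓ y := by
  ext p
  simp [ordAt_mul]

theorem tameDiv_one : tameDiv ℓ (1 : Kˣ) = 0 := by
  ext p
  simp [ordAt_one]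

theorem tameDiv_inv (x : Kˣ) : tameDiv ℓ x⁻¹ = - tameDiv ℓ x := by
  ext p
  simp [ordAt_inv]

theorem tameDiv_div (x y : Kˣ) : tameDiv ℓ (x / y) = tameDiv ℓ x - tameDiv ℓ y := by
  rw [div_eq_mul_inv, tameDiv_mul, tameDiv_inv, sub_eq_add_neg]

theorem tameDiv_pow (x : Kˣ) (n : ℕ) : tameDiv ℓ (x ^ n) = n • tameDiv ℓ x := by
  ext p
  simp [ordAt_pow]

theorem ordAt_eq_zero_of_mem_rayUnits {x : Kˣ} (hx : x ∈ rayUnits K ℓ)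
    {p : HeightOneSpectrum (𝓞 K)} (hp : p.valuation K (ℓ : K) < 1) : ordAt p (x : K) = 0 :=
  ordAt_eq_zero_of_valuation (valuation_eq_one_of_mem_rayUnits hx hp)

theorem extDiv_tameDiv_of_forall {x : Kˣ} (hx : ∀ p : HeightOneSpectrum (𝓞 K),
    p.valuation K (ℓ : K) < 1 → ordAt p (x : K) = 0) : extDiv (tameDiv ℓ x) = prinDiv x := by
  ext p
  rcases valuation_natCast_cases p ℓ with hp | hp
  · rw [extDiv_apply_wild _ hp, prinDiv_apply, hx p hp]
  · rw [extDiv_apply_tame _ ⟨p, hp⟩]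
    rfl

theorem extDiv_tameDiv {x : Kˣ} (hx : x ∈ rayUnits K ℓ) : extDiv (tameDiv ℓ x) = prinDiv x :=
  extDiv_tameDiv_of_forall fun _ hp => ordAt_eq_zero_of_mem_rayUnits hx hp

/-- Divisors of elements of the ray modulo `ℓ²`. -/
def rayPrincipal (K : Type*) [Field K] [NumberField K] (ℓ : ℕ) :
    AddSubgroup (TamePrime K ℓ →₀ ℤ) where
  carrier := {n | ∃ x ∈ rayUnits K ℓ, tameDiv ℓ x = n}
  zero_mem' := ⟨1, one_mem _, tameDiv_one⟩
  add_mem' := by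
    rintro _ _ ⟨x, hx, rfl⟩ ⟨y, hy, rfl⟩
    exact ⟨x * y, mul_mem hx hy, tameDiv_mul x y⟩
  neg_mem' := by
    rintro _ ⟨x, hx, rfl⟩
    exact ⟨x⁻¹, inv_mem hx, tameDiv_inv x⟩

theorem mem_rayPrincipal {n : TamePrime K ℓ →₀ ℤ} :
    n ∈ rayPrincipal K ℓ ↔ ∃ x ∈ rayUnits K ℓ, tameDiv ℓ x = n := Iff.rfl

/-- The ray class group modulo `ℓ²`. -/
abbrev RayGroup (K : Type*) [Field K] [NumberField K] (ℓ : ℕ) :=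
  (TamePrime K ℓ →₀ ℤ) ⧸ rayPrincipal K ℓ

/-- The ray class of a divisor prime to `ℓ`. -/
def rayClass : (TamePrime K ℓ →₀ ℤ) →+ RayGroup K ℓ := QuotientAddGroup.mk' _

theorem rayClass_surjective : Function.Surjective (rayClass : _ →+ RayGroup K ℓ) :=
  QuotientAddGroup.mk'_surjective _

theorem rayClass_eq_zero_iff {n : TamePrime K ℓ →₀ ℤ} :
    rayClass n = 0 ↔ ∃ x ∈ rayUnits K ℓ, tameDiv ℓ x = n := by
  rw [← mem_rayPrincipal]
  exact QuotientAddGroup.eq_zero_iff n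

/-- The map from ray classes to ideal classes. -/
def rayToClass : RayGroup K ℓ →+ Additive (ClassGroup (𝓞 K)) :=
  QuotientAddGroup.lift _ (divClass.comp extDiv) <| by
    rintro _ ⟨x, hx, rfl⟩
    rw [AddMonoidHom.mem_ker, AddMonoidHom.comp_apply, extDiv_tameDiv hx, divClass_prinDiv]

theorem rayToClass_rayClass (n : TamePrime K ℓ →₀ ℤ) :
    rayToClass (rayClass n) = divClass (extDiv n) := rfl

theorem exists_tame_divClass_eq (hℓ : ℓ ≠ 0) (c : Additive (ClassGroup (𝓞 K))) :
    ∃ n : TamePrime K ℓ →₀ ℤ, divClass (extDiv n) = c := by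
  obtain ⟨I, hI⟩ := ClassGroup.mk0_surjective c.toMul
  obtain ⟨x, hx⟩ := exists_forall_ordAt_eq (wildPrimes K hℓ) (natDiv (idealDiv I))
  refine ⟨(natDiv (idealDiv I) - prinDiv x).subtypeDomain _, ?_⟩
  have e : extDiv (ℓ := ℓ) ((natDiv (idealDiv I) - prinDiv x).subtypeDomain _) =
      natDiv (idealDiv I) - prinDiv x := by
    ext p
    rcases valuation_natCast_cases p ℓ with hp | hp
    · rw [extDiv_apply_wild _ hp, Finsupp.sub_apply, prinDiv_apply,
        hx p ((mem_wildPrimes hℓ).2 hp), sub_self]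
    · rw [extDiv_apply_tame _ ⟨p, hp⟩]
      rfl
  rw [e, map_sub, divClass_prinDiv, sub_zero, divClass_idealDiv, hI]
  rfl

theorem rayToClass_surjective (hℓ : ℓ ≠ 0) :
    Function.Surjective (rayToClass : RayGroup K ℓ →+ _) := fun c => by
  obtain ⟨n, hn⟩ := exists_tame_divClass_eq hℓ c
  exact ⟨rayClass n, hn⟩

theorem finite_rayGroup (hℓ : ℓ ≠ 0) : Finite (RayGroup K ℓ) := by
  choose t ht using exists_tame_divClass_eq (K := K) hℓ
  have hex : ∀ n : TamePrime K ℓ →₀ ℤ, ∃ x : Kˣ,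
      prinDiv x = extDiv (n - t (divClass (extDiv n))) := by
    intro n
    refine exists_prinDiv_eq K ?_
    rw [map_sub, map_sub, ht, sub_self]
  choose x hx using hex
  obtain ⟨F, hF, f, hf⟩ := exists_finite_ray_map (K := K) hℓ
  have hF' : Finite (Additive (ClassGroup (𝓞 K)) × F) :=
    have : Finite (Additive (ClassGroup (𝓞 K))) := inferInstanceAs (Finite (ClassGroup (𝓞 K)))
    inferInstance
  have h1 : ∀ n, ∀ p ∈ wildPrimes K hℓ, p.valuation K (x n : K) = 1 := by
    intro n p hp
    have h2 := DFunLike.congr_fun (hx n) p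
    rw [extDiv_apply_wild _ ((mem_wildPrimes hℓ).1 hp), prinDiv_apply] at h2
    rw [valuation_eq_exp_ordAt p (Units.ne_zero _), h2, neg_zero, WithZero.exp_zero]
  refine Finite.of_injective
    (fun q : RayGroup K ℓ => (divClass (extDiv q.out), f (x q.out))) fun q r h => ?_
  obtain ⟨h2, h3⟩ := Prod.mk.inj h
  have h4 := hf _ _ (h1 _) (h1 _) h3
  rw [← QuotientAddGroup.out_eq' q, ← QuotientAddGroup.out_eq' r, ← sub_eq_zero]
  have h5 : rayClass (q.out - r.out) = (0 : RayGroup K ℓ) := by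
    refine rayClass_eq_zero_iff.2 ⟨_, h4, ?_⟩
    ext p
    have e1 := DFunLike.congr_fun (hx q.out) p.1
    have e2 := DFunLike.congr_fun (hx r.out) p.1
    rw [extDiv_apply_tame, prinDiv_apply, Finsupp.sub_apply] at e1 e2
    rw [tameDiv_div, Finsupp.sub_apply, tameDiv_apply, tameDiv_apply, e1, e2, Finsupp.sub_apply, h2]
    ring
  exact h5

end RayClassGroup

section RayEquidistribution
open IsDedekindDomain NumberField HeightOneSpectrum
open scoped nonZeroDivisors

variable {K : Type*} [Field K] [NumberField K] {ℓ : ℕ}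

/-- The norm of a prime not dividing `ℓ`. -/
def tameNorm (p : TamePrime K ℓ) : ℕ := Ideal.absNorm p.1.asIdeal

theorem two_le_tameNorm (p : TamePrime K ℓ) : 2 ≤ tameNorm p := by
  have h0 : tameNorm p ≠ 0 := by
    rw [tameNorm, Ne, Ideal.absNorm_eq_zero_iff]
    exact p.1.ne_bot
  have h1 : tameNorm p ≠ 1 := by
    rw [tameNorm, Ne, Ideal.absNorm_eq_one_iff]
    exact p.1.isPrime.ne_top
  omega

/-- The ideal of an effective divisor prime to `ℓ`. -/
def tameIdeal (m : TamePrime K ℓ →₀ ℕ) : Ideal (𝓞 K) := divIdeal (extNat m)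

theorem tameIdeal_ne_bot (m : TamePrime K ℓ →₀ ℕ) : tameIdeal m ≠ ⊥ := divIdeal_ne_bot _

theorem multiplicity_tameIdeal (m : TamePrime K ℓ →₀ ℕ) (p : HeightOneSpectrum (𝓞 K)) :
    multiplicity p.asIdeal (tameIdeal m) = extNat m p := multiplicity_divIdeal p _

theorem absNorm_tameIdeal (m : TamePrime K ℓ →₀ ℕ) :
    Ideal.absNorm (tameIdeal m) = monSize tameNorm m := by
  rw [tameIdeal, divIdeal, extNat, Finsupp.mapDomain.addMonoidHom_apply,
    Finsupp.prod_mapDomain_index_inj Subtype.val_injective, map_finsuppProd, monSize]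
  simp only [map_pow]
  rfl

theorem tameIdeal_injective : Function.Injective (tameIdeal : (TamePrime K ℓ →₀ ℕ) → _) := by
  intro m n h
  ext p
  have h1 := multiplicity_tameIdeal m p.1
  rw [h, multiplicity_tameIdeal, extNat_apply_tame, extNat_apply_tame] at h1
  exact h1.symm

theorem finiteSublevels_monSize_tameNorm :
    FiniteSublevels (monSize (tameNorm : TamePrime K ℓ → ℕ)) := by
  intro X
  have h := Ideal.finite_setOfPred_absNorm_le (S := 𝓞 K) ⌊X⌋₊
  refine (h.preimage (f := tameIdeal (K := K) (ℓ := ℓ)) tameIdeal_injective.injOn).subset ?_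
  intro m hm
  rw [Set.mem_ofPred_eq] at hm
  rw [Set.mem_preimage, Set.mem_ofPred_eq, absNorm_tameIdeal]
  exact Nat.le_floor hm

theorem isCoprime_tameIdeal (hℓ : ℓ ≠ 0) (a : TamePrime K ℓ →₀ ℕ) :
    IsCoprime (tameIdeal a) (Ideal.span {(ℓ : 𝓞 K) ^ 2}) := by
  rw [Ideal.isCoprime_iff_sup_eq]
  by_contra hne
  obtain ⟨M, hM, hle⟩ := Ideal.exists_le_maximal _ hne
  have hmem : (ℓ : 𝓞 K) ^ 2 ∈ M :=
    hle (Ideal.mem_sup_right (Ideal.mem_span_singleton_self _))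
  have hℓM : (ℓ : 𝓞 K) ∈ M := hM.isPrime.mem_of_pow_mem _ hmem
  have hM0 : M ≠ ⊥ := by
    rintro rfl
    rw [Ideal.mem_bot, Nat.cast_eq_zero] at hℓM
    exact hℓ hℓM
  let p : HeightOneSpectrum (𝓞 K) := ⟨M, hM.isPrime, hM0⟩
  have hp : p.valuation K (ℓ : K) < 1 := by
    have := (p.valuation_lt_one_iff_mem (K := K) (ℓ : 𝓞 K)).2 hℓM
    simpa using this
  have h1 : 1 ≤ multiplicity p.asIdeal (tameIdeal a) := by
    rw [le_multiplicity_iff p (tameIdeal_ne_bot a), pow_one]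
    exact le_sup_left.trans hle
  rw [multiplicity_tameIdeal, extNat_apply_wild a hp] at h1
  omega

theorem exists_eq_tameIdeal {I : Ideal (𝓞 K)} (hI : I ≠ ⊥)
    (h : ∀ p : HeightOneSpectrum (𝓞 K), p.valuation K (ℓ : K) < 1 →
      multiplicity p.asIdeal I = 0) : ∃ m : TamePrime K ℓ →₀ ℕ, I = tameIdeal m := by
  let J : (Ideal (𝓞 K))⁰ := ⟨I, mem_nonZeroDivisors_of_ne_zero hI⟩
  refine ⟨(idealDiv J).subtypeDomain _, ideal_eq_of_multiplicity hI (tameIdeal_ne_bot _)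
    fun p => ?_⟩
  rw [multiplicity_tameIdeal]
  rcases valuation_natCast_cases p ℓ with hp | hp
  · rw [extNat_apply_wild _ hp, h p hp]
  · rw [extNat_apply_tame _ ⟨p, hp⟩]
    rfl

theorem ray_ideal_iff (hℓ : ℓ ≠ 0) (a : TamePrime K ℓ →₀ ℕ) {I : Ideal (𝓞 K)} (hI : I ≠ ⊥) :
    (∃ x, tameIdeal a * I = Ideal.span {x} ∧ x - 1 ∈ Ideal.span {(ℓ : 𝓞 K) ^ 2}) ↔
      ∃ m : TamePrime K ℓ →₀ ℕ, rayClass (natDiv a + natDiv m) = (0 : RayGroup K ℓ) ∧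
        tameIdeal m = I := by
  have hℓK : (ℓ : K) ≠ 0 := Nat.cast_ne_zero.2 hℓ
  constructor
  · rintro ⟨x, hx, hx1⟩
    have hx0 : x ≠ 0 := by
      rintro rfl
      rw [Ideal.span_singleton_eq_bot.2 rfl] at hx
      exact mul_ne_zero (tameIdeal_ne_bot a) hI hx
    have hxK : (algebraMap (𝓞 K) K x) ≠ 0 := by
      rwa [Ne, map_eq_zero_iff _ (FaithfulSMul.algebraMap_injective _ _)]
    have hord : ∀ p : HeightOneSpectrum (𝓞 K), ordAt p (algebraMap (𝓞 K) K x) =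
        extNat a p + multiplicity p.asIdeal I := by
      intro p
      rw [ordAt_algebraMap p hx0, ← hx, idealMult_mul p (tameIdeal_ne_bot a) hI,
        multiplicity_tameIdeal]
      push_cast
      rfl
    have hmem : Units.mk0 _ hxK ∈ rayUnits K ℓ := by
      intro p hp
      rw [Ideal.mem_span_singleton] at hx1
      obtain ⟨c, hc⟩ := hx1
      have e : ((Units.mk0 _ hxK : Kˣ) : K) - 1 = (ℓ : K) ^ 2 * algebraMap (𝓞 K) K c := by
        have := congrArg (algebraMap (𝓞 K) K) hc
        simpa using this
      rw [e, map_mul, map_pow]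
      exact mul_le_of_le_one_right' (p.valuation_le_one c)
    obtain ⟨m, rfl⟩ := exists_eq_tameIdeal (ℓ := ℓ) hI (by
      intro p hp
      have h1 := hord p
      have h2 : ordAt p (algebraMap (𝓞 K) K x) = 0 := ordAt_eq_zero_of_mem_rayUnits hmem hp
      rw [h2] at h1
      omega)
    refine ⟨m, rayClass_eq_zero_iff.2 ⟨_, hmem, ?_⟩, rfl⟩
    ext p
    have h1 := hord p.1
    rw [multiplicity_tameIdeal, extNat_apply_tame, extNat_apply_tame] at h1
    simpa using h1
  · rintro ⟨m, hm, rfl⟩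
    obtain ⟨y, hy, hdiv⟩ := rayClass_eq_zero_iff.1 hm
    have hord : ∀ p : HeightOneSpectrum (𝓞 K), ordAt p (y : K) = extNat a p + extNat m p := by
      intro p
      rcases valuation_natCast_cases p ℓ with hp | hp
      · rw [extNat_apply_wild _ hp, extNat_apply_wild _ hp, ordAt_eq_zero_of_mem_rayUnits hy hp]
        simp
      · have := DFunLike.congr_fun hdiv ⟨p, hp⟩
        rw [extNat_apply_tame _ ⟨p, hp⟩, extNat_apply_tame _ ⟨p, hp⟩]
        simpa using this
    have hle : ∀ p : HeightOneSpectrum (𝓞 K), p.valuation K (y : K) ≤ 1 := by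
      intro p
      rw [← ordAt_nonneg_iff p y.ne_zero, hord]
      positivity
    obtain ⟨x, hx⟩ := HeightOneSpectrum.mem_integers_of_valuation_le_one K (y : K) hle
    have hx0 : x ≠ 0 := by
      rintro rfl
      rw [map_zero] at hx
      exact y.ne_zero hx.symm
    refine ⟨x, ?_, ?_⟩
    · refine ideal_eq_of_multiplicity (mul_ne_zero (tameIdeal_ne_bot a) hI) (by simpa using hx0)
        fun p => ?_
      have h1 := ordAt_algebraMap (K := K) p hx0
      rw [hx, hord] at h1
      rw [idealMult_mul p (tameIdeal_ne_bot a) hI, multiplicity_tameIdeal, multiplicity_tameIdeal]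
      exact_mod_cast h1
    · have h2 : ∀ p : HeightOneSpectrum (𝓞 K),
          p.valuation K (((y : K) - 1) / (ℓ : K) ^ 2) ≤ 1 := by
        intro p
        rw [map_div₀, map_pow]
        rcases valuation_natCast_cases p ℓ with hp | hp
        · have hv0 : p.valuation K (ℓ : K) ^ 2 ≠ 0 :=
            pow_ne_zero _ ((Valuation.ne_zero_iff _).2 hℓK)
          rw [div_le_one₀ (zero_lt_iff.2 hv0)]
          exact hy p hp
        · rw [hp, one_pow, div_one]
          have e : algebraMap (𝓞 K) K (x - 1) = (y : K) - 1 := by rw [map_sub, map_one, hx]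
          rw [← e]
          exact p.valuation_le_one _
      obtain ⟨c, hc⟩ := HeightOneSpectrum.mem_integers_of_valuation_le_one K _ h2
      rw [Ideal.mem_span_singleton]
      refine ⟨c, FaithfulSMul.algebraMap_injective (𝓞 K) K ?_⟩
      rw [map_sub, map_one, hx, map_mul, hc, map_pow, map_natCast]
      field_simp

theorem exists_tendsto_rayClass (hℓ : ℓ ≠ 0) : ∃ δ : ℝ, 0 < δ ∧ ∀ g : RayGroup K ℓ,
    Tendsto (fun X => sizeCount (monSize (tameNorm : TamePrime K ℓ → ℕ))
      {m | (rayClass.comp natDiv) m = g} X / X) atTop (𝓝 δ) := by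
  have hQ : Ideal.span {(ℓ : 𝓞 K) ^ 2} ≠ ⊥ := by simpa using hℓ
  obtain ⟨δ, hδ, hlim⟩ := exists_tendsto_card_ray
    (⟨Ideal.span {(ℓ : 𝓞 K) ^ 2}, mem_nonZeroDivisors_of_ne_zero hQ⟩ : (Ideal (𝓞 K))⁰)
  refine ⟨δ, hδ, fun g => ?_⟩
  have hfin := finite_rayGroup (K := K) hℓ
  obtain ⟨a, ha⟩ : ∃ a : TamePrime K ℓ →₀ ℕ, rayClass (natDiv a) = -g := by
    obtain ⟨n, hn⟩ := rayClass_surjective (-g)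
    obtain ⟨b, c, rfl⟩ := exists_natDiv_sub n
    refine ⟨b + (addOrderOf (rayClass (natDiv c) : RayGroup K ℓ) - 1) • c, ?_⟩
    rw [← hn, map_add, map_add, map_sub, map_nsmul, map_nsmul, sub_eq_add_neg]
    congr 1
    have hpos := addOrderOf_pos (rayClass (natDiv c) : RayGroup K ℓ)
    rw [eq_neg_iff_add_eq_zero, ← succ_nsmul, Nat.sub_add_cancel hpos, addOrderOf_nsmul_eq_zero]
  have h := hlim ⟨tameIdeal a, mem_nonZeroDivisors_of_ne_zero (tameIdeal_ne_bot a)⟩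
    (isCoprime_tameIdeal hℓ a)
  refine h.congr fun X => ?_
  congr 1
  rw [sizeCount, Nat.cast_inj]
  let Φ : (TamePrime K ℓ →₀ ℕ) → (Ideal (𝓞 K))⁰ := fun m =>
    ⟨tameIdeal m, mem_nonZeroDivisors_of_ne_zero (tameIdeal_ne_bot m)⟩
  have hΦ : Function.Injective Φ := fun m n h => tameIdeal_injective (congrArg Subtype.val h)
  rw [← Set.ncard_image_of_injective _ hΦ]
  change Set.ncard _ = _
  congr 1
  ext I
  have hI := nonZeroDivisors.coe_ne_zero I
  change ((∃ x, tameIdeal a * (I : Ideal (𝓞 K)) = Ideal.span {x} ∧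
    x - 1 ∈ Ideal.span {(ℓ : 𝓞 K) ^ 2}) ∧ _) ↔ _
  rw [ray_ideal_iff hℓ a hI]
  constructor
  · rintro ⟨⟨m, hm, hmI⟩, hN⟩
    refine ⟨m, ⟨?_, ?_⟩, Subtype.ext hmI⟩
    · rw [map_add, ha, neg_add_eq_zero] at hm
      exact hm.symm
    · rwa [← absNorm_tameIdeal, hmI]
  · rintro ⟨m, ⟨hm, hN⟩, rfl⟩
    refine ⟨⟨m, ?_, rfl⟩, ?_⟩
    · rw [map_add, ha, neg_add_eq_zero]
      exact hm.symm
    · rwa [← absNorm_tameIdeal] at hN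

/-- Reduced tuples are equidistributed in the ray class group. -/
theorem exists_tendsto_reducedTuples (K : Type*) [Field K] [NumberField K] (hℓ : ℓ ≠ 0) (k : ℕ) :
    ∃ F : ℝ → ℝ, Tendsto F atTop atTop ∧ ∀ g : Fin (k + 1) → RayGroup K ℓ,
      Tendsto (fun X => sizeCount (tupleSize (monSize (tameNorm : TamePrime K ℓ → ℕ)))
        (reducedTuples (TamePrime K ℓ) (k + 1) ∩ classTuples (rayClass.comp natDiv) g) X / F X)
        atTop (𝓝 1) := by
  have := finite_rayGroup (K := K) hℓ
  have : Fintype (RayGroup K ℓ) := Fintype.ofFinite _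
  obtain ⟨δ, hδ, hlim⟩ := exists_tendsto_rayClass (K := K) hℓ
  exact reducedTuples_equidistribution two_le_tameNorm finiteSublevels_monSize_tameNorm _ hδ hlim k

end RayEquidistribution

section Kummer
open IntermediateField Polynomial

variable {K : Type*} [Field K] {ℓ : ℕ}

variable (ℓ) in
/-- The field generated by the `ℓ`-th roots of `α`. -/
def kummerField (α : K) : IntermediateField K (AlgebraicClosure K) :=
  IntermediateField.adjoin K {θ | θ ^ ℓ = algebraMap K _ α}

theorem kummerField_eq_adjoin (hℓ : ℓ ≠ 0) {ζ : K} (hζ : IsPrimitiveRoot ζ ℓ) {α : K} (hα : α ≠ 0)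
    {θ : AlgebraicClosure K} (hθ : θ ^ ℓ = algebraMap K _ α) : kummerField ℓ α = K⟮θ⟯ := by
  have : NeZero ℓ := ⟨hℓ⟩
  have hθ0 : θ ≠ 0 := by
    rintro rfl
    rw [zero_pow hℓ] at hθ
    exact hα ((map_eq_zero _).1 hθ.symm)
  refine le_antisymm (adjoin_le_iff.2 fun η hη => ?_) (IntermediateField.adjoin.mono _ _ _ (by simpa using hθ))
  have hη' : η ^ ℓ = algebraMap K _ α := hη
  have h1 : (η / θ) ^ ℓ = 1 := by
    rw [div_pow, hη', hθ, div_self]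
    rwa [Ne, map_eq_zero]
  obtain ⟨i, -, hi⟩ := (hζ.map_of_injective
    (algebraMap K (AlgebraicClosure K)).injective).eq_pow_of_pow_eq_one h1
  have h2 : η = algebraMap K _ (ζ ^ i) * θ := by
    rw [map_pow, hi, div_mul_cancel₀ _ hθ0]
  rw [h2]
  exact mul_mem (IntermediateField.algebraMap_mem _ _) (mem_adjoin_simple_self K θ)

theorem exists_kummer_root (hℓ : ℓ ≠ 0) (α : K) :
    ∃ θ : AlgebraicClosure K, θ ^ ℓ = algebraMap K _ α :=
  IsAlgClosed.exists_pow_nat_eq _ (Nat.pos_of_ne_zero hℓ)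

theorem kummerField_mul_pow_le (hℓ : ℓ ≠ 0) {ζ : K} (hζ : IsPrimitiveRoot ζ ℓ) {α : K} (hα : α ≠ 0)
    (i : ℕ) {t : K} (ht : t ≠ 0) : kummerField ℓ (α ^ i * t ^ ℓ) ≤ kummerField ℓ α := by
  obtain ⟨θ, hθ⟩ := exists_kummer_root hℓ α
  have hθ' : (θ ^ i * algebraMap K _ t) ^ ℓ = algebraMap K _ (α ^ i * t ^ ℓ) := by
    rw [mul_pow, ← pow_mul, mul_comm i, pow_mul, hθ, map_mul, map_pow, map_pow]
  rw [kummerField_eq_adjoin hℓ hζ hα hθ,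
    kummerField_eq_adjoin hℓ hζ (mul_ne_zero (pow_ne_zero _ hα) (pow_ne_zero _ ht)) hθ',
    adjoin_simple_le_iff]
  exact mul_mem (pow_mem (mem_adjoin_simple_self K θ) i) (IntermediateField.algebraMap_mem _ _)

/-- The structure of a Kummer extension. -/
theorem kummerField_spec (hℓ : ℓ.Prime) {ζ : K} (hζ : IsPrimitiveRoot ζ ℓ) {α : K} (hα : α ≠ 0)
    (hnp : ∀ t : K, t ^ ℓ ≠ α) :
    FiniteDimensional K (kummerField ℓ α) ∧ Module.finrank K (kummerField ℓ α) = ℓ ∧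
    ∃ θ : kummerField ℓ α, θ ^ ℓ = algebraMap K _ α ∧ K⟮θ⟯ = ⊤ ∧
      ∃ b : Module.Basis (Fin ℓ) K (kummerField ℓ α), ∀ j, b j = θ ^ (j : ℕ) := by
  obtain ⟨θ, hθ⟩ := exists_kummer_root hℓ.ne_zero α
  rw [kummerField_eq_adjoin hℓ.ne_zero hζ hα hθ]
  have hintegral : IsIntegral K θ := Algebra.IsIntegral.isIntegral θ
  have hmin : minpoly K θ = X ^ ℓ - C α := by
    refine (minpoly.eq_of_irreducible_of_monic (X_pow_sub_C_irreducible_of_prime hℓ hnp) ?_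
      (monic_X_pow_sub_C _ hℓ.ne_zero)).symm
    simp [hθ]
  have hfr : Module.finrank K K⟮θ⟯ = ℓ := by
    rw [adjoin.finrank hintegral, hmin, natDegree_X_pow_sub_C]
  have hdim : (adjoin.powerBasis hintegral).dim = ℓ := by
    rw [adjoin.powerBasis_dim, hmin, natDegree_X_pow_sub_C]
  refine ⟨adjoin.finiteDimensional hintegral, hfr, AdjoinSimple.gen K θ, ?_, ?_,
    (adjoin.powerBasis hintegral).basis.reindex (finCongr hdim), fun j => ?_⟩
  · ext
    simpa using hθ
  · have := (adjoin.powerBasis hintegral).adjoin_gen_eq_top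
    rw [adjoin.powerBasis_gen] at this
    rw [eq_top_iff]
    intro x _
    refine algebra_adjoin_le_adjoin K _ ?_
    rw [this]
    trivial
  · rw [Module.Basis.reindex_apply, PowerBasis.coe_basis, adjoin.powerBasis_gen]
    rfl

theorem isCyclicExt_kummerField (hℓ : ℓ.Prime) {ζ : K} (hζ : IsPrimitiveRoot ζ ℓ) {α : K}
    (hα : α ≠ 0) (hnp : ∀ t : K, t ^ ℓ ≠ α) : IsCyclicExt ℓ K (kummerField ℓ α) := by
  have : NeZero ℓ := ⟨hℓ.ne_zero⟩
  obtain ⟨hfd, hfr, θ, hθ, htop, -⟩ := kummerField_spec hℓ hζ hα hnp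
  have hprim : (primitiveRoots ℓ K).Nonempty := ⟨ζ, (mem_primitiveRoots hℓ.pos).2 hζ⟩
  have hH : Irreducible (X ^ ℓ - C α) := X_pow_sub_C_irreducible_of_prime hℓ hnp
  have hsplit : IsSplittingField K (kummerField ℓ α) (X ^ ℓ - C α) := by
    have := isSplittingField_X_pow_sub_C_of_root_adjoin_eq_top (K := K) (L := kummerField ℓ α)
      (a := α) (α := θ) (by rwa [hfr]) (by rwa [hfr]) htop
    rwa [hfr] at this
  exact ⟨isGalois_of_isSplittingField_X_pow_sub_C hprim hH _, ⟨autEquivZmod hH _ hζ⟩⟩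

theorem exists_eq_kummerField (hℓ : ℓ.Prime) {ζ : K} (hζ : IsPrimitiveRoot ζ ℓ)
    {L : IntermediateField K (AlgebraicClosure K)} (hL : IsCyclicExt ℓ K L) :
    ∃ α : K, α ≠ 0 ∧ (∀ t : K, t ^ ℓ ≠ α) ∧ L = kummerField ℓ α := by
  obtain ⟨hgal, ⟨e⟩⟩ := hL
  have : NeZero ℓ := ⟨hℓ.ne_zero⟩
  have hfin : Finite (L ≃ₐ[K] L) := Finite.of_equiv _ e.toEquiv.symm
  have hfd : FiniteDimensional K L := IsGalois.finiteDimensional_of_finite K L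
  have hfr : Module.finrank K L = ℓ := by
    rw [← IsGalois.card_aut_eq_finrank, Nat.card_congr (e.toEquiv.trans Multiplicative.toAdd),
      Nat.card_zmod]
  have hcyc : IsCyclic (L ≃ₐ[K] L) := isCyclic_of_surjective e.symm e.symm.surjective
  obtain ⟨θ, ⟨α, hα⟩, htop⟩ := exists_root_adjoin_eq_top_of_isCyclic K L
    (by rw [hfr]; exact ⟨ζ, (mem_primitiveRoots hℓ.pos).2 hζ⟩)
  have hirr := irreducible_X_pow_sub_C_of_root_adjoin_eq_top hα.symm htop
  rw [hfr] at hirr hα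
  have hnp : ∀ t : K, t ^ ℓ ≠ α := fun t =>
    pow_ne_of_irreducible_X_pow_sub_C hirr dvd_rfl hℓ.ne_one t
  have hα0 : α ≠ 0 := fun h => hnp 0 (by rw [zero_pow hℓ.ne_zero, h])
  refine ⟨α, hα0, hnp, ?_⟩
  have hθ : (θ : AlgebraicClosure K) ^ ℓ = algebraMap K _ α := by
    have := congrArg (algebraMap L (AlgebraicClosure K)) hα
    rw [map_pow] at this
    exact this.symm
  rw [kummerField_eq_adjoin hℓ.ne_zero hζ hα0 hθ]
  have h1 := congrArg IntermediateField.lift htop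
  rw [IntermediateField.lift_adjoin_simple, IntermediateField.lift_top] at h1
  exact h1.symm

theorem exists_eq_pow_mul_pow (hℓ : ℓ.Prime) {ζ : K} (hζ : IsPrimitiveRoot ζ ℓ) {α β : K}
    (hα : α ≠ 0) (hnp : ∀ t : K, t ^ ℓ ≠ α) (hβ : β ≠ 0)
    (h : kummerField ℓ β ≤ kummerField ℓ α) : ∃ (i : ℕ) (t : K), β = α ^ i * t ^ ℓ := by
  have : NeZero ℓ := ⟨hℓ.ne_zero⟩
  obtain ⟨hfd, hfr, θ, hθ, htop, -⟩ := kummerField_spec hℓ hζ hα hnp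
  have hprim : (primitiveRoots ℓ K).Nonempty := ⟨ζ, (mem_primitiveRoots hℓ.pos).2 hζ⟩
  have hH : Irreducible (X ^ ℓ - C α) := X_pow_sub_C_irreducible_of_prime hℓ hnp
  have hsplit : IsSplittingField K (kummerField ℓ α) (X ^ ℓ - C α) := by
    have := isSplittingField_X_pow_sub_C_of_root_adjoin_eq_top (K := K) (L := kummerField ℓ α)
      (a := α) (α := θ) (by rwa [hfr]) (by rwa [hfr]) htop
    rwa [hfr] at this
  have hgal : IsGalois K (kummerField ℓ α) := isGalois_of_isSplittingField_X_pow_sub_C hprim hH _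
  obtain ⟨η', hη'⟩ := exists_kummer_root hℓ.ne_zero β
  have hmem : η' ∈ kummerField ℓ α := h (subset_adjoin K _ hη')
  set η : kummerField ℓ α := ⟨η', hmem⟩ with hη
  have hηp : η ^ ℓ = algebraMap K _ β := by
    ext
    simpa using hη'
  have hinj := (algebraMap K (kummerField ℓ α)).injective
  have hθ0 : θ ≠ 0 := by
    rintro rfl
    rw [zero_pow hℓ.ne_zero] at hθ
    exact hα ((map_eq_zero _).1 hθ.symm)
  have hη0 : η ≠ 0 := by
    intro h0
    rw [h0, zero_pow hℓ.ne_zero] at hηp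
    exact hβ ((map_eq_zero _).1 hηp.symm)
  set σ := (autEquivZmod hH (kummerField ℓ α) hζ).symm (Multiplicative.ofAdd 1) with hσ
  have hσθ : σ θ = algebraMap K _ ζ * θ := by
    have := autEquivZmod_symm_apply_natCast hH (kummerField ℓ α) hθ hζ 1
    rw [Nat.cast_one, pow_one, Algebra.smul_def] at this
    exact this
  have h1 : (σ η / η) ^ ℓ = 1 := by
    rw [div_pow, ← map_pow, hηp, AlgEquiv.commutes, div_self]
    rwa [Ne, map_eq_zero]
  obtain ⟨i, -, hi⟩ := (hζ.map_of_injective hinj).eq_pow_of_pow_eq_one h1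
  have hση : σ η = algebraMap K _ ζ ^ i * η := by rw [hi, div_mul_cancel₀ _ hη0]
  have hζ0 : algebraMap K (kummerField ℓ α) ζ ≠ 0 := by
    rw [Ne, map_eq_zero]
    exact hζ.ne_zero hℓ.ne_zero
  have hfix : σ (η / θ ^ i) = η / θ ^ i := by
    rw [map_div₀, map_pow, hση, hσθ, mul_pow]
    field_simp
  obtain ⟨t, ht⟩ := (IsGalois.mem_range_algebraMap_iff_fixed (F := K) (η / θ ^ i)).2 (by
    intro τ
    obtain ⟨m, rfl⟩ := (autEquivZmod hH (kummerField ℓ α) hζ).symm.surjective τ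
    have hm : m = (Multiplicative.ofAdd 1 : Multiplicative (ZMod ℓ)) ^ (m.toAdd.val) := by
      rw [← ofAdd_nsmul, nsmul_one, ZMod.natCast_zmod_val, ofAdd_toAdd]
    rw [hm, map_pow, ← hσ]
    generalize m.toAdd.val = n
    induction n with
    | zero => rfl
    | succ n ih => rw [pow_succ, AlgEquiv.mul_apply, hfix, ih])
  refine ⟨i, t, hinj ?_⟩
  rw [map_mul, map_pow, map_pow, ht, ← hηp, ← hθ, div_pow, ← pow_mul, ← pow_mul, mul_comm i ℓ,
    mul_div_cancel₀ _ (pow_ne_zero _ hθ0)]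

end Kummer

section KummerClasses
open IntermediateField

variable {K : Type*} [Field K] {ℓ : ℕ}

/-- The group of units modulo `ℓ`-th powers. -/
def KummerClass (K : Type*) [Field K] (ℓ : ℕ) := Kˣ ⧸ (powMonoidHom ℓ : Kˣ →* Kˣ).range

instance : CommGroup (KummerClass K ℓ) := QuotientGroup.Quotient.commGroup _

/-- The Kummer class of a unit. -/
def kummerClass : Kˣ →* KummerClass K ℓ := QuotientGroup.mk' _

theorem kummerClass_surjective : Function.Surjective (kummerClass : Kˣ →* KummerClass K ℓ) :=
  QuotientGroup.mk'_surjective _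

theorem kummerClass_eq_one_iff {α : Kˣ} :
    (kummerClass α : KummerClass K ℓ) = 1 ↔ ∃ t : Kˣ, t ^ ℓ = α := by
  exact QuotientGroup.eq_one_iff α

theorem kummerClass_eq_iff {α β : Kˣ} :
    (kummerClass α : KummerClass K ℓ) = kummerClass β ↔ ∃ t : Kˣ, α = β * t ^ ℓ := by
  refine (eq_comm.trans QuotientGroup.eq).trans (exists_congr fun t => ?_)
  rw [powMonoidHom_apply, eq_comm, inv_mul_eq_iff_eq_mul]

theorem kummerClass_pow (v : KummerClass K ℓ) : v ^ ℓ = 1 := by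
  obtain ⟨α, rfl⟩ := kummerClass_surjective v
  rw [← map_pow, kummerClass_eq_one_iff]
  exact ⟨α, rfl⟩

theorem kummerClass_ne_one_iff (hℓ : ℓ ≠ 0) {α : Kˣ} :
    (kummerClass α : KummerClass K ℓ) ≠ 1 ↔ ∀ t : K, t ^ ℓ ≠ α := by
  rw [Ne, kummerClass_eq_one_iff, not_exists]
  constructor
  · intro h t ht
    have ht0 : t ≠ 0 := by
      rintro rfl
      rw [zero_pow hℓ] at ht
      exact α.ne_zero ht.symm
    exact h (Units.mk0 t ht0) (Units.ext (by simpa using ht))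
  · intro h t ht
    exact h t (by rw [← ht]; simp)

/-- The Kummer extension of a class. -/
def classField (v : KummerClass K ℓ) : IntermediateField K (AlgebraicClosure K) :=
  kummerField ℓ ((Quotient.out v : Kˣ) : K)

theorem kummerClass_out (v : KummerClass K ℓ) : kummerClass (Quotient.out v) = v :=
  QuotientGroup.out_eq' v

theorem classField_kummerClass (hℓ : ℓ ≠ 0) {ζ : K} (hζ : IsPrimitiveRoot ζ ℓ) (α : Kˣ) :
    classField (kummerClass α : KummerClass K ℓ) = kummerField ℓ (α : K) := by
  have key : ∀ x y : Kˣ, (kummerClass x : KummerClass K ℓ) = kummerClass y →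
      kummerField ℓ (x : K) ≤ kummerField ℓ (y : K) := by
    intro x y h
    obtain ⟨t, rfl⟩ := kummerClass_eq_iff.1 h
    have := kummerField_mul_pow_le hℓ hζ y.ne_zero 1 t.ne_zero
    simpa using this
  exact le_antisymm (key _ _ (kummerClass_out _)) (key _ _ (kummerClass_out _).symm)

theorem isCyclicExt_classField (hℓ : ℓ.Prime) {ζ : K} (hζ : IsPrimitiveRoot ζ ℓ)
    {v : KummerClass K ℓ} (hv : v ≠ 1) : IsCyclicExt ℓ K (classField v) := by
  obtain ⟨α, rfl⟩ := kummerClass_surjective v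
  rw [classField_kummerClass hℓ.ne_zero hζ]
  exact isCyclicExt_kummerField hℓ hζ α.ne_zero ((kummerClass_ne_one_iff hℓ.ne_zero).1 hv)

theorem exists_eq_classField (hℓ : ℓ.Prime) {ζ : K} (hζ : IsPrimitiveRoot ζ ℓ)
    {L : IntermediateField K (AlgebraicClosure K)} (hL : IsCyclicExt ℓ K L) :
    ∃ v : KummerClass K ℓ, v ≠ 1 ∧ L = classField v := by
  obtain ⟨α, hα, hnp, rfl⟩ := exists_eq_kummerField hℓ hζ hL
  exact ⟨kummerClass (Units.mk0 α hα), (kummerClass_ne_one_iff hℓ.ne_zero).2 hnp,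
    (classField_kummerClass hℓ.ne_zero hζ (Units.mk0 α hα)).symm⟩

theorem classField_eq_iff (hℓ : ℓ.Prime) {ζ : K} (hζ : IsPrimitiveRoot ζ ℓ)
    {v w : KummerClass K ℓ} (hv : v ≠ 1) (hw : w ≠ 1) :
    classField w = classField v ↔ w ∈ Subgroup.zpowers v := by
  obtain ⟨α, rfl⟩ := kummerClass_surjective v
  obtain ⟨β, rfl⟩ := kummerClass_surjective w
  rw [classField_kummerClass hℓ.ne_zero hζ, classField_kummerClass hℓ.ne_zero hζ]
  have hα := (kummerClass_ne_one_iff hℓ.ne_zero).1 hv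
  have hβ := (kummerClass_ne_one_iff hℓ.ne_zero).1 hw
  constructor
  · intro h
    obtain ⟨i, t, ht⟩ := exists_eq_pow_mul_pow hℓ hζ α.ne_zero hα β.ne_zero h.le
    have ht0 : t ≠ 0 := by
      rintro rfl
      rw [zero_pow hℓ.ne_zero, mul_zero] at ht
      exact β.ne_zero ht
    have : β = α ^ i * (Units.mk0 t ht0) ^ ℓ := Units.ext (by simpa using ht)
    have h2 : (kummerClass β : KummerClass K ℓ) = kummerClass (α ^ i) :=
      kummerClass_eq_iff.2 ⟨_, this⟩
    rw [h2, map_pow]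
    exact Subgroup.npow_mem_zpowers _ _
  · intro h
    have hfin : IsOfFinOrder (kummerClass α : KummerClass K ℓ) :=
      isOfFinOrder_iff_pow_eq_one.2 ⟨ℓ, hℓ.pos, kummerClass_pow _⟩
    rw [← hfin.mem_powers_iff_mem_zpowers] at h
    obtain ⟨i, hi⟩ := h
    have hi' : (kummerClass β : KummerClass K ℓ) = kummerClass (α ^ i) := by rw [map_pow]; exact hi.symm
    obtain ⟨t, ht⟩ := kummerClass_eq_iff.1 hi'
    have hle : kummerField ℓ (β : K) ≤ kummerField ℓ (α : K) := by
      have := kummerField_mul_pow_le hℓ.ne_zero hζ α.ne_zero i t.ne_zero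
      rw [ht]
      simpa using this
    obtain ⟨h1, h2, -⟩ := kummerField_spec hℓ hζ α.ne_zero hα
    obtain ⟨h3, h4, -⟩ := kummerField_spec hℓ hζ β.ne_zero hβ
    exact IntermediateField.eq_of_le_of_finrank_eq hle (h4.trans h2.symm)

theorem card_fiber_classField (hℓ : ℓ.Prime) {ζ : K} (hζ : IsPrimitiveRoot ζ ℓ)
    {v : KummerClass K ℓ} (hv : v ≠ 1) :
    Nat.card {w : KummerClass K ℓ // w ≠ 1 ∧ classField w = classField v} = ℓ - 1 := by
  have h1 : {w : KummerClass K ℓ | w ≠ 1 ∧ classField w = classField v} =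
      (Subgroup.zpowers v : Set (KummerClass K ℓ)) \ {1} := by
    ext w
    rw [Set.mem_ofPred_eq, Set.mem_sdiff, Set.mem_singleton_iff, SetLike.mem_coe, and_comm]
    exact and_congr_left fun hw => classField_eq_iff hℓ hζ hv hw
  have hord : orderOf v = ℓ :=
    have := Fact.mk hℓ
    orderOf_eq_prime (kummerClass_pow v) hv
  have hcard : Nat.card (Subgroup.zpowers v) = ℓ := by rw [Nat.card_zpowers, hord]
  change Set.ncard {w : KummerClass K ℓ | w ≠ 1 ∧ classField w = classField v} = ℓ - 1
  have : Finite (Subgroup.zpowers v) := Nat.finite_of_card_ne_zero (by rw [hcard]; exact hℓ.ne_zero)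
  rw [h1, Set.ncard_sdiff_singleton_of_mem (one_mem _)]
  exact congrArg (· - 1) hcard

/-- Counting cyclic extensions amounts to counting Kummer classes. -/
theorem card_kummerClass (hℓ : ℓ.Prime) {ζ : K} (hζ : IsPrimitiveRoot ζ ℓ)
    (P : IntermediateField K (AlgebraicClosure K) → Prop) :
    Nat.card {v : KummerClass K ℓ // v ≠ 1 ∧ P (classField v)} =
      Nat.card {L : IntermediateField K (AlgebraicClosure K) // IsCyclicExt ℓ K L ∧ P L} *
        (ℓ - 1) := by
  let f : {v : KummerClass K ℓ // v ≠ 1 ∧ P (classField v)} →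
      {L : IntermediateField K (AlgebraicClosure K) // IsCyclicExt ℓ K L ∧ P L} :=
    fun v => ⟨classField v.1, isCyclicExt_classField hℓ hζ v.2.1, v.2.2⟩
  have hf : ∀ L : {L : IntermediateField K (AlgebraicClosure K) // IsCyclicExt ℓ K L ∧ P L},
      Nonempty ({v // f v = L} ≃ Fin (ℓ - 1)) := by
    intro L
    obtain ⟨v, hv, hL⟩ := exists_eq_classField hℓ hζ L.2.1
    have hc := card_fiber_classField hℓ hζ hv
    have hfin : Finite {w : KummerClass K ℓ // w ≠ 1 ∧ classField w = classField v} :=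
      Nat.finite_of_card_ne_zero (by rw [hc]; have := hℓ.two_le; omega)
    refine ⟨Equiv.trans ?_ (Finite.equivFinOfCardEq hc)⟩
    exact
      { toFun := fun w => ⟨w.1.1, w.1.2.1, (congrArg Subtype.val w.2).trans hL⟩
        invFun := fun w => ⟨⟨w.1, w.2.1, by rw [w.2.2, ← hL]; exact L.2.2⟩,
          Subtype.ext (w.2.2.trans hL.symm)⟩
        left_inv := fun w => rfl
        right_inv := fun w => rfl }
  rw [← Nat.card_fin (ℓ - 1), ← Nat.card_prod]
  exact Nat.card_congr ((Equiv.sigmaFiberEquiv f).symm.trans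
    ((Equiv.sigmaCongrRight fun L => (hf L).some).trans (Equiv.sigmaEquivProd _ _)))

end KummerClasses

section Residues
open IsDedekindDomain NumberField HeightOneSpectrum
open scoped nonZeroDivisors

theorem eq_zero_or_eq_single {ι : Type*} [Fintype ι] [DecidableEq ι] {f : ι → ℕ}
    (hf : ∑ i, f i ≤ 1) : f = 0 ∨ ∃ i, f = Pi.single i 1 := by
  by_cases h : ∃ i, f i ≠ 0
  · obtain ⟨i, hi⟩ := h
    refine Or.inr ⟨i, funext fun j => ?_⟩
    have h1 := Finset.add_sum_erase Finset.univ f (Finset.mem_univ i)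
    by_cases hj : j = i
    · subst hj
      rw [Pi.single_eq_same]
      omega
    · rw [Pi.single_eq_of_ne hj]
      have h2 := Finset.single_le_sum (f := f) (fun _ _ => Nat.zero_le _)
        (Finset.mem_erase.2 ⟨hj, Finset.mem_univ j⟩)
      omega
  · push Not at h
    exact Or.inl (funext h)

/-- The sum of the floors of the multiples of `n / ℓ`. -/
def floorSum (ℓ : ℕ) (n : ℤ) : ℤ := ∑ j : Fin ℓ, (((j : ℕ) : ℤ) * n) / (ℓ : ℤ)

theorem floorSum_zero (ℓ : ℕ) : floorSum ℓ 0 = 0 := by simp [floorSum]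

theorem floorSum_add_mul {ℓ : ℕ} (hℓ : ℓ ≠ 0) (r q : ℤ) :
    floorSum ℓ (r + ℓ * q) = floorSum ℓ r + ℓ.choose 2 * q := by
  rw [← sum_ediv_of_dvd hℓ, floorSum, floorSum, ← Finset.sum_add_distrib]
  refine Finset.sum_congr rfl fun j _ => ?_
  have hℓ' : (ℓ : ℤ) ≠ 0 := by exact_mod_cast hℓ
  rw [mul_add, mul_left_comm _ (ℓ : ℤ), Int.add_mul_ediv_left _ _ hℓ',
    Int.mul_ediv_cancel_left _ hℓ']

variable {K : Type*} [Field K] [NumberField K] {ℓ : ℕ}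

variable (ℓ) in
/-- The contribution of the primes not dividing `ℓ` to the Steinitz divisor of `K(x^{1/ℓ})`. -/
def tameSteinitz (x : Kˣ) : TamePrime K ℓ →₀ ℤ :=
  (tameDiv ℓ x).mapRange (fun n => -floorSum ℓ n) (by rw [floorSum_zero, neg_zero])

theorem tameSteinitz_apply (x : Kˣ) (p : TamePrime K ℓ) :
    tameSteinitz ℓ x p = -floorSum ℓ (ordAt (p : HeightOneSpectrum (𝓞 K)) (x : K)) := rfl

variable (ℓ) in
/-- The divisors of the primes at which the order of `x` has a given nonzero residue. -/
def residueTuple (k : ℕ) (x : Kˣ) : Fin (k + 1) → TamePrime K ℓ →₀ ℕ := fun i =>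
  (tameDiv ℓ x).mapRange (fun n => if n % ℓ = ((i : ℕ) : ℤ) + 1 then 1 else 0)
    (if_neg (by rw [Int.zero_emod]; omega))

theorem residueTuple_apply (k : ℕ) (x : Kˣ) (i : Fin (k + 1)) (p : TamePrime K ℓ) :
    residueTuple ℓ k x i p =
      if ordAt (p : HeightOneSpectrum (𝓞 K)) (x : K) % ℓ = ((i : ℕ) : ℤ) + 1 then 1 else 0 := rfl

theorem residueTuple_mem (k : ℕ) (x : Kˣ) :
    residueTuple ℓ k x ∈ reducedTuples (TamePrime K ℓ) (k + 1) := by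
  intro p
  simp only [residueTuple_apply]
  rw [Finset.sum_boole]
  refine mod_cast Finset.card_le_one.2 fun i hi j hj => ?_
  have h1 := (Finset.mem_filter.1 hi).2
  have h2 := (Finset.mem_filter.1 hj).2
  exact Fin.ext (by omega)

/-- The divisor prime to `ℓ` with the given tuple of residues and quotient. -/
def residueDiv {k : ℕ} (m : Fin (k + 1) → TamePrime K ℓ →₀ ℕ) : TamePrime K ℓ →₀ ℤ :=
  ∑ i : Fin (k + 1), (((i : ℕ) : ℤ) + 1) • natDiv (m i)

theorem residueDiv_apply {k : ℕ} (m : Fin (k + 1) → TamePrime K ℓ →₀ ℕ) (p : TamePrime K ℓ) :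
    residueDiv m p = ∑ i : Fin (k + 1), (((i : ℕ) : ℤ) + 1) * (m i p : ℤ) := by
  rw [residueDiv, Finsupp.finsetSum_apply]
  rfl

theorem exists_tameDiv_eq {k : ℕ} (hk : ℓ = k + 2) (x : Kˣ) :
    ∃ q, tameDiv ℓ x = residueDiv (residueTuple ℓ k x) + (ℓ : ℤ) • q := by
  refine ⟨(tameDiv ℓ x).mapRange (fun n => n / (ℓ : ℤ)) (Int.zero_ediv _), ?_⟩
  ext p
  rw [Finsupp.add_apply, residueDiv_apply, Finsupp.smul_apply, Finsupp.mapRange_apply,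
    tameDiv_apply, smul_eq_mul]
  simp only [residueTuple_apply]
  set n := ordAt (p : HeightOneSpectrum (𝓞 K)) (x : K)
  have h0 : 0 ≤ n % ℓ := Int.emod_nonneg _ (by omega)
  have h1 : n % ℓ < ℓ := Int.emod_lt_of_pos _ (by omega)
  have h2 := Int.emod_add_mul_ediv n ℓ
  suffices ∑ i : Fin (k + 1), (((i : ℕ) : ℤ) + 1) *
      ((if n % ℓ = ((i : ℕ) : ℤ) + 1 then 1 else 0 : ℕ) : ℤ) = n % ℓ by rw [this, h2]
  by_cases h : n % ℓ = 0
  · rw [h]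
    refine Finset.sum_eq_zero fun i _ => ?_
    rw [if_neg (by omega), Nat.cast_zero, mul_zero]
  · have hlt : (n % ℓ).toNat - 1 < k + 1 := by omega
    rw [Finset.sum_eq_single (⟨(n % ℓ).toNat - 1, hlt⟩ : Fin (k + 1))]
    · dsimp only
      rw [if_pos (by omega)]
      omega
    · intro j _ hj
      rw [if_neg, Nat.cast_zero, mul_zero]
      intro hj'
      exact hj (Fin.ext (by dsimp only; omega))
    · exact fun h => absurd (Finset.mem_univ _) h

theorem residueTuple_eq_and_tameSteinitz_eq {k : ℕ} (hk : ℓ = k + 2) {x : Kˣ}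
    {m : Fin (k + 1) → TamePrime K ℓ →₀ ℕ} (hm : m ∈ reducedTuples (TamePrime K ℓ) (k + 1))
    {q : TamePrime K ℓ →₀ ℤ} (h : tameDiv ℓ x = residueDiv m + (ℓ : ℤ) • q) :
    residueTuple ℓ k x = m ∧
      tameSteinitz ℓ x = -(∑ i : Fin (k + 1), floorSum ℓ (((i : ℕ) : ℤ) + 1) • natDiv (m i))
        - ((ℓ.choose 2 : ℕ) : ℤ) • q := by
  have hℓ : ℓ ≠ 0 := by omega
  have hord : ∀ p : TamePrime K ℓ, ordAt (p : HeightOneSpectrum (𝓞 K)) (x : K) =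
      ∑ i : Fin (k + 1), (((i : ℕ) : ℤ) + 1) * (m i p : ℤ) + ℓ * q p := by
    intro p
    rw [← residueDiv_apply, ← tameDiv_apply, h]
    rfl
  constructor
  · funext i
    ext p
    rw [residueTuple_apply, hord p, Int.add_mul_emod_self_left]
    rcases eq_zero_or_eq_single (hm p) with h0 | ⟨j, hj⟩
    · simp only [show ∀ i, m i p = 0 from fun i => congrFun h0 i, Nat.cast_zero, mul_zero,
        Finset.sum_const_zero, Int.zero_emod]
      exact if_neg (by omega)
    · simp only [show ∀ i, m i p = Pi.single (M := fun _ => ℕ) j 1 i from fun i => congrFun hj i]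
      rw [Finset.sum_eq_single j (fun i _ hij => by rw [Pi.single_eq_of_ne hij]; simp)
        (fun h => absurd (Finset.mem_univ _) h), Pi.single_eq_same, Nat.cast_one, mul_one,
        Int.emod_eq_of_lt (by omega) (by omega)]
      by_cases hij : i = j
      · subst hij
        rw [Pi.single_eq_same, if_pos rfl]
      · rw [Pi.single_eq_of_ne hij, if_neg fun h => hij (Fin.ext (by omega))]
  · ext p
    rw [tameSteinitz_apply, hord p, floorSum_add_mul hℓ, Finsupp.sub_apply, Finsupp.neg_apply,
      Finsupp.finsetSum_apply]
    simp only [Finsupp.smul_apply, natDiv_apply, smul_eq_mul]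
    suffices floorSum ℓ (∑ i : Fin (k + 1), (((i : ℕ) : ℤ) + 1) * (m i p : ℤ)) =
        ∑ i : Fin (k + 1), floorSum ℓ (((i : ℕ) : ℤ) + 1) * (m i p : ℤ) by rw [this]; ring
    rcases eq_zero_or_eq_single (hm p) with h0 | ⟨j, hj⟩
    · simp only [show ∀ i, m i p = 0 from fun i => congrFun h0 i, Nat.cast_zero, mul_zero,
        Finset.sum_const_zero, floorSum_zero]
    · simp only [show ∀ i, m i p = Pi.single (M := fun _ => ℕ) j 1 i from fun i => congrFun hj i]
      rw [Finset.sum_eq_single j (fun i _ hij => by rw [Pi.single_eq_of_ne hij]; simp)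
        (fun h => absurd (Finset.mem_univ _) h),
        Finset.sum_eq_single j (fun i _ hij => by rw [Pi.single_eq_of_ne hij]; simp)
        (fun h => absurd (Finset.mem_univ _) h), Pi.single_eq_same, Nat.cast_one, mul_one, mul_one]

theorem residueTuple_mul_pow {k : ℕ} (hk : ℓ = k + 2) (x t : Kˣ) :
    residueTuple ℓ k (x * t ^ ℓ) = residueTuple ℓ k x := by
  obtain ⟨q, hq⟩ := exists_tameDiv_eq hk x
  refine (residueTuple_eq_and_tameSteinitz_eq hk (residueTuple_mem k x)
    (q := q + tameDiv ℓ t) ?_).1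
  rw [tameDiv_mul, tameDiv_pow, hq, smul_add, add_assoc, natCast_zsmul, natCast_zsmul]

end Residues

section Fibers
open IsDedekindDomain NumberField HeightOneSpectrum
open scoped nonZeroDivisors

variable {K : Type*} [Field K] [NumberField K] {ℓ : ℕ}

theorem exists_unit_of_prinDiv_eq_zero {z : Kˣ}
    (hz : (prinDiv z : HeightOneSpectrum (𝓞 K) →₀ ℤ) = 0) :
    ∃ ε : (𝓞 K)ˣ, Units.map (algebraMap (𝓞 K) K : 𝓞 K →* K) ε = z := by
  have key : ∀ z : Kˣ, (prinDiv z : HeightOneSpectrum (𝓞 K) →₀ ℤ) = 0 →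
      ∃ r : 𝓞 K, algebraMap (𝓞 K) K r = z := by
    intro z hz
    refine HeightOneSpectrum.mem_integers_of_valuation_le_one K _ fun p => ?_
    rw [← ordAt_nonneg_iff p z.ne_zero, ← prinDiv_apply, hz, Finsupp.zero_apply]
  obtain ⟨r, hr⟩ := key z hz
  obtain ⟨s, hs⟩ := key z⁻¹ (by rw [prinDiv_inv, hz, neg_zero])
  have h : r * s = 1 := by
    apply FaithfulSMul.algebraMap_injective (𝓞 K) K
    rw [map_mul, hr, hs, map_one, Units.mul_inv]
  exact ⟨⟨r, s, h, by rw [mul_comm, h]⟩, Units.ext hr⟩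

theorem finite_unit_classes (K : Type*) [Field K] [NumberField K] (hℓ : ℓ ≠ 0) :
    Finite ((kummerClass : Kˣ →* KummerClass K ℓ).comp
      (Units.map (algebraMap (𝓞 K) K : 𝓞 K →* K))).range := by
  have : Group.FG (𝓞 K)ˣ := Group.fg_iff_monoid_fg.2 inferInstance
  refine CommGroup.finite_of_fg_isMulTorsion _ fun v => ?_
  refine isOfFinOrder_iff_pow_eq_one.2 ⟨ℓ, Nat.pos_of_ne_zero hℓ, Subtype.ext ?_⟩
  exact kummerClass_pow v.1

/-- The classes of elements whose divisor is divisible by `ℓ`. -/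
theorem finite_selmer (K : Type*) [Field K] [NumberField K] (hℓ : ℓ ≠ 0) :
    {v : KummerClass K ℓ | ∃ (z : Kˣ) (d : HeightOneSpectrum (𝓞 K) →₀ ℤ),
      v = kummerClass z ∧ prinDiv z = (ℓ : ℤ) • d}.Finite := by
  classical
  set S := {v : KummerClass K ℓ | ∃ (z : Kˣ) (d : HeightOneSpectrum (𝓞 K) →₀ ℤ),
      v = kummerClass z ∧ prinDiv z = (ℓ : ℤ) • d} with hS
  have hS' : ∀ v : S, ∃ (z : Kˣ) (d : HeightOneSpectrum (𝓞 K) →₀ ℤ),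
      v.1 = kummerClass z ∧ prinDiv z = (ℓ : ℤ) • d := fun v => v.2
  choose z d hz hd using hS'
  have hfin := finite_unit_classes (ℓ := ℓ) K hℓ
  set U := ((kummerClass : Kˣ →* KummerClass K ℓ).comp
      (Units.map (algebraMap (𝓞 K) K : 𝓞 K →* K))).range with hU
  have hUfin : (U : Set (KummerClass K ℓ)).Finite := hfin
  have : Finite (Additive (ClassGroup (𝓞 K))) :=
    Finite.of_equiv (ClassGroup (𝓞 K)) Additive.ofMul
  rw [Set.Finite, ← Set.finite_univ_iff]
  refine Set.Finite.of_finite_fibers (fun v : S => divClass (d v)) (Set.toFinite _) ?_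
  rintro c -
  rcases ((Set.univ : Set S) ∩ (fun v : S => divClass (d v)) ⁻¹' {c}).eq_empty_or_nonempty
    with h | ⟨w, -, hw⟩
  · rw [h]
    exact Set.finite_empty
  · refine Set.Finite.of_finite_image (f := Subtype.val) ?_ Subtype.val_injective.injOn
    refine ((hUfin.image fun u => (w : KummerClass K ℓ) * u)).subset ?_
    rintro _ ⟨v, ⟨-, hv⟩, rfl⟩
    have hvw : divClass (d v - d w) = 0 := by
      rw [map_sub, sub_eq_zero]
      exact hv.trans hw.symm
    obtain ⟨t, ht⟩ := exists_prinDiv_eq K hvw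
    obtain ⟨ε, hε⟩ := exists_unit_of_prinDiv_eq_zero (z := z v / z w / t ^ ℓ) (by
      rw [div_eq_mul_inv, div_eq_mul_inv, prinDiv_mul, prinDiv_mul, prinDiv_inv, prinDiv_inv,
        prinDiv_pow, hd, hd, ht, ← natCast_zsmul, smul_sub]
      abel)
    refine ⟨kummerClass (Units.map (algebraMap (𝓞 K) K : 𝓞 K →* K) ε), ⟨ε, rfl⟩, ?_⟩
    change (w : KummerClass K ℓ) * _ = _
    rw [hz w, hz v, ← map_mul, hε, eq_comm, kummerClass_eq_iff]
    refine ⟨t, ?_⟩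
    ext
    push_cast
    field_simp

/-- The Kummer classes in the class of `α` modulo the ray with prescribed residues and
Steinitz class in `C`, where `W` is the Steinitz divisor at the primes dividing `ℓ`. -/
def steinitzFiber (k : ℕ) (α : Kˣ) (W : HeightOneSpectrum (𝓞 K) →₀ ℤ)
    (C : Set (Additive (ClassGroup (𝓞 K)))) (m : Fin (k + 1) → TamePrime K ℓ →₀ ℕ) :
    Set (KummerClass K ℓ) :=
  {v | ∃ y ∈ rayUnits K ℓ, v = kummerClass (α * y) ∧ residueTuple ℓ k (α * y) = m ∧
    divClass (W + extDiv (tameSteinitz ℓ (α * y))) ∈ C}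

theorem finite_steinitzFiber {k : ℕ} (hk : ℓ = k + 2) (α : Kˣ)
    (W : HeightOneSpectrum (𝓞 K) →₀ ℤ) (C : Set (Additive (ClassGroup (𝓞 K))))
    (m : Fin (k + 1) → TamePrime K ℓ →₀ ℕ) : (steinitzFiber k α W C m).Finite := by
  have hℓ : ℓ ≠ 0 := by omega
  rcases (steinitzFiber k α W C m).eq_empty_or_nonempty with h | ⟨w, y, hy, rfl, hm, -⟩
  · rw [h]
    exact Set.finite_empty
  refine ((finite_selmer (ℓ := ℓ) K hℓ).image fun u => kummerClass (α * y) * u).subset ?_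
  rintro _ ⟨y', hy', rfl, hm', -⟩
  obtain ⟨q, hq⟩ := exists_tameDiv_eq hk (α * y)
  obtain ⟨q', hq'⟩ := exists_tameDiv_eq hk (α * y')
  refine ⟨kummerClass (y' / y), ⟨y' / y, extDiv (q' - q), rfl, ?_⟩, ?_⟩
  · rw [← extDiv_tameDiv (div_mem hy' hy), tameDiv_div]
    rw [tameDiv_mul, hm] at hq
    rw [tameDiv_mul, hm'] at hq'
    rw [← map_zsmul, smul_sub]
    congr 1
    rw [← sub_eq_iff_eq_add'] at hq hq'
    rw [← hq, ← hq']
    abel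
  · change kummerClass (α * y) * kummerClass (y' / y) = _
    rw [← map_mul]
    congr 1
    rw [mul_assoc, mul_div_cancel]

theorem ncard_steinitzFiber_le {k : ℕ} (hk : ℓ = k + 2) {α α' : Kˣ}
    {W W' : HeightOneSpectrum (𝓞 K) →₀ ℤ} (C : Set (Additive (ClassGroup (𝓞 K))))
    {m m' : Fin (k + 1) → TamePrime K ℓ →₀ ℕ}
    (hm' : m' ∈ reducedTuples (TamePrime K ℓ) (k + 1))
    (h : Fin (k + 1) → RayGroup K ℓ) (b : RayGroup K ℓ)
    (hh : ∀ i, rayClass (natDiv (m' i)) = rayClass (natDiv (m i)) + h i)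
    (hα : rayClass (tameDiv ℓ α') = rayClass (tameDiv ℓ α) +
      ∑ i : Fin (k + 1), (((i : ℕ) : ℤ) + 1) • h i + (ℓ : ℤ) • b)
    (hW : divClass W' = divClass W + ∑ i : Fin (k + 1), floorSum ℓ (((i : ℕ) : ℤ) + 1) • rayToClass (h i) +
      ((ℓ.choose 2 : ℕ) : ℤ) • rayToClass b) :
    (steinitzFiber k α W C m).ncard ≤ (steinitzFiber k α' W' C m').ncard := by
  obtain ⟨q, rfl⟩ := rayClass_surjective b
  obtain ⟨y₀, hy₀, hy₀'⟩ := rayClass_eq_zero_iff.1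
    (show rayClass (residueDiv m' - residueDiv m + (ℓ : ℤ) • q -
      (tameDiv ℓ α' - tameDiv ℓ α)) = 0 by
      rw [map_sub, map_add, map_sub, map_sub, hα, residueDiv, residueDiv, map_sum, map_sum]
      simp only [map_zsmul, hh, zsmul_add, Finset.sum_add_distrib]
      abel)
  set β : Kˣ := α' * y₀ / α with hβ
  have hβdiv : tameDiv ℓ β = residueDiv m' - residueDiv m + (ℓ : ℤ) • q := by
    rw [hβ, tameDiv_div, tameDiv_mul, hy₀']
    abel
  refine Set.ncard_le_ncard_of_injOn (fun v => kummerClass β * v) ?_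
    (mul_right_injective _).injOn (finite_steinitzFiber hk _ _ _ _)
  rintro _ ⟨y, hy, rfl, hm, hC⟩
  obtain ⟨r, hr⟩ := exists_tameDiv_eq hk (α * y)
  have hmr : m ∈ reducedTuples (TamePrime K ℓ) (k + 1) := hm ▸ residueTuple_mem k _
  rw [hm] at hr
  have hx : β * (α * y) = α' * (y₀ * y) := by
    rw [hβ]
    ext
    push_cast
    field_simp
  have hr' : tameDiv ℓ (α' * (y₀ * y)) = residueDiv m' + (ℓ : ℤ) • (r + q) := by
    rw [← hx, tameDiv_mul, hr, hβdiv, smul_add]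
    abel
  obtain ⟨-, h1⟩ := residueTuple_eq_and_tameSteinitz_eq hk hmr hr
  obtain ⟨h2, h3⟩ := residueTuple_eq_and_tameSteinitz_eq hk hm' hr'
  refine ⟨y₀ * y, mul_mem hy₀ hy, ?_, h2, ?_⟩
  · rw [← map_mul, hx]
  · convert! hC using 1
    rw [map_add, map_add, ← rayToClass_rayClass, ← rayToClass_rayClass, h1, h3, hW]
    simp only [map_sub, map_neg, map_sum, map_zsmul, map_add, hh, smul_add,
      Finset.sum_add_distrib]
    abel

theorem ncard_steinitzFiber_eq {k : ℕ} (hk : ℓ = k + 2) {α α' : Kˣ}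
    {W W' : HeightOneSpectrum (𝓞 K) →₀ ℤ} (C : Set (Additive (ClassGroup (𝓞 K))))
    {m m' : Fin (k + 1) → TamePrime K ℓ →₀ ℕ}
    (hm : m ∈ reducedTuples (TamePrime K ℓ) (k + 1))
    (hm' : m' ∈ reducedTuples (TamePrime K ℓ) (k + 1))
    (h : Fin (k + 1) → RayGroup K ℓ) (b : RayGroup K ℓ)
    (hh : ∀ i, rayClass (natDiv (m' i)) = rayClass (natDiv (m i)) + h i)
    (hα : rayClass (tameDiv ℓ α') = rayClass (tameDiv ℓ α) +
      ∑ i : Fin (k + 1), (((i : ℕ) : ℤ) + 1) • h i + (ℓ : ℤ) • b)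
    (hW : divClass W' = divClass W + ∑ i : Fin (k + 1), floorSum ℓ (((i : ℕ) : ℤ) + 1) • rayToClass (h i) +
      ((ℓ.choose 2 : ℕ) : ℤ) • rayToClass b) :
    (steinitzFiber k α W C m).ncard = (steinitzFiber k α' W' C m').ncard := by
  refine le_antisymm (ncard_steinitzFiber_le hk C hm' h b hh hα hW)
    (ncard_steinitzFiber_le hk C hm (fun i => -h i) (-b) (fun i => ?_) ?_ ?_)
  · rw [hh]
    abel
  · rw [hα]
    simp only [zsmul_neg, Finset.sum_neg_distrib]
    abel
  · rw [hW]
    simp only [zsmul_neg, map_neg, Finset.sum_neg_distrib]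
    abel

theorem floorSum_one (hℓ : ℓ.Prime) : floorSum ℓ 1 = 0 := by
  have h := two_mul_sum_ediv hℓ (n := 1) fun h => by
    have := Int.le_of_dvd one_pos h
    have := hℓ.two_le
    omega
  rw [floorSum]
  linarith

theorem exists_translation (hℓ : ℓ.Prime) {k : ℕ} (hk : ℓ = k + 2) (e : RayGroup K ℓ)
    {W W' : HeightOneSpectrum (𝓞 K) →₀ ℤ} (hW : ∀ j : ℕ, ℓ = 2 * j + 1 → ∃ V, W = (j : ℤ) • V)
    (hW' : ∀ j : ℕ, ℓ = 2 * j + 1 → ∃ V, W' = (j : ℤ) • V) :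
    ∃ (h : Fin (k + 1) → RayGroup K ℓ) (b : RayGroup K ℓ),
      e = ∑ i : Fin (k + 1), (((i : ℕ) : ℤ) + 1) • h i + (ℓ : ℤ) • b ∧
      divClass W' = divClass W + ∑ i : Fin (k + 1), floorSum ℓ (((i : ℕ) : ℤ) + 1) • rayToClass (h i) +
        ((ℓ.choose 2 : ℕ) : ℤ) • rayToClass b := by
  have hsurj := rayToClass_surjective (K := K) hℓ.ne_zero
  rcases hℓ.eq_two_or_odd' with rfl | ⟨j, hj⟩
  · obtain rfl : k = 0 := by omega
    obtain ⟨b, hb⟩ := hsurj (divClass W' - divClass W)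
    refine ⟨fun _ => e - (2 : ℤ) • b, b, ?_, ?_⟩
    · simp
    · simp [floorSum_one Nat.prime_two, hb]
  · obtain ⟨V, rfl⟩ := hW j hj
    obtain ⟨V', rfl⟩ := hW' j hj
    obtain ⟨n, rfl⟩ : ∃ n, k = n + 1 := ⟨k - 1, by have := hℓ.two_le; omega⟩
    obtain ⟨a, ha⟩ := hsurj (divClass V' - divClass V)
    have hfl : floorSum ℓ 2 = j := by
      have h := two_mul_sum_ediv hℓ (n := 2) fun h => by
        have := Int.le_of_dvd two_pos h
        omega
      rw [floorSum]
      have : (ℓ : ℤ) = 2 * j + 1 := by exact_mod_cast hj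
      linarith
    refine ⟨Fin.cons (e - (2 : ℤ) • a) (Fin.cons a fun _ => 0), 0, ?_, ?_⟩
    · simp [Fin.sum_univ_succ]
    · simp [Fin.sum_univ_succ, floorSum_one hℓ, hfl, ha, smul_sub]

end Fibers

section Invariants
open IsDedekindDomain NumberField HeightOneSpectrum
open scoped nonZeroDivisors

variable {K : Type*} [Field K] [NumberField K] {ℓ : ℕ}

theorem dvd_span_natCast_iff (p : HeightOneSpectrum (𝓞 K)) (ℓ : ℕ) :
    p.asIdeal ∣ Ideal.span {(ℓ : 𝓞 K)} ↔ p.valuation K (ℓ : K) < 1 := by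
  rw [Ideal.dvd_span_singleton, ← p.valuation_lt_one_iff_mem (K := K)]
  simp

theorem dvd_iff_multiplicity_ne_zero {p : HeightOneSpectrum (𝓞 K)} {I : Ideal (𝓞 K)}
    (hI : I ≠ ⊥) : p.asIdeal ∣ I ↔ multiplicity p.asIdeal I ≠ 0 := by
  rw [← Nat.one_le_iff_ne_zero, le_multiplicity_iff p hI, pow_one, Ideal.dvd_iff_le]

/-- The partition of an ideal into its `ℓ`-part and its `ℓ`-free part is unique. -/
theorem isLPartition_iff {I : Ideal (𝓞 K)} (hI : I ≠ ⊥)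
    {n : HeightOneSpectrum (𝓞 K) →₀ ℕ} {d : TamePrime K ℓ →₀ ℕ}
    (hn : ∀ p : HeightOneSpectrum (𝓞 K), p.valuation K (ℓ : K) < 1 →
      multiplicity p.asIdeal I = n p)
    (hn' : ∀ p : HeightOneSpectrum (𝓞 K), p.valuation K (ℓ : K) = 1 → n p = 0)
    (hd : ∀ p : TamePrime K ℓ, multiplicity p.1.asIdeal I = d p) (Lp F : Ideal (𝓞 K)) :
    IsLPartition (Ideal.span {(ℓ : 𝓞 K)}) I Lp F ↔ Lp = divIdeal n ∧ F = tameIdeal d := by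
  constructor
  · rintro ⟨rfl, h1, h2⟩
    have hLp : Lp ≠ ⊥ := left_ne_zero_of_mul hI
    have hF : F ≠ ⊥ := right_ne_zero_of_mul hI
    have hF0 : ∀ p : HeightOneSpectrum (𝓞 K), p.valuation K (ℓ : K) < 1 →
        multiplicity p.asIdeal F = 0 := by
      intro p hp
      by_contra h
      exact h2 _ p.isPrime ((dvd_iff_multiplicity_ne_zero hF).2 h)
        ((dvd_span_natCast_iff p ℓ).2 hp)
    have hL0 : ∀ p : HeightOneSpectrum (𝓞 K), p.valuation K (ℓ : K) = 1 →
        multiplicity p.asIdeal Lp = 0 := by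
      intro p hp
      by_contra h
      exact ((dvd_span_natCast_iff p ℓ).1
        (h1 _ p.isPrime ((dvd_iff_multiplicity_ne_zero hLp).2 h))).ne hp
    constructor
    · refine ideal_eq_of_multiplicity hLp (divIdeal_ne_bot _) fun p => ?_
      rw [multiplicity_divIdeal]
      rcases valuation_natCast_cases p ℓ with hp | hp
      · rw [← hn p hp, idealMult_mul p hLp hF, hF0 p hp, add_zero]
      · rw [hn' p hp, hL0 p hp]
    · refine ideal_eq_of_multiplicity hF (tameIdeal_ne_bot _) fun p => ?_
      rw [multiplicity_tameIdeal]
      rcases valuation_natCast_cases p ℓ with hp | hp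
      · rw [extNat_apply_wild _ hp, hF0 p hp]
      · have h3 := extNat_apply_tame d ⟨p, hp⟩
        have h4 := hd ⟨p, hp⟩
        rw [idealMult_mul p hLp hF, hL0 p hp, zero_add] at h4
        rw [h4, ← h3]
  · rintro ⟨rfl, rfl⟩
    have hprime : ∀ (P J : Ideal (𝓞 K)), P.IsPrime → P ∣ J → J ≠ ⊥ →
        ∃ p : HeightOneSpectrum (𝓞 K), p.asIdeal = P := by
      intro P J hP hPJ hJ
      exact ⟨⟨P, hP, fun h => hJ (by rw [h] at hPJ; exact zero_dvd_iff.1 hPJ)⟩, rfl⟩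
    refine ⟨?_, ?_, ?_⟩
    · refine ideal_eq_of_multiplicity hI (mul_ne_zero (divIdeal_ne_bot _) (tameIdeal_ne_bot _))
        fun p => ?_
      rw [idealMult_mul p (divIdeal_ne_bot _) (tameIdeal_ne_bot _), multiplicity_divIdeal,
        multiplicity_tameIdeal]
      rcases valuation_natCast_cases p ℓ with hp | hp
      · rw [extNat_apply_wild _ hp, hn p hp, add_zero]
      · rw [hn' p hp, zero_add]
        exact (hd ⟨p, hp⟩).trans (extNat_apply_tame d ⟨p, hp⟩).symm
    · intro P hP hPJ
      obtain ⟨p, rfl⟩ := hprime P _ hP hPJ (divIdeal_ne_bot _)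
      rw [dvd_iff_multiplicity_ne_zero (divIdeal_ne_bot _), multiplicity_divIdeal] at hPJ
      rw [dvd_span_natCast_iff]
      exact (valuation_natCast_cases p ℓ).resolve_right fun hp => hPJ (hn' p hp)
    · intro P hP hPJ
      obtain ⟨p, rfl⟩ := hprime P _ hP hPJ (tameIdeal_ne_bot _)
      rw [dvd_iff_multiplicity_ne_zero (tameIdeal_ne_bot _), multiplicity_tameIdeal] at hPJ
      rw [dvd_span_natCast_iff]
      exact fun hp => hPJ (extNat_apply_wild _ hp)

theorem monSize_nsmul {P : Type*} (N : P → ℕ) (n : ℕ) (m : P →₀ ℕ) :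
    monSize N (n • m) = monSize N m ^ n := by
  induction n with
  | zero => rw [zero_smul, monSize_zero, pow_zero]
  | succ n ih => rw [succ_nsmul, monSize_add, ih, pow_succ]

theorem monSize_sum {P ι : Type*} (N : P → ℕ) (s : Finset ι) (m : ι → P →₀ ℕ) :
    monSize N (∑ i ∈ s, m i) = ∏ i ∈ s, monSize N (m i) := by
  classical
  induction s using Finset.induction_on with
  | empty => rw [Finset.sum_empty, Finset.prod_empty, monSize_zero]
  | insert a s ha ih => rw [Finset.sum_insert ha, Finset.prod_insert ha, monSize_add, ih]

theorem absNorm_tameIdeal_nsmul_sum {k : ℕ} (n : ℕ) (m : Fin (k + 1) → TamePrime K ℓ →₀ ℕ) :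
    Ideal.absNorm (tameIdeal (n • ∑ i, m i)) = tupleSize (monSize tameNorm) m ^ n := by
  rw [absNorm_tameIdeal, monSize_nsmul, monSize_sum, tupleSize]

theorem sum_residueTuple_apply {k : ℕ} (hk : ℓ = k + 2) (x : Kˣ) (p : TamePrime K ℓ) :
    (∑ i, residueTuple ℓ k x i) p =
      if (ℓ : ℤ) ∣ ordAt (p : HeightOneSpectrum (𝓞 K)) (x : K) then 0 else 1 := by
  rw [Finsupp.finsetSum_apply]
  simp only [residueTuple_apply]
  set n := ordAt (p : HeightOneSpectrum (𝓞 K)) (x : K)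
  have h0 : 0 ≤ n % ℓ := Int.emod_nonneg _ (by omega)
  have h1 : n % ℓ < ℓ := Int.emod_lt_of_pos _ (by omega)
  by_cases h : n % ℓ = 0
  · rw [if_pos (Int.dvd_of_emod_eq_zero h)]
    exact Finset.sum_eq_zero fun i _ => if_neg (by omega)
  · rw [if_neg fun h' => h (Int.emod_eq_zero_of_dvd h')]
    have hlt : (n % ℓ).toNat - 1 < k + 1 := by omega
    rw [Finset.sum_eq_single (⟨(n % ℓ).toNat - 1, hlt⟩ : Fin (k + 1))]
    · exact if_pos (by dsimp only; omega)
    · intro j _ hj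
      refine if_neg fun hj' => hj (Fin.ext (by dsimp only; omega))
    · exact fun h => absurd (Finset.mem_univ _) h

theorem tame_discr_exponent (hℓ : ℓ.Prime) (n : ℤ) :
    2 * (-floorSum ℓ n) + (ℓ - 1) * n = (ℓ - 1) * (if (ℓ : ℤ) ∣ n then 0 else 1) := by
  split_ifs with h
  · obtain ⟨m, rfl⟩ := h
    rw [floorSum, sum_ediv_of_dvd hℓ.ne_zero]
    linear_combination -two_mul_choose_two ℓ * m
  · rw [floorSum]
    linear_combination -two_mul_sum_ediv hℓ h

theorem isLeast_detOrders_reindex {L : Type*} [Field L] [NumberField L] [Algebra K L] {m n : ℕ}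
    (h : m = n) {p : HeightOneSpectrum (𝓞 K)} {b : Module.Basis (Fin m) K L} {c : ℤ}
    (hc : IsLeast (detOrders p b) c) :
    IsLeast (detOrders p (b.reindex (finCongr h))) c := by
  subst h
  have : b.reindex (finCongr rfl) = b := by ext i; simp
  rwa [this]

theorem exists_wildSteinitz.{u} {K : Type u} [Field K] [NumberField K] (hℓ : ℓ.Prime) {ζ : K}
    (hζ : IsPrimitiveRoot ζ ℓ) (α : Kˣ) :
    ∃ W : HeightOneSpectrum (𝓞 K) →₀ ℤ,
      (∀ p, p.valuation K (ℓ : K) = 1 → W p = 0) ∧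
      (∀ j : ℕ, ℓ = 2 * j + 1 → ∃ V, W = (j : ℤ) • V) ∧
      ∀ y ∈ rayUnits K ℓ, ∀ (L : Type u) [Field L] [NumberField L] [Algebra K L]
        (b : Module.Basis (Fin ℓ) K L) (θ : L), (∀ j, b j = θ ^ (j : ℕ)) →
        θ ^ ℓ = algebraMap K L ((α : K) * (y : K)) → ∀ p,
          IsLeast (detOrders p b) ((W + extDiv (tameSteinitz ℓ (α * y))) p) := by
  classical
  obtain ⟨l, hl0, hl⟩ := exists_valuation_pow_eq hℓ hζ
  have hex : ∀ p : HeightOneSpectrum (𝓞 K), ∃ c : ℤ, (∀ k : ℕ, ℓ = 2 * k + 1 → (k : ℤ) ∣ c) ∧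
      (p.valuation K (ℓ : K) < 1 →
      ∀ x : K, p.valuation K x = 1 → p.valuation K (x - 1) ≤ p.valuation K l ^ ℓ →
        ∀ (L : Type u) [Field L] [NumberField L] [Algebra K L] (b : Module.Basis (Fin ℓ) K L)
          (θ : L), (∀ j, b j = θ ^ (j : ℕ)) → θ ^ ℓ = algebraMap K L ((α : K) * x) →
          IsLeast (detOrders p b) c) := by
    intro p
    by_cases hp : p.valuation K (ℓ : K) < 1
    · obtain ⟨c, h1, h2⟩ := exists_local_invariant hℓ hl0 (hl p).2 hp α.ne_zero
      exact ⟨c, h1, fun _ => h2⟩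
    · exact ⟨0, fun k _ => dvd_zero _, fun h => absurd h hp⟩
  choose c hc1 hc2 using hex
  have hmem : ∀ p, p ∈ wildPrimes K hℓ.ne_zero ↔ p.valuation K (ℓ : K) < 1 :=
    fun p => mem_wildPrimes hℓ.ne_zero
  let W : HeightOneSpectrum (𝓞 K) →₀ ℤ := Finsupp.indicator (wildPrimes K hℓ.ne_zero) fun p _ => c p
  have hWw : ∀ p, p.valuation K (ℓ : K) < 1 → W p = c p := fun p hp =>
    Finsupp.indicator_of_mem ((hmem p).2 hp) _
  have hWt : ∀ p, p.valuation K (ℓ : K) = 1 → W p = 0 := fun p hp =>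
    Finsupp.indicator_of_notMem (fun h => ((hmem p).1 h).ne hp) _
  refine ⟨W, hWt, fun j hj => ?_, ?_⟩
  · refine ⟨W.mapRange (fun n => n / (j : ℤ)) (Int.zero_ediv _), ?_⟩
    ext p
    rw [Finsupp.smul_apply, Finsupp.mapRange_apply, smul_eq_mul]
    refine (Int.mul_ediv_cancel' ?_).symm
    rcases valuation_natCast_cases p ℓ with hp | hp
    · rw [hWw p hp]
      exact hc1 p j hj
    · rw [hWt p hp]
      exact dvd_zero _
  · intro y hy L _ _ _ b θ hb hθ p
    rw [Finsupp.add_apply]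
    rcases valuation_natCast_cases p ℓ with hp | hp
    · rw [hWw p hp, extDiv_apply_wild _ hp, add_zero]
      refine hc2 p hp y (valuation_eq_one_of_mem_rayUnits hy hp) ((hy p hp).trans ?_) L b θ hb hθ
      rw [← (hl p).2, ← pow_mul]
      exact pow_le_pow_right_of_le_one' (hl p).1 (by have := hℓ.two_le; omega)
    · have h1 := isLeast_detOrders_of_tame hℓ hp b hb (mul_ne_zero α.ne_zero y.ne_zero) hθ
      have h2 := extDiv_apply_tame (tameSteinitz ℓ (α * y)) ⟨p, hp⟩
      rw [tameSteinitz_apply] at h2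
      rw [hWt p hp, zero_add]
      exact h2 ▸ h1

theorem exists_classField_invariants.{u} {K : Type u} [Field K] [NumberField K] (hℓ : ℓ.Prime)
    {ζ : K} (hζ : IsPrimitiveRoot ζ ℓ) {k : ℕ} (hk : ℓ = k + 2) (α : Kˣ) :
    ∃ (W : HeightOneSpectrum (𝓞 K) →₀ ℤ) (Lp : Ideal (𝓞 K)),
      (∀ j : ℕ, ℓ = 2 * j + 1 → ∃ V, W = (j : ℤ) • V) ∧
      ∀ y ∈ rayUnits K ℓ, (kummerClass (α * y) : KummerClass K ℓ) ≠ 1 →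
        (∃ c, IsSteinitzClass K (classField (kummerClass (α * y) : KummerClass K ℓ)) c) ∧
        (∀ c, IsSteinitzClass K (classField (kummerClass (α * y) : KummerClass K ℓ)) c ↔
          Additive.ofMul c = divClass (W + extDiv (tameSteinitz ℓ (α * y)))) ∧
        ∀ Lp' F, IsLPartition (Ideal.span {(ℓ : 𝓞 K)})
          (relDisc K (classField (kummerClass (α * y) : KummerClass K ℓ))) Lp' F ↔
            Lp' = Lp ∧ F = tameIdeal ((ℓ - 1) • ∑ i, residueTuple ℓ k (α * y) i) := by
  classical
  obtain ⟨W, hWt, hWj, hW⟩ := exists_wildSteinitz hℓ hζ α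
  let n : HeightOneSpectrum (𝓞 K) →₀ ℕ := Finsupp.indicator (wildPrimes K hℓ.ne_zero)
    fun p _ => (2 * W p + (ℓ * ordAt p (ℓ : K) + (ℓ - 1) * ordAt p (α : K))).toNat
  have hnw : ∀ p, p.valuation K (ℓ : K) < 1 →
      n p = (2 * W p + (ℓ * ordAt p (ℓ : K) + (ℓ - 1) * ordAt p (α : K))).toNat := fun p hp =>
    Finsupp.indicator_of_mem ((mem_wildPrimes hℓ.ne_zero).2 hp) _
  have hnt : ∀ p, p.valuation K (ℓ : K) = 1 → n p = 0 := fun p hp =>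
    Finsupp.indicator_of_notMem (fun h => ((mem_wildPrimes hℓ.ne_zero).1 h).ne hp) _
  refine ⟨W, divIdeal n, hWj, fun y hy hne => ?_⟩
  have hnp := (kummerClass_ne_one_iff hℓ.ne_zero).1 hne
  rw [classField_kummerClass hℓ.ne_zero hζ]
  obtain ⟨hfd, hrank, θ, hθ, -, b, hb⟩ := kummerField_spec hℓ hζ (α * y).ne_zero hnp
  have : NumberField (kummerField ℓ ((α * y : Kˣ) : K)) := NumberField.of_module_finite K _
  have hθ' : θ ^ ℓ = algebraMap K _ ((α : K) * (y : K)) := hθ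
  have hleast := hW y hy _ b θ hb hθ'
  have hdisc := fun p => ordAt_discr_kummer (p := p) hℓ b hb
    (mul_ne_zero α.ne_zero y.ne_zero) hθ'
  set b' := b.reindex (finCongr hrank.symm) with hb'
  have hleast' := fun p => isLeast_detOrders_reindex hrank.symm (hleast p)
  have hdisc' : Algebra.discr K b' = Algebra.discr K b := by
    rw [hb', Module.Basis.coe_reindex, Algebra.discr_reindex]
  obtain ⟨hbot, hmult⟩ := relDisc_ne_bot_and_multiplicity b'
  have hmult' := fun p => hmult p _ (hleast' p)
  simp only [hdisc', hdisc] at hmult'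
  refine ⟨exists_isSteinitzClass, isSteinitzClass_iff b' _ hleast',
    isLPartition_iff hbot (fun p hp => ?_) hnt fun p => ?_⟩
  · have h := hmult' p
    rw [Finsupp.add_apply, extDiv_apply_wild _ hp, add_zero,
      ordAt_mul p α.ne_zero y.ne_zero, ordAt_eq_zero_of_mem_rayUnits hy hp, add_zero] at h
    rw [hnw p hp, ← h, Int.toNat_natCast]
  · have h := hmult' p.1
    have ht : tameSteinitz ℓ (α * y) p = -floorSum ℓ (ordAt p.1 ((α : K) * (y : K))) :=
      tameSteinitz_apply _ _
    have hr := sum_residueTuple_apply hk (α * y) p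
    rw [Units.val_mul] at hr
    rw [Finsupp.add_apply, hWt _ p.2, zero_add, extDiv_apply_tame, ht,
      ordAt_eq_zero_of_valuation p.2, mul_zero, zero_add, tame_discr_exponent hℓ] at h
    rw [Finsupp.smul_apply, hr, smul_eq_mul]
    refine Nat.cast_injective (R := ℤ) (h.trans ?_)
    rw [Nat.cast_mul, Nat.cast_sub hℓ.one_le, Nat.cast_ite, Nat.cast_zero, Nat.cast_one]

end Invariants

section FiberCounting

variable {T V G : Type*} [Fintype G]

/-- If the number of elements of `X` over a point of `D` depends only on the class of that point,
and the points of `D` are equidistributed over the classes, then so are their fibres. -/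
theorem tendsto_sizeCount_comp {s : T → ℕ} (hfin : FiniteSublevels s) (κ : T → G) {D : Set T}
    {r : V → T} {X : Set V} (hX : ∀ v ∈ X, r v ∈ D) {N : G → ℕ}
    (hN : ∀ m ∈ D, {v | v ∈ X ∧ r v = m}.Finite ∧ {v | v ∈ X ∧ r v = m}.ncard = N (κ m))
    {F : ℝ → ℝ}
    (hF : ∀ g, Tendsto (fun Y => sizeCount s (D ∩ {m | κ m = g}) Y / F Y) atTop (𝓝 1)) :
    Tendsto (fun Y => sizeCount (fun v => s (r v)) X Y / F Y) atTop (𝓝 (∑ g, (N g : ℝ))) := by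
  classical
  have key : ∀ Y, sizeCount (fun v => s (r v)) X Y =
      ∑ g, (N g : ℝ) * sizeCount s (D ∩ {m | κ m = g}) Y := by
    intro Y
    have hB : {m | m ∈ D ∧ (s m : ℝ) ≤ Y}.Finite := SizeCount.finite hfin D Y
    have hA : {v | v ∈ X ∧ (s (r v) : ℝ) ≤ Y}.Finite := by
      refine (hB.biUnion fun m hm => (hN m hm.1).1).subset fun v hv => ?_
      exact Set.mem_biUnion (x := r v) ⟨hX v hv.1, hv.2⟩ ⟨hv.1, rfl⟩
    have h1 : {v | v ∈ X ∧ (s (r v) : ℝ) ≤ Y}.ncard = ∑ m ∈ hB.toFinset, N (κ m) := by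
      rw [Set.ncard_eq_toFinset_card _ hA,
        Finset.card_eq_sum_card_fiberwise (f := r) (t := hB.toFinset)]
      · refine Finset.sum_congr rfl fun m hm => ?_
        rw [hB.mem_toFinset] at hm
        rw [← (hN m hm.1).2, ← Set.ncard_coe_finset]
        congr 1
        ext v
        simp only [Finset.coe_filter, hA.mem_toFinset, Set.mem_ofPred_eq]
        constructor
        · exact fun h => ⟨h.1.1, h.2⟩
        · rintro ⟨h, rfl⟩
          exact ⟨⟨h, hm.2⟩, rfl⟩
      · intro v hv
        have hv' := hA.mem_toFinset.1 (Finset.mem_coe.1 hv)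
        exact Finset.mem_coe.2 (hB.mem_toFinset.2 ⟨hX v hv'.1, hv'.2⟩)
    rw [sizeCount, h1, ← Finset.sum_fiberwise hB.toFinset κ, Nat.cast_sum]
    refine Finset.sum_congr rfl fun g _ => ?_
    rw [Finset.sum_congr rfl (g := fun _ => N g) fun m hm => by rw [(Finset.mem_filter.1 hm).2],
      Finset.sum_const, smul_eq_mul, Nat.cast_mul, mul_comm, sizeCount, ← Set.ncard_coe_finset]
    congr 3
    ext m
    simp only [Finset.coe_filter, hB.mem_toFinset, Set.mem_ofPred_eq, Set.mem_inter_iff]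
    tauto
  simp only [key, Finset.sum_div, mul_div_assoc]
  refine tendsto_finsetSum _ fun g _ => ?_
  simpa using (hF g).const_mul (N g : ℝ)

theorem tendsto_sizeCount_sdiff_singleton {s : V → ℕ} {X : Set V} (v : V)
    {F : ℝ → ℝ} (hF : Tendsto F atTop atTop) {c : ℝ}
    (h : Tendsto (fun Y => sizeCount s X Y / F Y) atTop (𝓝 c)) :
    Tendsto (fun Y => sizeCount s (X \ {v}) Y / F Y) atTop (𝓝 c) := by
  have h0 : Tendsto (fun Y => (sizeCount s X Y - sizeCount s (X \ {v}) Y) / F Y) atTop (𝓝 0) := by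
    refine squeeze_zero_norm' (a := fun Y => 1 / F Y) ?_ (tendsto_const_nhds.div_atTop hF)
    filter_upwards [hF.eventually_gt_atTop 0] with Y hY
    rw [norm_div, Real.norm_of_nonneg hY.le]
    refine div_le_div_of_nonneg_right ?_ hY.le
    have he : {t | t ∈ X \ {v} ∧ (s t : ℝ) ≤ Y} = {t | t ∈ X ∧ (s t : ℝ) ≤ Y} \ {v} := by
      ext t
      simp only [Set.mem_ofPred_eq, Set.mem_sdiff]
      tauto
    rw [sizeCount, sizeCount, he, Real.norm_eq_abs, abs_le]
    have h1 := Set.ncard_sdiff_singleton_le {t | t ∈ X ∧ (s t : ℝ) ≤ Y} v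
    have h2 := Set.ncard_le_ncard_sdiff_add_ncard {t | t ∈ X ∧ (s t : ℝ) ≤ Y} {v}
    rw [Set.ncard_singleton] at h2
    have h1' : (({t | t ∈ X ∧ (s t : ℝ) ≤ Y} \ {v}).ncard : ℝ) ≤
      ({t | t ∈ X ∧ (s t : ℝ) ≤ Y}.ncard : ℝ) := by exact_mod_cast h1
    have h2' : ({t | t ∈ X ∧ (s t : ℝ) ≤ Y}.ncard : ℝ) ≤
      (({t | t ∈ X ∧ (s t : ℝ) ≤ Y} \ {v}).ncard : ℝ) + 1 := by exact_mod_cast h2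
    constructor <;> linarith
  have := h.sub h0
  rw [sub_zero] at this
  refine this.congr fun Y => ?_
  ring

end FiberCounting

section SteinitzSets
open IsDedekindDomain NumberField HeightOneSpectrum
open scoped nonZeroDivisors

variable {K : Type*} [Field K] [NumberField K] {ℓ : ℕ}

/-- The residues modulo `ℓ` of the orders of a Kummer class. -/
def residues (k : ℕ) (v : KummerClass K ℓ) : Fin (k + 1) → TamePrime K ℓ →₀ ℕ :=
  residueTuple ℓ k (Quotient.out v)

theorem residues_kummerClass {k : ℕ} (hk : ℓ = k + 2) (x : Kˣ) :
    residues k (kummerClass x : KummerClass K ℓ) = residueTuple ℓ k x := by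
  obtain ⟨t, ht⟩ := kummerClass_eq_iff.1 (kummerClass_out (kummerClass x : KummerClass K ℓ))
  rw [residues, ht, residueTuple_mul_pow hk]

theorem mk_mul_eq {u : Kˣ ⧸ rayPowers K ℓ} {y : Kˣ} (hy : y ∈ rayUnits K ℓ) (t : Kˣ) :
    (QuotientGroup.mk (Quotient.out u * y * t ^ ℓ) : Kˣ ⧸ rayPowers K ℓ) = u := by
  refine Eq.trans ?_ (QuotientGroup.out_eq' u)
  rw [mul_assoc]
  exact (QuotientGroup.mk_mul_of_mem _ (mem_rayPowers.2 ⟨y, hy, t, rfl⟩))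

theorem eq_of_kummerClass_eq {u u' : Kˣ ⧸ rayPowers K ℓ} {y y' : Kˣ} (hy : y ∈ rayUnits K ℓ)
    (hy' : y' ∈ rayUnits K ℓ)
    (h : (kummerClass (Quotient.out u * y) : KummerClass K ℓ) = kummerClass (Quotient.out u' * y')) :
    u = u' := by
  obtain ⟨t, ht⟩ := kummerClass_eq_iff.1 h
  rw [← mk_mul_eq (u := u) hy 1, ht, one_pow, mul_one, mk_mul_eq hy']

theorem exists_kummerClass_eq (v : KummerClass K ℓ) :
    ∃ u : Kˣ ⧸ rayPowers K ℓ, ∃ y ∈ rayUnits K ℓ, v = kummerClass (Quotient.out u * y) := by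
  obtain ⟨x, rfl⟩ := kummerClass_surjective v
  obtain ⟨⟨z, hz⟩, h⟩ := QuotientGroup.mk_out_eq_mul (rayPowers K ℓ) x
  obtain ⟨y, hy, t, hyt⟩ := mem_rayPowers.1 (inv_mem hz)
  refine ⟨QuotientGroup.mk x, y, hy, kummerClass_eq_iff.2 ⟨t, ?_⟩⟩
  rw [mul_assoc, ← hyt]
  exact eq_mul_inv_of_mul_eq h.symm

/-- The Kummer classes lying over `S` with Steinitz class in `C`. -/
def steinitzSet (W : Kˣ ⧸ rayPowers K ℓ → HeightOneSpectrum (𝓞 K) →₀ ℤ)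
    (C : Set (Additive (ClassGroup (𝓞 K)))) (S : Set (Kˣ ⧸ rayPowers K ℓ)) :
    Set (KummerClass K ℓ) :=
  {v | ∃ u ∈ S, ∃ y ∈ rayUnits K ℓ, v = kummerClass (Quotient.out u * y) ∧
    divClass (W u + extDiv (tameSteinitz ℓ (Quotient.out u * y))) ∈ C}

theorem steinitzSet_fiber {k : ℕ} (hk : ℓ = k + 2)
    (W : Kˣ ⧸ rayPowers K ℓ → HeightOneSpectrum (𝓞 K) →₀ ℤ)
    (C : Set (Additive (ClassGroup (𝓞 K)))) (S : Set (Kˣ ⧸ rayPowers K ℓ))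
    (m : Fin (k + 1) → TamePrime K ℓ →₀ ℕ) :
    {v | v ∈ steinitzSet W C S ∧ residues k v = m} =
      ⋃ u ∈ S, steinitzFiber k (Quotient.out u) (W u) C m := by
  ext v
  simp only [Set.mem_iUnion, Set.mem_ofPred_eq, steinitzSet, steinitzFiber, exists_prop]
  constructor
  · rintro ⟨⟨u, hu, y, hy, rfl, hC⟩, hm⟩
    exact ⟨u, hu, y, hy, rfl, (residues_kummerClass hk _).symm.trans hm, hC⟩
  · rintro ⟨u, hu, y, hy, rfl, hm, hC⟩
    exact ⟨⟨u, hu, y, hy, rfl, hC⟩, (residues_kummerClass hk _).trans hm⟩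

theorem tendsto_steinitzSet (hℓ : ℓ.Prime) {k : ℕ} (hk : ℓ = k + 2)
    {W : Kˣ ⧸ rayPowers K ℓ → HeightOneSpectrum (𝓞 K) →₀ ℤ}
    (hW : ∀ u, ∀ j : ℕ, ℓ = 2 * j + 1 → ∃ V, W u = (j : ℤ) • V)
    (C : Set (Additive (ClassGroup (𝓞 K)))) {F : ℝ → ℝ}
    (hF : ∀ g : Fin (k + 1) → RayGroup K ℓ,
      Tendsto (fun X => sizeCount (tupleSize (monSize (tameNorm : TamePrime K ℓ → ℕ)))
        (reducedTuples (TamePrime K ℓ) (k + 1) ∩ classTuples (rayClass.comp natDiv) g) X / F X)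
        atTop (𝓝 1)) :
    ∃ R : ℕ, (∀ S, (steinitzSet W C S).Nonempty → 0 < R) ∧ ∀ S,
      Tendsto (fun X => sizeCount (fun v => tupleSize (monSize (tameNorm : TamePrime K ℓ → ℕ))
        (residues k v)) (steinitzSet W C S) X / F X) atTop (𝓝 (S.ncard * R)) := by
  classical
  have := finite_rayGroup (K := K) hℓ.ne_zero
  have : Fintype (RayGroup K ℓ) := Fintype.ofFinite _
  have := finite_quotient_rayPowers (K := K) hℓ.ne_zero
  have : Fintype (Kˣ ⧸ rayPowers K ℓ) := Fintype.ofFinite _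
  let κ : (Fin (k + 1) → TamePrime K ℓ →₀ ℕ) → Fin (k + 1) → RayGroup K ℓ :=
    fun m i => rayClass (natDiv (m i))
  have hκ : ∀ g, {m | κ m = g} = classTuples (rayClass.comp natDiv) g := fun g =>
    Set.ext fun m => funext_iff
  have hrep : ∀ g, ∃ m ∈ reducedTuples (TamePrime K ℓ) (k + 1), κ m = g := by
    intro g
    by_contra! hne
    have h0 : reducedTuples (TamePrime K ℓ) (k + 1) ∩ classTuples (rayClass.comp natDiv) g = ∅ := by
      rw [← hκ]
      exact Set.eq_empty_of_forall_notMem fun m hm => hne m hm.1 hm.2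
    have h1 := hF g
    simp only [h0, sizeCount, Set.mem_empty_iff_false, false_and, Set.ofPred_false,
      Set.ncard_empty, Nat.cast_zero, zero_div] at h1
    exact zero_ne_one (tendsto_nhds_unique tendsto_const_nhds h1)
  choose rep hrep hrepκ using hrep
  let N : Kˣ ⧸ rayPowers K ℓ → (Fin (k + 1) → RayGroup K ℓ) → ℕ := fun u g =>
    (steinitzFiber k (Quotient.out u) (W u) C (rep g)).ncard
  have hN : ∀ u, ∀ m ∈ reducedTuples (TamePrime K ℓ) (k + 1),
      (steinitzFiber k (Quotient.out u) (W u) C m).ncard = N u (κ m) := by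
    intro u m hm
    refine ncard_steinitzFiber_eq hk C hm (hrep _) 0 0 (fun i => ?_) (by simp) (by simp)
    rw [Pi.zero_apply, add_zero]
    exact congrFun (hrepκ (κ m)) i
  have hR : ∀ u, ∑ g, N u g = ∑ g, N 1 g := by
    intro u
    obtain ⟨h, b, he, hb⟩ := exists_translation hℓ hk
      (rayClass (tameDiv ℓ (Quotient.out (1 : Kˣ ⧸ rayPowers K ℓ))) -
        rayClass (tameDiv ℓ (Quotient.out u))) (hW u) (hW 1)
    refine Fintype.sum_equiv (Equiv.addRight h) _ _ fun g => ?_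
    refine ncard_steinitzFiber_eq hk C (hrep _) (hrep _) h b (fun i => ?_) ?_ hb
    · rw [show rayClass (natDiv (rep g i)) = g i from congrFun (hrepκ g) i]
      exact congrFun (hrepκ _) i
    · rw [add_assoc, ← he]
      abel
  have hfib : ∀ S m, {v | v ∈ steinitzSet W C S ∧ residues k v = m}.Finite := fun S m => by
    rw [steinitzSet_fiber hk]
    exact S.toFinite.biUnion fun u _ => finite_steinitzFiber hk _ _ _ _
  have hcard : ∀ S, ∀ m ∈ reducedTuples (TamePrime K ℓ) (k + 1),
      {v | v ∈ steinitzSet W C S ∧ residues k v = m}.ncard = ∑ u ∈ S.toFinset, N u (κ m) := by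
    intro S m hm
    rw [steinitzSet_fiber hk, S.toFinite.ncard_biUnion (fun u _ => finite_steinitzFiber hk _ _ _ _),
      finsum_mem_eq_toFinset_sum]
    · exact Finset.sum_congr rfl fun u _ => hN u m hm
    · intro u _ u' _ hne
      refine Set.disjoint_left.2 ?_
      rintro v ⟨y, hy, rfl, -⟩ ⟨y', hy', h, -⟩
      exact hne (eq_of_kummerClass_eq hy hy' h)
  refine ⟨∑ g, N 1 g, ?_, fun S => ?_⟩
  · rintro S ⟨v, u, hu, y, hy, rfl, hC⟩
    have hm := residueTuple_mem (ℓ := ℓ) k (Quotient.out u * y)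
    have h1 : 0 < N u (κ (residueTuple ℓ k (Quotient.out u * y))) := by
      rw [← hN u _ hm, Set.ncard_pos (finite_steinitzFiber hk _ _ _ _)]
      exact ⟨_, y, hy, rfl, rfl, hC⟩
    rw [← hR u]
    exact h1.trans_le (Finset.single_le_sum (fun g _ => Nat.zero_le _) (Finset.mem_univ _))
  · have h := tendsto_sizeCount_comp
      (finiteSublevels_monSize_tameNorm.tuple (one_le_monSize two_le_tameNorm) (k + 1)) κ
      (D := reducedTuples (TamePrime K ℓ) (k + 1)) (r := residues k) (X := steinitzSet W C S)
      (fun v _ => residueTuple_mem _ _) (N := fun g => ∑ u ∈ S.toFinset, N u g)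
      (fun m hm => ⟨hfib S m, hcard S m hm⟩) (F := F) (fun g => by rw [hκ]; exact hF g)
    convert! h using 2
    rw [← Nat.cast_sum, Finset.sum_comm, Finset.sum_congr rfl fun u _ => hR u, Finset.sum_const,
      smul_eq_mul, Nat.cast_mul, Set.ncard_eq_toFinset_card']

end SteinitzSets

section Densities
open IsDedekindDomain NumberField HeightOneSpectrum
open scoped nonZeroDivisors

variable {K : Type*} [Field K] [NumberField K] {ℓ : ℕ}

theorem natCast_pow_le_iff {n : ℕ} (hn : n ≠ 0) (a : ℕ) {X : ℝ} (hX : 0 ≤ X) :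
    ((a ^ n : ℕ) : ℝ) ≤ X ↔ (a : ℝ) ≤ X ^ (n : ℝ)⁻¹ := by
  rw [Nat.cast_pow, Real.le_rpow_inv_iff_of_pos (Nat.cast_nonneg a) hX
    (Nat.cast_pos.2 (Nat.pos_of_ne_zero hn)), Real.rpow_natCast]

theorem tendsto_div_of_tendsto_div {ι : Type*} {l : Filter ι} {f g F : ι → ℝ} {a b : ℝ}
    (hf : Tendsto (fun x => f x / F x) l (𝓝 a)) (hg : Tendsto (fun x => g x / F x) l (𝓝 b))
    (hb : b ≠ 0) (hF : ∀ᶠ x in l, F x ≠ 0) : Tendsto (fun x => f x / g x) l (𝓝 (a / b)) := by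
  refine (hf.div hg hb).congr' ?_
  filter_upwards [hF] with x hx
  exact div_div_div_cancel_right₀ hx _ _

theorem exists_density.{u} {K : Type u} [Field K] [NumberField K] (hℓ : ℓ.Prime)
    {ζ : K} (hζ : IsPrimitiveRoot ζ ℓ) (𝔔 : Ideal (𝓞 K)) :
    ∃ δ : ℝ, ∀ C : Set (ClassGroup (𝓞 K)),
      (∃ L : IntermediateField K (AlgebraicClosure K),
        IsCyclicExt ℓ K L ∧ ∃ c ∈ C, IsSteinitzClass K L c) →
      Tendsto (fun X : ℝ =>
        (Nat.card {L : IntermediateField K (AlgebraicClosure K) //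
          IsCyclicExt ℓ K L ∧ (∃ c ∈ C, IsSteinitzClass K L c) ∧ ∃ F : Ideal (𝓞 K),
            IsLPartition (Ideal.span {(ℓ : 𝓞 K)}) (relDisc K L) 𝔔 F ∧
            (Ideal.absNorm F : ℝ) ≤ X} : ℝ) /
        (Nat.card {L : IntermediateField K (AlgebraicClosure K) //
          IsCyclicExt ℓ K L ∧ (∃ c ∈ C, IsSteinitzClass K L c) ∧ ∃ Lp F : Ideal (𝓞 K),
            IsLPartition (Ideal.span {(ℓ : 𝓞 K)}) (relDisc K L) Lp F ∧
            (Ideal.absNorm F : ℝ) ≤ X} : ℝ)) atTop (𝓝 δ) := by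
  obtain ⟨k, hk⟩ : ∃ k, ℓ = k + 2 := ⟨ℓ - 2, by have := hℓ.two_le; omega⟩
  have hℓ1 : ℓ - 1 ≠ 0 := by omega
  obtain ⟨F, hF, hlim⟩ := exists_tendsto_reducedTuples K hℓ.ne_zero k
  choose W Lp hW hinv using fun u : Kˣ ⧸ rayPowers K ℓ =>
    exists_classField_invariants hℓ hζ hk (Quotient.out u)
  have := finite_quotient_rayPowers (K := K) hℓ.ne_zero
  refine ⟨(({u | Lp u = 𝔔} : Set (Kˣ ⧸ rayPowers K ℓ)).ncard : ℝ) /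
    ((Set.univ : Set (Kˣ ⧸ rayPowers K ℓ)).ncard : ℝ), fun C hC => ?_⟩
  set D : Set (Additive (ClassGroup (𝓞 K))) := Additive.toMul ⁻¹' C with hD
  obtain ⟨R, hRpos, hR⟩ := tendsto_steinitzSet hℓ hk hW D hlim
  let s : KummerClass K ℓ → ℕ := fun v =>
    tupleSize (monSize (tameNorm : TamePrime K ℓ → ℕ)) (residues k v)
  have hSt : ∀ u : Kˣ ⧸ rayPowers K ℓ, ∀ y ∈ rayUnits K ℓ,
      (kummerClass (Quotient.out u * y) : KummerClass K ℓ) ≠ 1 →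
      ((∃ c ∈ C, IsSteinitzClass K
        (classField (kummerClass (Quotient.out u * y) : KummerClass K ℓ)) c) ↔
        divClass (W u + extDiv (tameSteinitz ℓ (Quotient.out u * y))) ∈ D) := by
    intro u y hy hne
    simp only [(hinv u y hy hne).2.1]
    constructor
    · rintro ⟨c, hc, h⟩
      rw [← h]
      exact hc
    · exact fun h => ⟨_, h, rfl⟩
  have hcount : ∀ (A : Set (Ideal (𝓞 K))) (X : ℝ), 0 ≤ X →
      (Nat.card {L : IntermediateField K (AlgebraicClosure K) // IsCyclicExt ℓ K L ∧
        (∃ c ∈ C, IsSteinitzClass K L c) ∧ ∃ Lp ∈ A, ∃ F : Ideal (𝓞 K),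
          IsLPartition (Ideal.span {(ℓ : 𝓞 K)}) (relDisc K L) Lp F ∧
          (Ideal.absNorm F : ℝ) ≤ X} : ℝ) * ((ℓ - 1 : ℕ) : ℝ) =
      sizeCount s (steinitzSet W D {u | Lp u ∈ A} \ {1}) (X ^ (((ℓ - 1 : ℕ) : ℝ)⁻¹)) := by
    intro A X hX
    rw [← Nat.cast_mul, ← card_kummerClass hℓ hζ, sizeCount]
    congr 1
    refine (Nat.card_coe_set_eq (Set.ofPred _)).trans ?_
    congr 1
    ext v
    obtain ⟨u, y, hy, rfl⟩ := exists_kummerClass_eq v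
    simp only [Set.mem_ofPred_eq, Set.mem_sdiff, Set.mem_singleton_iff]
    by_cases hne : (kummerClass (Quotient.out u * y) : KummerClass K ℓ) = 1
    · simp [hne]
    have hmem : (kummerClass (Quotient.out u * y) : KummerClass K ℓ) ∈
        steinitzSet W D {u | Lp u ∈ A} ↔
        Lp u ∈ A ∧ divClass (W u + extDiv (tameSteinitz ℓ (Quotient.out u * y))) ∈ D := by
      constructor
      · rintro ⟨u', hu', y', hy', h, hd⟩
        obtain rfl := eq_of_kummerClass_eq hy hy' h
        refine ⟨hu', ?_⟩
        rw [← hSt _ _ hy hne, h, hSt _ _ hy' (h ▸ hne)]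
        exact hd
      · exact fun h => ⟨u, h.1, y, hy, rfl, h.2⟩
    have hs : (∃ Lp' ∈ A, ∃ F : Ideal (𝓞 K), IsLPartition (Ideal.span {(ℓ : 𝓞 K)})
        (relDisc K (classField (kummerClass (Quotient.out u * y) : KummerClass K ℓ))) Lp' F ∧
          (Ideal.absNorm F : ℝ) ≤ X) ↔ Lp u ∈ A ∧
          (s (kummerClass (Quotient.out u * y)) : ℝ) ≤ X ^ (((ℓ - 1 : ℕ) : ℝ)⁻¹) := by
      simp only [(hinv u y hy hne).2.2]
      rw [← natCast_pow_le_iff hℓ1 _ hX]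
      simp only [s, residues_kummerClass hk, ← absNorm_tameIdeal_nsmul_sum]
      constructor
      · rintro ⟨_, hA, _, ⟨rfl, rfl⟩, h⟩
        exact ⟨hA, h⟩
      · exact fun h => ⟨_, h.1, _, ⟨rfl, rfl⟩, h.2⟩
    rw [hmem, hSt u y hy hne, hs]
    tauto
  have hR0 : (R : ℝ) ≠ 0 := by
    obtain ⟨L, hL, hLC⟩ := hC
    obtain ⟨v, hv, rfl⟩ := exists_eq_classField hℓ hζ hL
    obtain ⟨u, y, hy, rfl⟩ := exists_kummerClass_eq v
    exact Nat.cast_ne_zero.2 (hRpos Set.univ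
      ⟨_, u, Set.mem_univ _, y, hy, rfl, (hSt u y hy hv).1 hLC⟩).ne'
  have hroot : Tendsto (fun X : ℝ => X ^ (((ℓ - 1 : ℕ) : ℝ)⁻¹)) atTop atTop :=
    tendsto_rpow_atTop (inv_pos.2 (Nat.cast_pos.2 (Nat.pos_of_ne_zero hℓ1)))
  have hlimit : ∀ A : Set (Ideal (𝓞 K)), Tendsto (fun X : ℝ =>
      (Nat.card {L : IntermediateField K (AlgebraicClosure K) // IsCyclicExt ℓ K L ∧
        (∃ c ∈ C, IsSteinitzClass K L c) ∧ ∃ Lp ∈ A, ∃ F : Ideal (𝓞 K),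
          IsLPartition (Ideal.span {(ℓ : 𝓞 K)}) (relDisc K L) Lp F ∧
          (Ideal.absNorm F : ℝ) ≤ X} : ℝ) / (F (X ^ (((ℓ - 1 : ℕ) : ℝ)⁻¹)) / ((ℓ - 1 : ℕ) : ℝ)))
        atTop (𝓝 (({u | Lp u ∈ A} : Set (Kˣ ⧸ rayPowers K ℓ)).ncard * R)) := by
    intro A
    refine ((tendsto_sizeCount_sdiff_singleton 1 hF (hR {u | Lp u ∈ A})).comp hroot).congr' ?_
    filter_upwards [eventually_ge_atTop 0] with X hX
    rw [Function.comp_apply, ← hcount A X hX, div_div_eq_mul_div]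
  have hFne : ∀ᶠ X : ℝ in atTop, F (X ^ (((ℓ - 1 : ℕ) : ℝ)⁻¹)) / ((ℓ - 1 : ℕ) : ℝ) ≠ 0 := by
    filter_upwards [(hF.comp hroot).eventually_gt_atTop 0] with X hX
    exact div_ne_zero hX.ne' (Nat.cast_ne_zero.2 hℓ1)
  have hU : ((Set.univ : Set (Kˣ ⧸ rayPowers K ℓ)).ncard : ℝ) ≠ 0 :=
    Nat.cast_ne_zero.2 (Set.ncard_ne_zero_of_mem (Set.mem_univ 1))
  have h := tendsto_div_of_tendsto_div (hlimit {𝔔}) (hlimit Set.univ)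
    (mul_ne_zero (by simpa using hU) hR0) hFne
  simpa [mul_div_mul_right _ _ hR0] using h

end Densities

end SteinitzDensity

/-- **The density `ρ_𝔔` is independent of the Steinitz class.**
Let `𝒞` be a realizable Steinitz class for degree-`ℓ` cyclic extensions of `K` and `𝔔` a
possible value of the `ℓ`-part `𝔏_{L/K}` of the discriminant, with density `ρ_𝔔`
(extensions ordered by the norm of the `ℓ`-free part `𝔉_{L/K}`).  Then among extensions
with Steinitz class `𝒞`, the density of those with `𝔏_{L/K} = 𝔔` is again `ρ_𝔔`. -/
theorem density_independent_of_steinitz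
    (ℓ : ℕ) (hℓ : ℓ.Prime) (K : Type*) [Field K] [NumberField K]
    (hζ : ∃ ζ : K, IsPrimitiveRoot ζ ℓ)
    (𝒞 : ClassGroup (𝓞 K))
    (h𝒞 : ∃ L : IntermediateField K (AlgebraicClosure K),
      IsCyclicExt ℓ K L ∧ IsSteinitzClass K L 𝒞)
    (𝔔 : Ideal (𝓞 K))
    (h𝔔 : ∃ L : IntermediateField K (AlgebraicClosure K), IsCyclicExt ℓ K L ∧
      ∃ F : Ideal (𝓞 K), IsLPartition (Ideal.span {(ℓ : 𝓞 K)}) (relDisc K L) 𝔔 F)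
    (ρ : ℝ)
    (hρ : Tendsto (fun X : ℝ =>
      (Nat.card {L : IntermediateField K (AlgebraicClosure K) //
          IsCyclicExt ℓ K L ∧ ∃ F : Ideal (𝓞 K),
            IsLPartition (Ideal.span {(ℓ : 𝓞 K)}) (relDisc K L) 𝔔 F ∧
            (Ideal.absNorm F : ℝ) ≤ X} : ℝ) /
      (Nat.card {L : IntermediateField K (AlgebraicClosure K) //
          IsCyclicExt ℓ K L ∧ ∃ Lp F : Ideal (𝓞 K),
            IsLPartition (Ideal.span {(ℓ : 𝓞 K)}) (relDisc K L) Lp F ∧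
            (Ideal.absNorm F : ℝ) ≤ X} : ℝ)) atTop (nhds ρ)) :
    Tendsto (fun X : ℝ =>
      (Nat.card {L : IntermediateField K (AlgebraicClosure K) //
          IsCyclicExt ℓ K L ∧ IsSteinitzClass K L 𝒞 ∧ ∃ F : Ideal (𝓞 K),
            IsLPartition (Ideal.span {(ℓ : 𝓞 K)}) (relDisc K L) 𝔔 F ∧
            (Ideal.absNorm F : ℝ) ≤ X} : ℝ) /
      (Nat.card {L : IntermediateField K (AlgebraicClosure K) //
          IsCyclicExt ℓ K L ∧ IsSteinitzClass K L 𝒞 ∧ ∃ Lp F : Ideal (𝓞 K),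
            IsLPartition (Ideal.span {(ℓ : 𝓞 K)}) (relDisc K L) Lp F ∧
            (Ideal.absNorm F : ℝ) ≤ X} : ℝ)) atTop (nhds ρ) := by
  obtain ⟨ζ, hζ⟩ := hζ
  obtain ⟨δ, hδ⟩ := exists_density hℓ hζ 𝔔
  have hSt : ∀ L : IntermediateField K (AlgebraicClosure K), IsCyclicExt ℓ K L →
      ∃ c ∈ (Set.univ : Set (ClassGroup (𝓞 K))), IsSteinitzClass K L c := by
    rintro L ⟨hL, ⟨e⟩⟩
    have : NeZero ℓ := ⟨hℓ.ne_zero⟩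
    have : Finite (L ≃ₐ[K] L) := Finite.of_equiv (ZMod ℓ) (Multiplicative.ofAdd.trans e.symm.toEquiv)
    have : FiniteDimensional K L := IsGalois.finiteDimensional_of_finite K L
    have : NumberField L := NumberField.of_module_finite K L
    obtain ⟨c, hc⟩ := exists_isSteinitzClass (K := K) (L := L)
    exact ⟨c, Set.mem_univ c, hc⟩
  obtain ⟨L₀, hL₀, hc₀⟩ := h𝒞
  have h1 := hδ Set.univ ⟨L₀, hL₀, hSt L₀ hL₀⟩
  have h2 := hδ {𝒞} ⟨L₀, hL₀, 𝒞, rfl, hc₀⟩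
  have hdrop : ∀ P : IntermediateField K (AlgebraicClosure K) → Prop,
      Nat.card {L : IntermediateField K (AlgebraicClosure K) // IsCyclicExt ℓ K L ∧
        (∃ c ∈ (Set.univ : Set (ClassGroup (𝓞 K))), IsSteinitzClass K L c) ∧ P L} =
      Nat.card {L : IntermediateField K (AlgebraicClosure K) // IsCyclicExt ℓ K L ∧ P L} :=
    fun P => Nat.card_congr (Equiv.subtypeEquivRight fun L =>
      ⟨fun h => ⟨h.1, h.2.2⟩, fun h => ⟨h.1, hSt L h.1, h.2⟩⟩)
  simp only [hdrop] at h1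
  simp only [Set.mem_singleton_iff, exists_eq_left] at h2
  rwa [tendsto_nhds_unique hρ h1]

end
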